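/- Theorem 1.7. Let d₁, d₂ > 0, c₁, c₂ ∈ ℝ with c₁ ≠ c₂, and α, β, γ ∈ ℝ satisfying the sign condition β − γα/(c₂−c₁) < 0. Then there exists M₀ ≥ 1 such that for every M ≥ M₀ and every ε > 0 there exists δ > 0 with the following property: for every pair (u₀, v₀) of twice continuously differentiable functions ℝ → ℝ which together with their first and second derivatives are square integrable (i.e., (u₀,v₀) ∈ H²(ℝ,ℝ²)) and which satisfy ‖(u₀,v₀)‖_{H²} + sup_x |v₀(x)| e^{x²/M} + √(Mπ) · sup_x |u₀(x)| e^{x²/M} + sup_x |u₀'(x)| e^{x²/M} < δ, there exists a global classical solution (u,v) of the system u_t = d₁ u_xx + c₁ u_x + α u v + β u³, v_t = d₂ v_xx + c₂ v_x + γ ∂_x(u²) with initial data (u₀, v₀) such that for all t ≥ 0: sup_{x∈ℝ}(|u(x,t)| + |v(x,t)|) ≤ ε/√(1+t) and ∫_ℝ (|u(x,t)| + |v(x,t)|) dx ≤ ε. -/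

import Mathlib

open MeasureTheory Set

noncomputable section

/-- `f` is `α`-Hölder continuous. -/
def HolderCont (α : ℝ) (f : ℝ → ℝ) : Prop :=
  ∃ C : ℝ, ∀ x y : ℝ, |f x - f y| ≤ C * |x - y| ^ α

/-- `h : ℝ² → ℝ` is `C^{2,α}`: twice continuously differentiable with `α`-Hölder
continuous second-order derivatives. -/
def IsC2Holder (α : ℝ) (h : ℝ × ℝ → ℝ) : Prop :=
  ContDiff ℝ 2 h ∧
    ∃ C : ℝ, ∀ x y : ℝ × ℝ,
      ‖iteratedFDeriv ℝ 2 h x - iteratedFDeriv ℝ 2 h y‖ ≤ C * ‖x - y‖ ^ α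

/-- A classical solution of the reaction-diffusion-advection system (GRD)
`u_t = d₁ u_xx + c₁ u_x + f₁(u,v) + ∂_x(g₁(u,v))`,
`v_t = d₂ v_xx + c₂ v_x + f₂(u,v) + ∂_x(g₂(u,v))`
on `ℝ × [0,T)` with initial data `(u₀, v₀)`: jointly continuous, bounded in `x` on
each compact time interval, once continuously differentiable in `t` and twice
continuously differentiable in `x` on `ℝ × (0,T)`, satisfying both equations
pointwise there, and attaining the initial data at `t = 0`. -/
def IsClassicalSolution (d₁ d₂ c₁ c₂ : ℝ) (f₁ f₂ g₁ g₂ : ℝ × ℝ → ℝ)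
    (T : ENNReal) (u₀ v₀ : ℝ → ℝ) (u v : ℝ → ℝ → ℝ) : Prop :=
  (∀ x : ℝ, u x 0 = u₀ x) ∧ (∀ x : ℝ, v x 0 = v₀ x) ∧
  ContinuousOn (fun p : ℝ × ℝ => (u p.1 p.2, v p.1 p.2))
    {p : ℝ × ℝ | 0 ≤ p.2 ∧ ENNReal.ofReal p.2 < T} ∧
  (∀ t₁ : ℝ, 0 ≤ t₁ → ENNReal.ofReal t₁ < T →
    ∃ K : ℝ, ∀ x t : ℝ, 0 ≤ t → t ≤ t₁ → |u x t| + |v x t| ≤ K) ∧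
  ∃ ut vt ux vx uxx vxx gx hx : ℝ → ℝ → ℝ,
    (∀ x t : ℝ, 0 < t → ENNReal.ofReal t < T →
      HasDerivAt (fun τ => u x τ) (ut x t) t ∧
      HasDerivAt (fun ξ => u ξ t) (ux x t) x ∧
      HasDerivAt (fun ξ => ux ξ t) (uxx x t) x ∧
      HasDerivAt (fun ξ => g₁ (u ξ t, v ξ t)) (gx x t) x ∧
      HasDerivAt (fun τ => v x τ) (vt x t) t ∧
      HasDerivAt (fun ξ => v ξ t) (vx x t) x ∧
      HasDerivAt (fun ξ => vx ξ t) (vxx x t) x ∧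
      HasDerivAt (fun ξ => g₂ (u ξ t, v ξ t)) (hx x t) x ∧
      ut x t = d₁ * uxx x t + c₁ * ux x t + f₁ (u x t, v x t) + gx x t ∧
      vt x t = d₂ * vxx x t + c₂ * vx x t + f₂ (u x t, v x t) + hx x t) ∧
    ContinuousOn (fun p : ℝ × ℝ =>
        (ut p.1 p.2, ux p.1 p.2, uxx p.1 p.2, vt p.1 p.2, vx p.1 p.2, vxx p.1 p.2))
      {p : ℝ × ℝ | 0 < p.2 ∧ ENNReal.ofReal p.2 < T}

local notation "xA" => (-(1/2):ℝ)
local notation "xB" => (-(1/4):ℝ)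
local notation "xC" => (-(5/4):ℝ)
local notation "xD" => (-(7/4):ℝ)
local notation "xE" => (-(7/8):ℝ)
local notation "xF" => (-(3/2):ℝ)
local notation "xG" => (-(9/4):ℝ)
local notation "xH" => (-(3/4):ℝ)
local notation "eX" => Real.exp
local notation "eO" => Filter.Eventually.of_forall


def k0 (x : ℝ) : ℝ := (√(2 * Real.pi))⁻¹ * eX (-(x ^ 2) / 2)
def k1 (x : ℝ) : ℝ := x * k0 x
def k2 (x : ℝ) : ℝ := (x ^ 2 - 1) * k0 x
def ge (x : ℝ) : ℝ := eX (-(x ^ 2) / 8)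
def KB (k : ℝ → ℝ) : Prop := Continuous k ∧ ∀ x, |k x| ≤ 16 * ge x
def cT : ℝ := 16 * √(8 * Real.pi)
def TT (k f : ℝ → ℝ) (a x : ℝ) : ℝ := ∫ ξ, f (x + a * ξ) * k ξ

lemma cT_pos : 0 < cT := by unfold cT; positivity

lemma k_aux (p x : ℝ) (h : |p| ≤ 16 * (1 + x ^ 2 / 8) ^ 2) : |p * k0 x| ≤ 16 * ge x := by
  have h1 : (√(2 * Real.pi))⁻¹ ≤ 1 := by
    apply inv_le_one_of_one_le₀
    rw [Real.one_le_sqrt]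
    linarith [Real.pi_gt_three]
  have h2 : (1 + x ^ 2 / 8) ^ 2 * eX (-(x ^ 2) / 2) ≤ ge x := by
    unfold ge
    have h3 : 1 + x ^ 2 / 8 ≤ eX (x ^ 2 / 8) := by linarith [Real.add_one_le_exp (x ^ 2 / 8)]
    calc _ ≤ (eX (x ^ 2 / 8)) ^ 2 * eX (-(x ^ 2) / 2) := by gcongr
      _ = eX (x ^ 2 / 8 + x ^ 2 / 8 + -(x ^ 2) / 2) := by
        rw [Real.exp_add, Real.exp_add]; ring
      _ ≤ _ := by apply Real.exp_le_exp.mpr; nlinarith [sq_nonneg x]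
  unfold k0
  rw [abs_mul, abs_of_pos (by positivity : 0 < (√(2 * Real.pi))⁻¹ * eX (-(x ^ 2) / 2))]
  have : 0 < eX (-(x ^ 2) / 2) := Real.exp_pos _
  calc _ ≤ 16 * (1 + x ^ 2 / 8) ^ 2 * (1 * eX (-(x ^ 2) / 2)) := by gcongr
    _ ≤ _ := by linarith

lemma k0_cont : Continuous k0 := by unfold k0; fun_prop
lemma ge_cont : Continuous ge := by unfold ge; fun_prop
lemma KB0 : KB k0 := by
  refine ⟨k0_cont, fun x => ?_⟩
  have := k_aux 1 x (by rw [abs_one]; nlinarith [sq_nonneg x])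
  simpa using this
lemma KB1 : KB k1 := by
  refine ⟨by unfold k1; exact continuous_id.mul k0_cont, fun x => k_aux x x ?_⟩
  rw [abs_le]; constructor <;> nlinarith [sq_nonneg x, sq_nonneg (x - 1), sq_nonneg (x + 1)]
lemma KB2 : KB k2 := by
  refine ⟨by unfold k2; exact (by fun_prop : Continuous fun x : ℝ => x ^ 2 - 1).mul k0_cont, fun x => k_aux _ x ?_⟩
  rw [abs_le]; constructor <;> nlinarith [sq_nonneg x]
lemma k2_abs_mul (x : ℝ) : |x * k2 x| ≤ 16 * ge x := by
  have := k_aux (x * (x ^ 2 - 1)) x (by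
    have h1 : |x| ≤ 1 + x ^ 2 / 4 := by
      rw [abs_le]; constructor <;> nlinarith [sq_nonneg (x - 2), sq_nonneg (x + 2)]
    have h2 : |x ^ 2 - 1| ≤ 1 + x ^ 2 := by
      rw [abs_le]; constructor <;> nlinarith [sq_nonneg x]
    rw [abs_mul]
    calc |x| * |x ^ 2 - 1| ≤ (1 + x ^ 2 / 4) * (1 + x ^ 2) := by gcongr
      _ ≤ _ := by nlinarith [sq_nonneg x, sq_nonneg (x ^ 2)])
  unfold k2; rwa [← mul_assoc]

lemma ge_int : Integrable ge := by
  have := integrable_exp_neg_mul_sq (b := 1 / 8) (by norm_num)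
  convert this using 2 with x
  unfold ge; congr 1; ring

lemma gauss_shift (l a x : ℝ) (hl : 0 ≤ l) :
    (∫ ξ, eX (-l * (x + a * ξ) ^ 2) * ge ξ) =
      √(8 * Real.pi) * (√(1 + 8 * l * a ^ 2))⁻¹ * eX (-l * x ^ 2 / (1 + 8 * l * a ^ 2)) := by
  set D := 1 + 8 * l * a ^ 2 with hD
  have hDp : 0 < D := by positivity
  have h1 : ∀ ξ, eX (-l * (x + a * ξ) ^ 2) * ge ξ =
      eX (-l * x ^ 2 / D) * eX (-(D / 8) * (ξ + 8 * l * a * x / D) ^ 2) := by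
    intro ξ
    unfold ge
    rw [← Real.exp_add, ← Real.exp_add]
    congr 1
    field_simp
    rw [hD]; ring
  simp_rw [h1]
  rw [integral_const_mul, integral_add_right_eq_self (fun ξ => eX (-(D / 8) * ξ ^ 2)), integral_gaussian]
  rw [show Real.pi / (D / 8) = 8 * Real.pi / D by field_simp, Real.sqrt_div (by positivity)]
  ring

lemma gauss_shift_int (l a x : ℝ) (hl : 0 ≤ l) :
    Integrable (fun ξ => eX (-l * (x + a * ξ) ^ 2) * ge ξ) := by
  refine ge_int.mono' ?_ (eO fun ξ => ?_)
  · exact ((by fun_prop : Continuous fun ξ : ℝ => eX (-l * (x + a * ξ) ^ 2)).mul ge_cont).aestronglyMeasurable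
  · rw [Real.norm_of_nonneg (by unfold ge; positivity)]
    have : eX (-l * (x + a * ξ) ^ 2) ≤ 1 := Real.exp_le_one_iff.mpr (by nlinarith [mul_nonneg hl (sq_nonneg (x + a * ξ))])
    have h2 : 0 < ge ξ := Real.exp_pos _
    nlinarith

lemma TT_gauss {k f : ℝ → ℝ} (hk : KB k) {B l y₀ : ℝ} (hl : 0 ≤ l)
    (hf : ∀ y, |f y| ≤ B * eX (-l * (y - y₀) ^ 2)) (a x : ℝ) :
    |TT k f a x| ≤ B * cT * (√(1 + 8 * l * a ^ 2))⁻¹ * eX (-l * (x - y₀) ^ 2 / (1 + 8 * l * a ^ 2)) := by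
  have h := gauss_shift l a (x - y₀) hl
  have hi := gauss_shift_int l a (x - y₀) hl
  have : |TT k f a x| ≤ ∫ ξ, B * 16 * (eX (-l * (x - y₀ + a * ξ) ^ 2) * ge ξ) := by
    unfold TT
    rw [← Real.norm_eq_abs]
    refine norm_integral_le_of_norm_le (hi.const_mul _) (eO fun ξ => ?_)
    rw [Real.norm_eq_abs, abs_mul]
    have h1 := hf (x + a * ξ)
    have h2 := hk.2 ξ
    rw [show x + a * ξ - y₀ = x - y₀ + a * ξ by ring] at h1
    calc _ ≤ (B * eX (-l * (x - y₀ + a * ξ) ^ 2)) * (16 * ge ξ) :=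
          mul_le_mul h1 h2 (abs_nonneg _) ((abs_nonneg _).trans h1)
      _ = _ := by ring
  rw [integral_const_mul, h] at this
  refine this.trans (le_of_eq ?_)
  unfold cT; ring

lemma TT_bound {k f : ℝ → ℝ} (hk : KB k) {C : ℝ} (hf : ∀ y, |f y| ≤ C) (a x : ℝ) :
    |TT k f a x| ≤ C * cT := by
  have := TT_gauss hk (B := C) (l := 0) (y₀ := 0) le_rfl (by simpa using hf) a x
  simpa using this

lemma TT_integrable {k f : ℝ → ℝ} (hk : KB k) (hc : Continuous f) {C : ℝ} (hf : ∀ y, |f y| ≤ C) (a x : ℝ) :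
    Integrable (fun ξ => f (x + a * ξ) * k ξ) := by
  refine (ge_int.const_mul (C * 16)).mono' ?_ (eO fun ξ => ?_)
  · exact ((hc.comp (by fun_prop : Continuous fun ξ : ℝ => x + a * ξ)).mul hk.1).aestronglyMeasurable
  · rw [Real.norm_eq_abs, abs_mul, mul_assoc]
    exact mul_le_mul (hf _) (hk.2 ξ) (abs_nonneg _) ((abs_nonneg _).trans (hf 0))

def LocBdd (g : ℝ → ℝ → ℝ) : Prop := ∀ T : ℝ, ∃ C : ℝ, ∀ s ≤ T, ∀ x, |g s x| ≤ C

lemma TT_cont {k : ℝ → ℝ} (hk : KB k) {g : ℝ → ℝ → ℝ} (hc : Continuous (Function.uncurry g)) (hb : LocBdd g) :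
    Continuous (fun p : ℝ × ℝ × ℝ => TT k (g p.1) p.2.1 p.2.2) := by
  rw [continuous_iff_continuousAt]
  intro p
  obtain ⟨C, hC⟩ := hb (p.1 + 1)
  unfold TT
  refine continuousAt_of_dominated (bound := fun ξ => C * 16 * ge ξ) ?_ ?_ (ge_int.const_mul _) ?_
  · refine eO fun q => ?_
    exact ((hc.comp (by fun_prop : Continuous fun ξ : ℝ => (q.1, q.2.2 + q.2.1 * ξ))).mul hk.1).aestronglyMeasurable
  · have : ∀ᶠ q : ℝ × ℝ × ℝ in nhds p, q.1 < p.1 + 1 := by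
      apply (continuous_fst.tendsto p).eventually_lt_const; linarith
    filter_upwards [this] with q hq
    refine eO fun ξ => ?_
    rw [Real.norm_eq_abs, abs_mul, mul_assoc]
    exact mul_le_mul (hC _ hq.le _) (hk.2 ξ) (abs_nonneg _) ((abs_nonneg _).trans (hC _ hq.le 0))
  · refine eO fun ξ => ?_
    exact ((hc.comp (by fun_prop : Continuous fun q : ℝ × ℝ × ℝ => (q.1, q.2.2 + q.2.1 * ξ))).mul continuous_const).continuousAt

lemma TT_eq (k f : ℝ → ℝ) {a : ℝ} (ha : 0 < a) (x : ℝ) :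
    TT k f a x = a⁻¹ * ∫ z, f z * k ((z - x) / a) := by
  unfold TT
  have h1 : (∫ z, f z * k ((z - x) / a)) = ∫ z, f (z + x) * k (z / a) := by
    rw [← integral_add_right_eq_self _ x]; simp
  have h2 := Measure.integral_comp_mul_left (fun z => f (z + x) * k (z / a)) a
  rw [abs_of_pos (inv_pos.mpr ha), smul_eq_mul] at h2
  rw [h1, ← h2]
  congr 1; ext ξ
  rw [mul_div_cancel_left₀ _ ha.ne', add_comm]

lemma k0_deriv (x : ℝ) : HasDerivAt k0 (-k1 x) x := by
  unfold k0 k1 k0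
  have h : HasDerivAt (fun x : ℝ => -(x ^ 2) / 2) (-x) x := by
    have := ((hasDerivAt_pow 2 x).neg).div_const 2
    exact this.congr_deriv (by simp; ring)
  exact (h.exp.const_mul ((√(2 * Real.pi))⁻¹)).congr_deriv (by ring)

lemma k1_deriv (x : ℝ) : HasDerivAt k1 (-k2 x) x := by
  have := (hasDerivAt_id x).mul (k0_deriv x)
  exact this.congr_deriv (by unfold k2 k1; simp; ring)

lemma ge_div_int {a : ℝ} (ha : 0 < a) (x : ℝ) : Integrable (fun z => ge ((z - x) / a)) := by
  have := (ge_int.comp_div ha.ne').comp_sub_right x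
  exact this

lemma ge_le {u v : ℝ} (h : v ^ 2 ≤ u ^ 2) : ge u ≤ ge v := by
  unfold ge; apply Real.exp_le_exp.mpr; linarith

lemma TT_deriv_x {k kd f : ℝ → ℝ} (hk : KB k) (hkd : KB kd) (hd : ∀ x, HasDerivAt k (-kd x) x)
    (hc : Continuous f) {C : ℝ} (hf : ∀ y, |f y| ≤ C) {a : ℝ} (ha : 0 < a) (x : ℝ) :
    HasDerivAt (fun x => TT k f a x) (a⁻¹ * TT kd f a x) x := by
  have hC : 0 ≤ C := (abs_nonneg _).trans (hf 0)
  have e : (fun x => TT k f a x) = fun x => a⁻¹ * ∫ z, f z * k ((z - x) / a) := by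
    ext x; exact TT_eq k f ha x
  rw [e, TT_eq kd f ha x]
  apply HasDerivAt.const_mul
  rw [← integral_const_mul]
  have key : ∀ z y, y ∈ Metric.ball x a → ge ((z - y) / a) ≤ eX (1 / 8) * ge ((z - x) / (2 * a)) := by
    intro z y hy
    rw [Metric.mem_ball, Real.dist_eq, abs_lt] at hy
    unfold ge
    rw [← Real.exp_add]
    apply Real.exp_le_exp.mpr
    have h1 : ((z - y) / a) = 2 * ((z - x) / (2 * a)) - (y - x) / a := by field_simp; ring
    have h2 : ((y - x) / a) ^ 2 ≤ 1 := by
      rw [div_pow, div_le_one (by positivity)]; nlinarith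
    rw [h1]
    nlinarith [sq_nonneg ((z - x) / (2 * a) - ((y - x) / a)), sq_nonneg ((z - x) / (2 * a))]
  have hm : ∀ y, AEStronglyMeasurable (fun z => f z * k ((z - y) / a)) := fun y =>
    (hc.mul (hk.1.comp (by fun_prop : Continuous fun z : ℝ => (z - y) / a))).aestronglyMeasurable
  refine (hasDerivAt_integral_of_dominated_loc_of_deriv_le (s := Metric.ball x a)
    (F := fun y z => f z * k ((z - y) / a)) (F' := fun y z => a⁻¹ * (f z * kd ((z - y) / a)))
    (bound := fun z => a⁻¹ * (C * 16 * eX (1 / 8)) * ge ((z - x) / (2 * a)))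
    (Metric.ball_mem_nhds x ha) (eO hm) ?_ ?_ ?_ ?_ ?_).2
  · refine ((ge_div_int ha x).const_mul (C * 16)).mono' (hm x) (eO fun z => ?_)
    rw [Real.norm_eq_abs, abs_mul, mul_assoc]
    exact mul_le_mul (hf _) (hk.2 _) (abs_nonneg _) hC
  · exact (continuous_const.mul (hc.mul (hkd.1.comp (by fun_prop : Continuous fun z : ℝ => (z - x) / a)))).aestronglyMeasurable
  · refine eO fun z y hy => ?_
    rw [Real.norm_eq_abs, abs_mul, abs_mul, abs_of_pos (inv_pos.mpr ha)]
    have h1 := key z y hy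
    have h2 := hkd.2 ((z - y) / a)
    have h3 : |kd ((z - y) / a)| ≤ 16 * (eX (1 / 8) * ge ((z - x) / (2 * a))) := by linarith
    calc _ ≤ a⁻¹ * (C * (16 * (eX (1 / 8) * ge ((z - x) / (2 * a))))) := by
          gcongr; exact hf z
      _ = _ := by ring
  · exact (ge_div_int (by positivity) x).const_mul _
  · refine eO fun z y _ => ?_
    have h1 : HasDerivAt (fun y => (z - y) / a) (-1 / a) y := by
      simpa using ((hasDerivAt_id y).const_sub z).div_const a
    have := ((hd ((z - y) / a)).comp y h1).const_mul (f z)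
    exact this.congr_deriv (by field_simp)

lemma TT_deriv_a {f : ℝ → ℝ} (hc : Continuous f) {C : ℝ} (hf : ∀ y, |f y| ≤ C) {a : ℝ} (ha : 0 < a) (x : ℝ) :
    HasDerivAt (fun a => TT k0 f a x) (a⁻¹ * TT k2 f a x) a := by
  have hC : 0 ≤ C := (abs_nonneg _).trans (hf 0)
  have e : (fun a => TT k0 f a x) =ᶠ[nhds a] fun a => ∫ z, a⁻¹ * (f z * k0 ((z - x) / a)) := by
    filter_upwards [lt_mem_nhds ha] with b hb
    rw [TT_eq k0 f hb x, integral_const_mul]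
  refine HasDerivAt.congr_of_eventuallyEq ?_ e
  rw [TT_eq k2 f ha x, ← mul_assoc, ← integral_const_mul]
  have hm : ∀ b, AEStronglyMeasurable (fun z => b⁻¹ * (f z * k0 ((z - x) / b))) := fun y =>
    (continuous_const.mul (hc.mul (k0_cont.comp (by fun_prop : Continuous fun z : ℝ => (z - x) / y)))).aestronglyMeasurable
  have hs : ∀ b ∈ Metric.ball a (a / 2), a / 2 < b ∧ b < 2 * a := by
    intro b hb
    rw [Metric.mem_ball, Real.dist_eq, abs_lt] at hb
    constructor <;> linarith
  refine (hasDerivAt_integral_of_dominated_loc_of_deriv_le (s := Metric.ball a (a / 2))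
    (F := fun b z => b⁻¹ * (f z * k0 ((z - x) / b))) (F' := fun b z => b⁻¹ * b⁻¹ * (f z * k2 ((z - x) / b)))
    (bound := fun z => (a / 2)⁻¹ * (a / 2)⁻¹ * (C * 16) * ge ((z - x) / (2 * a)))
    (Metric.ball_mem_nhds a (by linarith)) (eO hm) ?_ ?_ ?_ ?_ ?_).2
  · refine Integrable.const_mul ?_ _
    refine ((ge_div_int ha x).const_mul (C * 16)).mono' ?_ (eO fun z => ?_)
    · exact (hc.mul (k0_cont.comp (by fun_prop : Continuous fun z : ℝ => (z - x) / a))).aestronglyMeasurable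
    rw [Real.norm_eq_abs, abs_mul, mul_assoc]
    exact mul_le_mul (hf _) (KB0.2 _) (abs_nonneg _) hC
  · exact (continuous_const.mul (hc.mul (KB2.1.comp (by fun_prop : Continuous fun z : ℝ => (z - x) / a)))).aestronglyMeasurable
  · refine eO fun z b hb => ?_
    obtain ⟨h1, h2⟩ := hs b hb
    have hb0 : 0 < b := by linarith
    have h3 : ge ((z - x) / b) ≤ ge ((z - x) / (2 * a)) := by
      apply ge_le
      rw [div_pow, div_pow]
      gcongr
    have h4 : b⁻¹ ≤ (a / 2)⁻¹ := by gcongr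
    rw [Real.norm_eq_abs, abs_mul, abs_mul, abs_mul, abs_of_pos (inv_pos.mpr hb0)]
    have h5 := KB2.2 ((z - x) / b)
    calc _ ≤ (a / 2)⁻¹ * (a / 2)⁻¹ * (C * (16 * ge ((z - x) / (2 * a)))) := by
          gcongr
          · exact hf z
          · linarith
      _ = _ := by ring
  · exact (ge_div_int (by positivity) x).const_mul _
  · refine eO fun z b hb => ?_
    obtain ⟨h1, h2⟩ := hs b hb
    have hb0 : b ≠ 0 := by linarith
    have h6 : HasDerivAt (fun b => (z - x) / b) (-(z - x) / b ^ 2) b := by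
      have := (hasDerivAt_inv hb0).const_mul (z - x)
      simp only [div_eq_mul_inv]
      exact this.congr_deriv (by ring)
    have := (hasDerivAt_inv hb0).mul (((k0_deriv ((z - x) / b)).comp b h6).const_mul (f z))
    refine this.congr_deriv ?_
    unfold k2 k1
    simp only [Function.comp]
    field_simp
    ring

lemma TT_deriv_f {k f f' : ℝ → ℝ} (hk : KB k) (hd : ∀ x, HasDerivAt f (f' x) x) (hc : Continuous f')
    {C C' : ℝ} (hf : ∀ y, |f y| ≤ C) (hf' : ∀ y, |f' y| ≤ C') (a x : ℝ) :
    HasDerivAt (fun x => TT k f a x) (TT k f' a x) x := by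
  have hcf : Continuous f := continuous_iff_continuousAt.mpr fun x => (hd x).continuousAt
  unfold TT
  refine (hasDerivAt_integral_of_dominated_loc_of_deriv_le (s := univ)
    (F := fun x ξ => f (x + a * ξ) * k ξ) (F' := fun x ξ => f' (x + a * ξ) * k ξ)
    (bound := fun z => C' * 16 * ge z)
    Filter.univ_mem (eO fun y => ?_) ?_ ?_ ?_ (ge_int.const_mul _) ?_).2
  · exact (TT_integrable hk hcf hf a y).aestronglyMeasurable
  · exact (TT_integrable hk hcf hf a x)
  · exact (TT_integrable hk hc hf' a x).aestronglyMeasurable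
  · refine eO fun ξ y _ => ?_
    rw [Real.norm_eq_abs, abs_mul, mul_assoc]
    exact mul_le_mul (hf' _) (hk.2 ξ) (abs_nonneg _) ((abs_nonneg _).trans (hf' 0))
  · refine eO fun ξ y _ => ?_
    have := ((hd (y + a * ξ)).comp_add_const y (a * ξ)).mul_const (k ξ)
    exact this

lemma TT_shift {k kd f f' : ℝ → ℝ} (hk : KB k) (hkd : KB kd) (hkk : ∀ x, HasDerivAt k (-kd x) x)
    (hd : ∀ x, HasDerivAt f (f' x) x) (hc : Continuous f')
    {C C' : ℝ} (hf : ∀ y, |f y| ≤ C) (hf' : ∀ y, |f' y| ≤ C') {a : ℝ} (ha : 0 < a) (x : ℝ) :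
    a⁻¹ * TT kd f a x = TT k f' a x :=
  (TT_deriv_x hk hkd hkk (continuous_iff_continuousAt.mpr fun x => (hd x).continuousAt) hf ha x).unique
    (TT_deriv_f hk hd hc hf hf' a x)

lemma int_k2 : ∫ ξ, k2 ξ = 0 := by
  have := TT_shift KB1 KB2 k1_deriv (f := fun _ => 1) (f' := fun _ => 0) (fun x => hasDerivAt_const x 1)
    continuous_const (C := 1) (C' := 0) (by simp) (by simp) one_pos 0
  simpa [TT] using this

lemma int_k0 : ∫ ξ, k0 ξ = 1 := by
  unfold k0
  rw [integral_const_mul]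
  have := integral_gaussian (1 / 2)
  rw [show (fun x : ℝ => eX (-(x ^ 2) / 2)) = fun x : ℝ => eX (-(1 / 2) * x ^ 2) by ext x; congr 1; ring, this]
  rw [show Real.pi / (1 / 2) = 2 * Real.pi by ring]
  exact inv_mul_cancel₀ (by positivity)

lemma TT_zero (f : ℝ → ℝ) (x : ℝ) : TT k0 f 0 x = f x := by
  simp [TT, integral_const_mul, int_k0]

lemma TT_lip {f : ℝ → ℝ} (hc : Continuous f) {C L : ℝ} (hf : ∀ y, |f y| ≤ C)
    (hL : ∀ x y, |f x - f y| ≤ L * |x - y|) {a : ℝ} (ha : 0 ≤ a) (x : ℝ) :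
    |TT k2 f a x| ≤ L * a * cT := by
  have hL0 : 0 ≤ L := by have := (abs_nonneg _).trans (hL 1 0); simpa using this
  have h0 : TT k2 f a x = ∫ ξ, (f (x + a * ξ) - f x) * k2 ξ := by
    unfold TT
    simp_rw [sub_mul]
    have hi : Integrable k2 := (ge_int.const_mul 16).mono' KB2.1.aestronglyMeasurable (eO KB2.2)
    rw [integral_sub (TT_integrable KB2 hc hf a x) (hi.const_mul _), integral_const_mul, int_k2]; simp
  have hg : ∫ ξ, ge ξ = √(8 * Real.pi) := by
    have := gauss_shift 0 0 0 le_rfl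
    simpa using this
  rw [h0]
  have : |∫ ξ, (f (x + a * ξ) - f x) * k2 ξ| ≤ ∫ ξ, L * a * 16 * ge ξ := by
    rw [← Real.norm_eq_abs]
    refine norm_integral_le_of_norm_le (ge_int.const_mul _) (eO fun ξ => ?_)
    rw [Real.norm_eq_abs, abs_mul]
    have h1 := hL (x + a * ξ) x
    rw [add_sub_cancel_left, abs_mul, abs_of_nonneg ha] at h1
    have h2 := k2_abs_mul ξ
    rw [abs_mul] at h2
    calc _ ≤ (L * (a * |ξ|)) * |k2 ξ| := by gcongr
      _ = L * a * (|ξ| * |k2 ξ|) := by ring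
      _ ≤ L * a * (16 * ge ξ) := by gcongr
      _ = _ := by ring
  rw [integral_const_mul, hg] at this
  refine this.trans (le_of_eq ?_)
  unfold cT; ring

def wt (p q θ : ℝ) : ℝ := (1 - θ) ^ (-p) * θ ^ (-q)
def bt (p q : ℝ) : ℝ := ∫ θ in (0:ℝ)..1, wt p q θ
def CV (K : ℝ → ℝ → ℝ → ℝ) (t x : ℝ) : ℝ := ∫ s in (0:ℝ)..t, K s (t - s) x
def KC (K : ℝ → ℝ → ℝ → ℝ) : Prop :=
  ContinuousOn (fun p : ℝ × ℝ × ℝ => K p.1 p.2.1 p.2.2) {p | 0 < p.1 ∧ 0 < p.2.1}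
def KBd (K : ℝ → ℝ → ℝ → ℝ) : Prop :=
  ∀ T : ℝ, ∃ B : ℝ, ∀ s r x, 0 < s → 0 < r → s ≤ T → r ≤ T → |K s r x| ≤ B * (r ^ xA * s ^ xA)

lemma ae_ne1 (a : ℝ) : ∀ᵐ θ : ℝ, θ ≠ a := by
  have : ({a}ᶜ : Set ℝ) ∈ ae (volume : Measure ℝ) := compl_mem_ae_iff.mpr (by simp)
  exact this

lemma wt_int {p q : ℝ} (hp : p < 1) (hq : q < 1) : IntervalIntegrable (wt p q) volume 0 1 := by
  have h := (Complex.betaIntegral_convergent (u := ((1 - q : ℝ) : ℂ)) (v := ((1 - p : ℝ) : ℂ))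
    (by simpa using hq) (by simpa using hp)).norm
  rw [intervalIntegrable_iff_integrableOn_Ioo_of_le zero_le_one] at h ⊢
  refine h.congr_fun (fun θ hθ => ?_) measurableSet_Ioo
  simp only
  rw [norm_mul]
  have e1 : ‖((θ:ℂ)) ^ (((1 - q : ℝ) : ℂ) - 1)‖ = θ ^ (-q) := by
    rw [Complex.norm_cpow_eq_rpow_re_of_pos hθ.1]; simp
  have e2 : ‖((1 - (θ:ℂ))) ^ (((1 - p : ℝ) : ℂ) - 1)‖ = (1 - θ) ^ (-p) := by
    rw [show (1 - (θ:ℂ)) = ((1 - θ : ℝ) : ℂ) by push_cast; ring, Complex.norm_cpow_eq_rpow_re_of_pos (by linarith [hθ.2])]; simp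
  rw [e1, e2, wt, mul_comm]

lemma wt_nonneg (p q : ℝ) {θ : ℝ} (h0 : 0 ≤ θ) (h1 : θ ≤ 1) : 0 ≤ wt p q θ :=
  mul_nonneg (Real.rpow_nonneg (by linarith) _) (Real.rpow_nonneg h0 _)

lemma bt_nonneg (p q : ℝ) : 0 ≤ bt p q :=
  intervalIntegral.integral_nonneg zero_le_one fun θ hθ => wt_nonneg p q hθ.1 hθ.2

lemma CV_eq (K : ℝ → ℝ → ℝ → ℝ) (t x : ℝ) :
    CV K t x = ∫ θ in (0:ℝ)..1, t * K (t * θ) (t * (1 - θ)) x := by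
  have := intervalIntegral.mul_integral_comp_mul_left (a := 0) (b := 1) (f := fun s => K s (t - s) x) t
  rw [intervalIntegral.integral_const_mul]
  simp only [mul_zero, mul_one] at this
  rw [CV, ← this]
  congr 2; ext θ; congr 1; ring

lemma wt_scale (p q : ℝ) {t θ : ℝ} (ht : 0 < t) (h0 : 0 < θ) (h1 : θ < 1) :
    t * ((t * (1 - θ)) ^ (-p) * (t * θ) ^ (-q)) = t ^ (1 - p - q) * wt p q θ := by
  rw [Real.mul_rpow ht.le (by linarith), Real.mul_rpow ht.le h0.le, wt,
    show 1 - p - q = 1 + (-p) + (-q) by ring, Real.rpow_add ht, Real.rpow_add ht, Real.rpow_one]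
  ring

lemma CV_bound {K : ℝ → ℝ → ℝ → ℝ} {p q t x B : ℝ} (hp : p < 1) (hq : q < 1) (ht : 0 < t)
    (h : ∀ s r, 0 < s → 0 < r → s + r = t → |K s r x| ≤ B * (r ^ (-p) * s ^ (-q))) :
    |CV K t x| ≤ B * t ^ (1 - p - q) * bt p q := by
  rw [CV_eq, bt, ← intervalIntegral.integral_const_mul, ← Real.norm_eq_abs]
  refine intervalIntegral.norm_integral_le_of_norm_le zero_le_one ?_ ((wt_int hp hq).const_mul _)
  filter_upwards [ae_ne1 1] with θ h1 hθ
  have h2 : θ < 1 := lt_of_le_of_ne hθ.2 h1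
  have := h (t * θ) (t * (1 - θ)) (mul_pos ht hθ.1) (mul_pos ht (by linarith)) (by ring)
  rw [Real.norm_eq_abs, abs_mul, abs_of_pos ht]
  calc _ ≤ t * _ := mul_le_mul_of_nonneg_left this ht.le
    _ = _ := by rw [mul_left_comm, wt_scale p q ht hθ.1 h2]; ring

lemma KC_sec {K : ℝ → ℝ → ℝ → ℝ} (hc : KC K) {t x : ℝ} (ht : 0 < t) :
    AEStronglyMeasurable (fun θ => t * K (t * θ) (t * (1 - θ)) x) (volume.restrict (uIoc 0 1)) := by
  rw [uIoc_of_le zero_le_one, ← restrict_Ioo_eq_restrict_Ioc]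
  refine ContinuousOn.aestronglyMeasurable ?_ measurableSet_Ioo
  refine continuousOn_const.mul (hc.comp (f := fun θ => (t * θ, t * (1 - θ), x)) (by fun_prop) ?_)
  intro θ hθ
  exact ⟨mul_pos ht hθ.1, mul_pos ht (by linarith [hθ.2])⟩

lemma KB_dom {K : ℝ → ℝ → ℝ → ℝ} {B T : ℝ}
    (h : ∀ s r x, 0 < s → 0 < r → s ≤ T → r ≤ T → |K s r x| ≤ B * (r ^ xA * s ^ xA))
    {t : ℝ} (ht : 0 < t) (hT : t ≤ T) (x : ℝ) :
    ∀ᵐ θ : ℝ, θ ∈ uIoc (0:ℝ) 1 → ‖t * K (t * θ) (t * (1 - θ)) x‖ ≤ B * wt (1/2) (1/2) θ := by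
  filter_upwards [ae_ne1 1] with θ h1 hθ
  rw [uIoc_of_le zero_le_one] at hθ
  have h2 : θ < 1 := lt_of_le_of_ne hθ.2 h1
  have := h (t * θ) (t * (1 - θ)) x (mul_pos ht hθ.1) (mul_pos ht (by linarith)) (by nlinarith [hθ.1]) (by nlinarith [hθ.1])
  rw [Real.norm_eq_abs, abs_mul, abs_of_pos ht]
  calc _ ≤ t * _ := mul_le_mul_of_nonneg_left this ht.le
    _ = _ := by rw [mul_left_comm, wt_scale _ _ ht hθ.1 h2]; norm_num

lemma CV_bd {K : ℝ → ℝ → ℝ → ℝ} {B T : ℝ}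
    (h : ∀ s r x, 0 < s → 0 < r → s ≤ T → r ≤ T → |K s r x| ≤ B * (r ^ xA * s ^ xA))
    {t : ℝ} (ht : 0 < t) (hT : t ≤ T) (x : ℝ) : |CV K t x| ≤ B * bt (1/2) (1/2) := by
  have := CV_bound (K := K) (p := 1/2) (q := 1/2) (x := x) (B := B) (by norm_num) (by norm_num) ht (fun s r hs hr hsr => h s r x hs hr (by linarith) (by linarith))
  norm_num at this ⊢
  exact this

lemma CV_ii {K : ℝ → ℝ → ℝ → ℝ} (hc : KC K) (hb : KBd K) {t : ℝ} (ht : 0 < t) (x : ℝ) :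
    IntervalIntegrable (fun θ => t * K (t * θ) (t * (1 - θ)) x) volume 0 1 := by
  obtain ⟨B, hB⟩ := hb t
  refine IntervalIntegrable.mono_fun' ((wt_int (p := 1/2) (q := 1/2) (by norm_num) (by norm_num)).const_mul B) (KC_sec hc ht) ?_
  exact (ae_restrict_iff' measurableSet_uIoc).mpr (KB_dom hB ht le_rfl x)

lemma CV_contAt {K : ℝ → ℝ → ℝ → ℝ} (hc : KC K) (hb : KBd K) {t : ℝ} (ht : 0 < t) (x : ℝ) :
    ContinuousAt (fun p : ℝ × ℝ => CV K p.1 p.2) (t, x) := by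
  obtain ⟨B, hB⟩ := hb (2 * t)
  have e : (fun p : ℝ × ℝ => CV K p.1 p.2) = fun p => ∫ θ in (0:ℝ)..1, p.1 * K (p.1 * θ) (p.1 * (1 - θ)) p.2 := by
    ext p; exact CV_eq K p.1 p.2
  rw [e]
  have ev : ∀ᶠ p : ℝ × ℝ in nhds (t, x), 0 < p.1 ∧ p.1 < 2 * t :=
    ((continuous_fst.tendsto (t, x)).eventually_const_lt ht).and
      ((continuous_fst.tendsto (t, x)).eventually_lt_const (by simp only; linarith))
  refine intervalIntegral.continuousAt_of_dominated_interval (bound := fun θ => B * wt (1/2) (1/2) θ) ?_ ?_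
    ((wt_int (by norm_num) (by norm_num)).const_mul B) ?_
  · filter_upwards [ev] with p hp using KC_sec hc hp.1
  · filter_upwards [ev] with p hp using KB_dom hB hp.1 hp.2.le p.2
  · filter_upwards [ae_ne1 1] with θ h1 hθ
    rw [uIoc_of_le zero_le_one] at hθ
    have h2 : θ < 1 := lt_of_le_of_ne hθ.2 h1
    refine continuousAt_fst.mul ?_
    have ho : IsOpen {p : ℝ × ℝ × ℝ | 0 < p.1 ∧ 0 < p.2.1} :=
      (isOpen_lt continuous_const continuous_fst).inter (isOpen_lt continuous_const (continuous_fst.comp continuous_snd))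
    have h3 := hc.continuousAt (ho.mem_nhds (show (t * θ, t * (1 - θ), x) ∈ _ from ⟨mul_pos ht hθ.1, mul_pos ht (by linarith)⟩))
    exact ContinuousAt.comp (f := fun p : ℝ × ℝ => (p.1 * θ, p.1 * (1 - θ), p.2)) (x := (t, x)) h3 (by fun_prop)

lemma CV_deriv {K K' : ℝ → ℝ → ℝ → ℝ} (hc : KC K) (hb : KBd K) (hc' : KC K') (hb' : KBd K')
    (hd : ∀ s r x, 0 < s → 0 < r → HasDerivAt (fun y => K s r y) (K' s r x) x) {t : ℝ} (ht : 0 < t) (x : ℝ) :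
    HasDerivAt (fun y => CV K t y) (CV K' t x) x := by
  obtain ⟨B, hB⟩ := hb' t
  have e : (fun y => CV K t y) = fun y => ∫ θ in (0:ℝ)..1, t * K (t * θ) (t * (1 - θ)) y := by
    ext p; exact CV_eq K t p
  rw [e, CV_eq]
  refine (intervalIntegral.hasDerivAt_integral_of_dominated_loc_of_deriv_le (s := univ)
    (F := fun y θ => t * K (t * θ) (t * (1 - θ)) y) (F' := fun y θ => t * K' (t * θ) (t * (1 - θ)) y)
    (bound := fun θ => B * wt (1/2) (1/2) θ) Filter.univ_mem (eO fun y => KC_sec hc ht)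
    (CV_ii hc hb ht x) (KC_sec hc' ht) ?_ ((wt_int (by norm_num) (by norm_num)).const_mul B) ?_).2
  · filter_upwards [ae_ne1 1] with θ h1 hθ y _
    rw [uIoc_of_le zero_le_one] at hθ
    have h2 : θ < 1 := lt_of_le_of_ne hθ.2 h1
    have := hB (t * θ) (t * (1 - θ)) y (mul_pos ht hθ.1) (mul_pos ht (by linarith)) (by nlinarith [hθ.1]) (by nlinarith [hθ.1])
    rw [Real.norm_eq_abs, abs_mul, abs_of_pos ht]
    calc _ ≤ t * _ := mul_le_mul_of_nonneg_left this ht.le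
      _ = _ := by rw [mul_left_comm, wt_scale _ _ ht hθ.1 h2]; norm_num
  · filter_upwards [ae_ne1 1] with θ h1 hθ y _
    rw [uIoc_of_le zero_le_one] at hθ
    have h2 : θ < 1 := lt_of_le_of_ne hθ.2 h1
    exact (hd _ _ y (mul_pos ht hθ.1) (mul_pos ht (by linarith))).const_mul t

def Ar (d r : ℝ) : ℝ := √(2 * d * r)
def E0 (d : ℝ) (g : ℝ → ℝ → ℝ) (s r x : ℝ) : ℝ := TT k0 (g s) (Ar d r) x
def E1 (d : ℝ) (g : ℝ → ℝ → ℝ) (s r x : ℝ) : ℝ := (Ar d r)⁻¹ * TT k1 (g s) (Ar d r) x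
def E2 (d : ℝ) (g : ℝ → ℝ → ℝ) (s r x : ℝ) : ℝ := (Ar d r)⁻¹ * ((Ar d r)⁻¹ * TT k2 (g s) (Ar d r) x)
def GC (g : ℝ → ℝ → ℝ) : Prop := Continuous (Function.uncurry g) ∧ LocBdd g
def SL (g : ℝ → ℝ → ℝ) : Prop :=
  ∀ T : ℝ, ∃ L : ℝ, ∀ s x y, 0 < s → s ≤ T → |g s x - g s y| ≤ L * s ^ xA * |x - y|
def KB1' (K : ℝ → ℝ → ℝ → ℝ) : Prop :=
  ∀ T : ℝ, ∃ B : ℝ, ∀ s r x, 0 < s → 0 < r → s ≤ T → r ≤ T → |K s r x| ≤ B * r ^ xA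

lemma Ar_pos {d r : ℝ} (hd : 0 < d) (hr : 0 < r) : 0 < Ar d r := by unfold Ar; positivity
lemma Ar_nonneg (d r : ℝ) : 0 ≤ Ar d r := Real.sqrt_nonneg _
lemma Ar_zero (d : ℝ) : Ar d 0 = 0 := by simp [Ar]
lemma Ar_sq {d r : ℝ} (hd : 0 < d) (hr : 0 ≤ r) : Ar d r ^ 2 = 2 * d * r := Real.sq_sqrt (by positivity)
lemma Ar_cont (d : ℝ) : Continuous (Ar d) := by unfold Ar; fun_prop
lemma Ar_inv {d r : ℝ} (hd : 0 < d) (hr : 0 ≤ r) : (Ar d r)⁻¹ = (√(2 * d))⁻¹ * r ^ xA := by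
  unfold Ar
  rw [Real.sqrt_mul (by positivity), mul_inv, Real.rpow_neg hr, ← Real.sqrt_eq_rpow]
lemma Ar_deriv {d r : ℝ} (hd : 0 < d) (hr : 0 < r) : HasDerivAt (Ar d) (d * (Ar d r)⁻¹) r := by
  unfold Ar
  have h : HasDerivAt (fun r => 2 * d * r) (2 * d) r := by simpa using (hasDerivAt_id r).const_mul (2 * d)
  refine (h.sqrt (by positivity)).congr_deriv ?_
  field_simp

lemma one_le_half {T s : ℝ} (hs : 0 < s) (h : s ≤ T) : 1 ≤ √T * s ^ xA := by
  rw [Real.rpow_neg hs.le, ← Real.sqrt_eq_rpow]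
  rw [le_mul_inv_iff₀ (by positivity), one_mul]
  exact Real.sqrt_le_sqrt h

lemma KB1'.kbd {K : ℝ → ℝ → ℝ → ℝ} (h : KB1' K) : KBd K := by
  intro T
  obtain ⟨B, hB⟩ := h T
  refine ⟨B * √T, fun s r x hs hr hsT hrT => (hB s r x hs hr hsT hrT).trans ?_⟩
  have h1 := one_le_half hs hsT
  have h2 := (abs_nonneg _).trans (hB s r x hs hr hsT hrT)
  nlinarith

lemma bdd_KB1 {K : ℝ → ℝ → ℝ → ℝ}
    (h : ∀ T : ℝ, ∃ B : ℝ, ∀ s r x, 0 < s → 0 < r → s ≤ T → r ≤ T → |K s r x| ≤ B) : KB1' K := by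
  intro T
  obtain ⟨B, hB⟩ := h T
  refine ⟨B * √T, fun s r x hs hr hsT hrT => (hB s r x hs hr hsT hrT).trans ?_⟩
  have h1 := one_le_half hr hrT
  have h2 := (abs_nonneg _).trans (hB s r x hs hr hsT hrT)
  nlinarith

lemma E0_cont {d : ℝ} {g : ℝ → ℝ → ℝ} (hg : GC g) :
    Continuous (fun p : ℝ × ℝ × ℝ => E0 d g p.1 p.2.1 p.2.2) := by
  have := TT_cont KB0 hg.1 hg.2
  exact this.comp (by have := Ar_cont d; fun_prop : Continuous fun p : ℝ × ℝ × ℝ => (p.1, Ar d p.2.1, p.2.2))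
lemma E0_KC {d : ℝ} {g : ℝ → ℝ → ℝ} (hg : GC g) : KC (E0 d g) := (E0_cont hg).continuousOn
lemma E_cont_aux {k : ℝ → ℝ} (hk : KB k) {d : ℝ} {g : ℝ → ℝ → ℝ} (hd : 0 < d) (hg : GC g) :
    KC (fun s r x => (Ar d r)⁻¹ * TT k (g s) (Ar d r) x) := by
  have h1 := (TT_cont hk hg.1 hg.2).comp (by have := Ar_cont d; fun_prop : Continuous fun p : ℝ × ℝ × ℝ => (p.1, Ar d p.2.1, p.2.2))
  refine ContinuousOn.mul (ContinuousOn.inv₀ ?_ ?_) h1.continuousOn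
  · exact ((Ar_cont d).comp (continuous_fst.comp continuous_snd)).continuousOn
  · intro p hp; exact (Ar_pos hd hp.2).ne'
lemma E1_KC {d : ℝ} {g : ℝ → ℝ → ℝ} (hd : 0 < d) (hg : GC g) : KC (E1 d g) := E_cont_aux KB1 hd hg
lemma E2_KC {d : ℝ} {g : ℝ → ℝ → ℝ} (hd : 0 < d) (hg : GC g) : KC (E2 d g) := by
  refine ContinuousOn.mul (ContinuousOn.inv₀ ?_ ?_) (E_cont_aux KB2 hd hg)
  · exact ((Ar_cont d).comp (continuous_fst.comp continuous_snd)).continuousOn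
  · intro p hp; exact (Ar_pos hd hp.2).ne'

lemma E0_bd {d : ℝ} {g : ℝ → ℝ → ℝ} (hg : GC g) : KB1' (E0 d g) := by
  apply bdd_KB1
  intro T
  obtain ⟨C, hC⟩ := hg.2 T
  exact ⟨C * cT, fun s r x _ _ hs _ => TT_bound KB0 (hC s hs) _ _⟩
lemma E1_le {d : ℝ} (hd : 0 < d) {g : ℝ → ℝ → ℝ} {s r C : ℝ} (hr : 0 < r) (hC : ∀ y, |g s y| ≤ C) (x : ℝ) :
    |E1 d g s r x| ≤ C * cT * (√(2 * d))⁻¹ * r ^ xA := by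
  unfold E1
  rw [abs_mul, abs_of_pos (inv_pos.mpr (Ar_pos hd hr)), Ar_inv hd hr.le]
  have := TT_bound KB1 hC (Ar d r) x
  have h0 : 0 ≤ (√(2 * d))⁻¹ * r ^ xA := by positivity
  nlinarith
lemma E1_bd {d : ℝ} (hd : 0 < d) {g : ℝ → ℝ → ℝ} (hg : GC g) : KB1' (E1 d g) := by
  intro T
  obtain ⟨C, hC⟩ := hg.2 T
  exact ⟨_, fun s r x _ hr hs _ => E1_le hd hr (hC s hs) x⟩
lemma E2_le {d : ℝ} (hd : 0 < d) {g : ℝ → ℝ → ℝ} {s r C L : ℝ} (hr : 0 < r) (hc : Continuous (g s)) (hC : ∀ y, |g s y| ≤ C)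
    (hL : ∀ x y, |g s x - g s y| ≤ L * |x - y|) (x : ℝ) :
    |E2 d g s r x| ≤ L * cT * (√(2 * d))⁻¹ * r ^ xA := by
  unfold E2
  have hA := Ar_pos hd hr
  rw [abs_mul, abs_mul, abs_of_pos (inv_pos.mpr hA)]
  have := TT_lip hc hC hL (Ar_nonneg d r) x
  calc _ ≤ (Ar d r)⁻¹ * ((Ar d r)⁻¹ * (L * Ar d r * cT)) := by gcongr
    _ = L * cT * (Ar d r)⁻¹ := by field_simp
    _ = _ := by rw [Ar_inv hd hr.le]; ring
lemma GC.sec {g : ℝ → ℝ → ℝ} (hg : GC g) (s : ℝ) : Continuous (g s) :=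
  hg.1.comp (by fun_prop : Continuous fun x : ℝ => (s, x))
lemma E2_bd {d : ℝ} (hd : 0 < d) {g : ℝ → ℝ → ℝ} (hg : GC g) (hL : SL g) : KBd (E2 d g) := by
  intro T
  obtain ⟨C, hC⟩ := hg.2 T
  obtain ⟨L, hL⟩ := hL T
  refine ⟨L * cT * (√(2 * d))⁻¹, fun s r x hs hr hsT _ => ?_⟩
  refine (E2_le hd hr (hg.sec s) (hC s hsT) (fun x y => hL s x y hs hsT) x).trans (le_of_eq ?_)
  ring

lemma E0_dx {d : ℝ} (hd : 0 < d) {g : ℝ → ℝ → ℝ} (hg : GC g) (s r x : ℝ) (hr : 0 < r) :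
    HasDerivAt (fun y => E0 d g s r y) (E1 d g s r x) x := by
  obtain ⟨C, hC⟩ := hg.2 s
  exact TT_deriv_x KB0 KB1 k0_deriv (hg.sec s) (hC s le_rfl) (Ar_pos hd hr) x
lemma E1_dx {d : ℝ} (hd : 0 < d) {g : ℝ → ℝ → ℝ} (hg : GC g) (s r x : ℝ) (hr : 0 < r) :
    HasDerivAt (fun y => E1 d g s r y) (E2 d g s r x) x := by
  obtain ⟨C, hC⟩ := hg.2 s
  exact (TT_deriv_x KB1 KB2 k1_deriv (hg.sec s) (hC s le_rfl) (Ar_pos hd hr) x).const_mul _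
lemma E0_dr {d : ℝ} (hd : 0 < d) {g : ℝ → ℝ → ℝ} (hg : GC g) (s r x : ℝ) (hr : 0 < r) :
    HasDerivAt (fun r => E0 d g s r x) (d * E2 d g s r x) r := by
  obtain ⟨C, hC⟩ := hg.2 s
  have h := (TT_deriv_a (hg.sec s) (hC s le_rfl) (Ar_pos hd hr) x).comp r (Ar_deriv hd hr)
  exact h.congr_deriv (by unfold E2; ring)

lemma D0_dx {d : ℝ} (hd : 0 < d) {g : ℝ → ℝ → ℝ} (hg : GC g) {t : ℝ} (ht : 0 < t) (x : ℝ) :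
    HasDerivAt (fun y => CV (E0 d g) t y) (CV (E1 d g) t x) x :=
  CV_deriv (E0_KC hg) (E0_bd hg).kbd (E1_KC hd hg) (E1_bd hd hg).kbd (fun s r x _ hr => E0_dx hd hg s r x hr) ht x
lemma D1_dx {d : ℝ} (hd : 0 < d) {g : ℝ → ℝ → ℝ} (hg : GC g) (hL : SL g) {t : ℝ} (ht : 0 < t) (x : ℝ) :
    HasDerivAt (fun y => CV (E1 d g) t y) (CV (E2 d g) t x) x :=
  CV_deriv (E1_KC hd hg) (E1_bd hd hg).kbd (E2_KC hd hg) (E2_bd hd hg hL) (fun s r x _ hr => E1_dx hd hg s r x hr) ht x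

lemma CV_zero (K : ℝ → ℝ → ℝ → ℝ) (x : ℝ) : CV K 0 x = 0 := by simp [CV]

lemma CV_cont {K : ℝ → ℝ → ℝ → ℝ} (hc : KC K) (hb : KB1' K) :
    Continuous (fun p : ℝ × ℝ => CV K (max p.1 0) p.2) := by
  rw [continuous_iff_continuousAt]
  rintro ⟨t, x⟩
  rcases lt_or_ge 0 t with ht | ht
  · have := CV_contAt hc hb.kbd ht x
    exact ContinuousAt.comp (f := fun p : ℝ × ℝ => (max p.1 0, p.2)) (x := (t, x)) (g := fun p : ℝ × ℝ => CV K p.1 p.2) (by simpa [max_eq_left ht.le] using this) (by fun_prop)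
  · obtain ⟨B, hB⟩ := hb 1
    unfold ContinuousAt
    simp only [max_eq_right ht, CV_zero]
    have h0 : Filter.Tendsto (fun p : ℝ × ℝ => B * √(max p.1 0) * bt (1/2) 0) (nhds (t, x)) (nhds 0) := by
      have : Continuous (fun p : ℝ × ℝ => B * √(max p.1 0) * bt (1/2) 0) := by fun_prop
      have := this.tendsto (t, x)
      simpa [max_eq_right ht] using this
    refine squeeze_zero_norm' ?_ h0
    have ev : ∀ᶠ p : ℝ × ℝ in nhds (t, x), p.1 < 1 :=
      ((continuous_fst.tendsto (t, x)).eventually_lt_const (by simp only; linarith))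
    filter_upwards [ev] with p hp
    rcases lt_or_ge 0 p.1 with h | h
    · have := CV_bound (K := K) (p := 1/2) (q := 0) (x := p.2) (B := B) (t := p.1) (by norm_num) (by norm_num) h (fun s r hs hr hsr => by
        have := hB s r p.2 hs hr (by linarith) (by linarith)
        simpa using this)
      rw [max_eq_left h.le, Real.norm_eq_abs, Real.sqrt_eq_rpow]
      norm_num at this ⊢
      exact this
    · simp [max_eq_right h, CV_zero]

lemma CV_locbdd {K : ℝ → ℝ → ℝ → ℝ} (hb : KB1' K) : LocBdd (fun t x => CV K (max t 0) x) := by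
  intro T
  obtain ⟨B, hB⟩ := hb.kbd T
  refine ⟨|B * bt (1/2) (1/2)|, fun s hs x => ?_⟩
  simp only
  rcases lt_or_ge 0 s with h | h
  · rw [max_eq_left h.le]
    exact (CV_bd hB h hs x).trans (le_abs_self _)
  · rw [max_eq_right h, CV_zero, abs_zero]; exact abs_nonneg _

lemma half_int (t : ℝ) : Integrable (indicator (Ioo 0 t) (fun s : ℝ => s ^ xA)) := by
  rw [integrable_indicator_iff measurableSet_Ioo]
  rcases le_total 0 t with h | h
  · rw [← intervalIntegrable_iff_integrableOn_Ioo_of_le h]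
    exact intervalIntegral.intervalIntegrable_rpow' (by norm_num)
  · simp [Ioo_eq_empty_of_le h]

lemma tri_swap {H : ℝ → ℝ → ℝ} {t B : ℝ} (ht : 0 < t)
    (hc : ContinuousOn (fun p : ℝ × ℝ => H p.1 p.2) {p | 0 < p.1 ∧ 0 < p.2})
    (hB : ∀ s r, 0 < s → 0 < r → s ≤ t → r ≤ t → |H s r| ≤ B * (r ^ xA * s ^ xA)) :
    (∫ s in (0:ℝ)..t, ∫ r in (0:ℝ)..(t - s), H s r) = ∫ t' in (0:ℝ)..t, ∫ s in (0:ℝ)..t', H s (t' - s) := by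
  set S : Set (ℝ × ℝ) := {p | 0 < p.1 ∧ 0 < p.2 ∧ p.1 + p.2 < t} with hS
  have hSo : IsOpen S := (isOpen_lt continuous_const continuous_fst).inter
    ((isOpen_lt continuous_const continuous_snd).inter (isOpen_lt (continuous_fst.add continuous_snd) continuous_const))
  set F : ℝ × ℝ → ℝ := indicator S (fun p => H p.1 p.2) with hF
  have hFi : Integrable F (volume.prod volume) := by
    refine (((half_int t).mul_prod (half_int t)).const_mul B).mono' ?_ (eO fun p => ?_)
    · rw [hF, aestronglyMeasurable_indicator_iff hSo.measurableSet]
      exact (hc.mono fun p hp => ⟨hp.1, hp.2.1⟩).aestronglyMeasurable hSo.measurableSet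
    · by_cases hp : p ∈ S
      · have h1 : p.1 ∈ Ioo 0 t := ⟨hp.1, by linarith [hp.2.1, hp.2.2]⟩
        have h2 : p.2 ∈ Ioo 0 t := ⟨hp.2.1, by linarith [hp.1, hp.2.2]⟩
        rw [hF, indicator_of_mem hp, indicator_of_mem h1, indicator_of_mem h2, Real.norm_eq_abs]
        refine (hB _ _ h1.1 h2.1 h1.2.le h2.2.le).trans (le_of_eq (by ring))
      · rw [hF, indicator_of_notMem hp, norm_zero]
        have hB0 : 0 ≤ B := by
          have h := (abs_nonneg _).trans (hB t t ht ht le_rfl le_rfl)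
          have h' : 0 < t ^ xA * t ^ xA := by positivity
          exact nonneg_of_mul_nonneg_left h h'
        refine mul_nonneg hB0 (mul_nonneg ?_ ?_) <;>
        · refine indicator_nonneg (fun z hz => Real.rpow_nonneg hz.1.le _) _
  have hGi : Integrable (Function.uncurry (fun s t' => F (s, t' - s))) (volume.prod volume) :=
    (measurePreserving_prod_sub (volume : Measure ℝ) (volume : Measure ℝ)).integrable_comp_of_integrable hFi
  have hsw := integral_integral_swap hGi
  have hL : ∀ s, (∫ t', F (s, t' - s)) = indicator (Ioc 0 t) (fun s => ∫ r in (0:ℝ)..(t - s), H s r) s := by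
    intro s
    rw [integral_sub_right_eq_self (fun r => F (s, r)) s]
    by_cases hs : s ∈ Ioc 0 t
    · rw [indicator_of_mem hs, intervalIntegral.integral_of_le (by linarith [hs.2]), ← integral_indicator measurableSet_Ioc]
      refine integral_congr_ae ?_
      filter_upwards [ae_ne1 (t - s)] with r hr
      by_cases h : r ∈ Ioc 0 (t - s)
      · have : r < t - s := lt_of_le_of_ne h.2 hr
        rw [indicator_of_mem h, hF, indicator_of_mem (show (s, r) ∈ S from ⟨hs.1, h.1, by linarith⟩)]
      · rw [indicator_of_notMem h, hF, indicator_of_notMem]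
        rintro ⟨_, h2, h3⟩
        exact h ⟨h2, by simp only at h3; linarith⟩
    · rw [indicator_of_notMem hs]
      have : ∀ r, F (s, r) = 0 := fun r => by
        rw [hF, indicator_of_notMem]
        rintro ⟨h1, h2, h3⟩
        exact hs ⟨h1, by simp only at h2 h3; linarith⟩
      simp [this]
  have hR : ∀ t', t' ≠ t → (∫ s, F (s, t' - s)) = indicator (Ioc 0 t) (fun t' => ∫ s in (0:ℝ)..t', H s (t' - s)) t' := by
    intro t' hne
    by_cases hs : t' ∈ Ioc 0 t
    · rw [indicator_of_mem hs, intervalIntegral.integral_of_le hs.1.le, ← integral_indicator measurableSet_Ioc]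
      refine integral_congr_ae ?_
      filter_upwards [ae_ne1 t'] with s hs'
      by_cases h : s ∈ Ioc 0 t'
      · have : s < t' := lt_of_le_of_ne h.2 hs'
        have h4 : t' < t := lt_of_le_of_ne hs.2 hne
        rw [indicator_of_mem h, hF, indicator_of_mem (show (s, t' - s) ∈ S from ⟨h.1, by simp only; linarith, by simp only; linarith⟩)]
      · rw [indicator_of_notMem h, hF, indicator_of_notMem]
        rintro ⟨h1, h2, h3⟩
        exact h ⟨h1, by simp only at h2; linarith⟩
    · rw [indicator_of_notMem hs]
      have : ∀ s, F (s, t' - s) = 0 := fun r => by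
        rw [hF, indicator_of_notMem]
        rintro ⟨h1, h2, h3⟩
        simp only at h1 h2 h3
        exact hs ⟨by linarith, by linarith⟩
      simp [this]
  rw [intervalIntegral.integral_of_le ht.le, intervalIntegral.integral_of_le ht.le,
    ← integral_indicator measurableSet_Ioc, ← integral_indicator measurableSet_Ioc]
  simp_rw [hL] at hsw
  rw [hsw]
  refine integral_congr_ae ?_
  filter_upwards [ae_ne1 t] with t' h using hR t' h

lemma D0_formula {d : ℝ} (hd : 0 < d) {g : ℝ → ℝ → ℝ} (hg : GC g) (hL : SL g) {t : ℝ} (ht : 0 < t) (x : ℝ) :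
    CV (E0 d g) t x = (∫ s in (0:ℝ)..t, g s x) + d * ∫ t' in (0:ℝ)..t, CV (E2 d g) t' x := by
  obtain ⟨B, hB⟩ := E2_bd hd hg hL t
  have hc : ContinuousOn (fun p : ℝ × ℝ => E2 d g p.1 p.2 x) {p | 0 < p.1 ∧ 0 < p.2} :=
    (E2_KC hd hg).comp (f := fun p : ℝ × ℝ => (p.1, p.2, x)) (by fun_prop) (fun p hp => hp)
  have h := tri_swap (H := fun s r => E2 d g s r x) ht hc (fun s r hs hr h1 h2 => hB s r x hs hr h1 h2)
  have key : ∀ s ∈ Ioc 0 t, d * (∫ r in (0:ℝ)..(t - s), E2 d g s r x) = E0 d g s (t - s) x - g s x := by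
    intro s hs
    rw [← intervalIntegral.integral_const_mul]
    have hcr : Continuous (fun r => E0 d g s r x) := (E0_cont hg).comp (by fun_prop : Continuous fun r : ℝ => (s, r, x))
    rw [intervalIntegral.integral_eq_sub_of_hasDerivAt_of_le (by linarith [hs.2]) hcr.continuousOn
      (fun r hr => E0_dr hd hg s r x hr.1)]
    · simp [E0, Ar_zero, TT_zero]
    · have hts : 0 ≤ t - s := by linarith [hs.2]
      refine IntervalIntegrable.const_mul ?_ _
      refine IntervalIntegrable.mono_fun' ((intervalIntegral.intervalIntegrable_rpow' (r := -(1/2)) (by norm_num)).const_mul (B * s ^ xA)) ?_ ?_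
      · rw [uIoc_of_le hts]
        refine ContinuousOn.aestronglyMeasurable (hc.comp (f := fun r => (s, r)) (by fun_prop) ?_) measurableSet_Ioc
        intro r hr; exact ⟨hs.1, hr.1⟩
      · refine (ae_restrict_iff' measurableSet_uIoc).mpr (eO fun r hr => ?_)
        rw [uIoc_of_le hts] at hr
        refine (hB s r x hs.1 hr.1 hs.2 (by linarith [hr.2, hs.1])).trans (le_of_eq (by ring))
  have h2 : d * (∫ s in (0:ℝ)..t, ∫ r in (0:ℝ)..(t - s), E2 d g s r x) = ∫ s in (0:ℝ)..t, (E0 d g s (t - s) x - g s x) := by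
    rw [← intervalIntegral.integral_const_mul]
    refine intervalIntegral.integral_congr_ae (eO fun s hs => ?_)
    rw [uIoc_of_le ht.le] at hs
    exact key s hs
  rw [h] at h2
  have hcs : Continuous (fun s => E0 d g s (t - s) x) := (E0_cont hg).comp (by fun_prop : Continuous fun s : ℝ => (s, t - s, x))
  have hgs : Continuous (fun s => g s x) := hg.1.comp (by fun_prop : Continuous fun s : ℝ => (s, x))
  rw [intervalIntegral.integral_sub (hcs.intervalIntegrable _ _) (hgs.intervalIntegrable _ _)] at h2
  unfold CV
  linarith

lemma D0_dt {d : ℝ} (hd : 0 < d) {g : ℝ → ℝ → ℝ} (hg : GC g) (hL : SL g) {t : ℝ} (ht : 0 < t) (x : ℝ) :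
    HasDerivAt (fun t => CV (E0 d g) t x) (d * CV (E2 d g) t x + g t x) t := by
  have e : (fun t => CV (E0 d g) t x) =ᶠ[nhds t] fun t => (∫ s in (0:ℝ)..t, g s x) + d * ∫ t' in (0:ℝ)..t, CV (E2 d g) t' x := by
    filter_upwards [lt_mem_nhds ht] with b hb using D0_formula hd hg hL hb x
  refine HasDerivAt.congr_of_eventuallyEq ?_ e
  have hgs : Continuous (fun s => g s x) := hg.1.comp (by fun_prop : Continuous fun s : ℝ => (s, x))
  have h1 := intervalIntegral.integral_hasDerivAt_right (hgs.intervalIntegrable 0 t) (hgs.stronglyMeasurableAtFilter _ _) hgs.continuousAt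
  obtain ⟨B, hB⟩ := E2_bd hd hg hL t
  have hco : ∀ s, 0 < s → ContinuousAt (fun s => CV (E2 d g) s x) s := fun s hs =>
    ContinuousAt.comp (f := fun s : ℝ => (s, x)) (g := fun p : ℝ × ℝ => CV (E2 d g) p.1 p.2) (CV_contAt (E2_KC hd hg) (E2_bd hd hg hL) hs x) (by fun_prop)
  have hcon : ContinuousOn (fun s => CV (E2 d g) s x) (Ioi 0) := fun s hs => (hco s hs).continuousWithinAt
  have hii : IntervalIntegrable (fun s => CV (E2 d g) s x) volume 0 t := by
    refine IntervalIntegrable.mono_fun' (intervalIntegrable_const (c := B * bt (1/2) (1/2))) ?_ ?_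
    · rw [uIoc_of_le ht.le]
      exact (hcon.mono fun s hs => hs.1).aestronglyMeasurable measurableSet_Ioc
    · refine (ae_restrict_iff' measurableSet_uIoc).mpr (eO fun r hr => ?_)
      rw [uIoc_of_le ht.le] at hr
      exact CV_bd hB hr.1 hr.2 x
  have h2 := intervalIntegral.integral_hasDerivAt_right hii
    (hcon.stronglyMeasurableAtFilter isOpen_Ioi t ht) (hco t ht)
  exact (h1.add (h2.const_mul d)).congr_deriv (by ring)

def Md (d : ℝ) (f : ℝ → ℝ) (g : ℝ → ℝ → ℝ) (t x : ℝ) : ℝ := E0 d (fun _ => f) 0 t x + CV (E0 d g) t x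
def Md1 (d : ℝ) (f : ℝ → ℝ) (g : ℝ → ℝ → ℝ) (t x : ℝ) : ℝ := E1 d (fun _ => f) 0 t x + CV (E1 d g) t x
def Md2 (d : ℝ) (f : ℝ → ℝ) (g : ℝ → ℝ → ℝ) (t x : ℝ) : ℝ := E2 d (fun _ => f) 0 t x + CV (E2 d g) t x

lemma GC_const {f : ℝ → ℝ} (hf : Continuous f) {C : ℝ} (hC : ∀ x, |f x| ≤ C) : GC (fun _ => f) :=
  ⟨hf.comp continuous_snd, fun _ => ⟨C, fun _ _ x => hC x⟩⟩

lemma Md_zero (d : ℝ) (f : ℝ → ℝ) (g : ℝ → ℝ → ℝ) (x : ℝ) : Md d f g 0 x = f x := by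
  simp [Md, CV_zero, E0, Ar_zero, TT_zero]

section
variable {d : ℝ} (hd : 0 < d) {f : ℝ → ℝ} {g : ℝ → ℝ → ℝ} (hf : GC (fun _ => f)) (hg : GC g)

lemma Md_dx (hd : 0 < d) (hf : GC (fun _ => f)) (hg : GC g) {t : ℝ} (ht : 0 < t) (x : ℝ) :
    HasDerivAt (fun y => Md d f g t y) (Md1 d f g t x) x :=
  (E0_dx hd hf 0 t x ht).add (D0_dx hd hg ht x)
lemma Md1_dx (hd : 0 < d) (hf : GC (fun _ => f)) (hg : GC g) (hL : SL g) {t : ℝ} (ht : 0 < t) (x : ℝ) :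
    HasDerivAt (fun y => Md1 d f g t y) (Md2 d f g t x) x :=
  (E1_dx hd hf 0 t x ht).add (D1_dx hd hg hL ht x)
lemma Md_dt (hd : 0 < d) (hf : GC (fun _ => f)) (hg : GC g) (hL : SL g) {t : ℝ} (ht : 0 < t) (x : ℝ) :
    HasDerivAt (fun t => Md d f g t x) (d * Md2 d f g t x + g t x) t :=
  ((E0_dr hd hf 0 t x ht).add (D0_dt hd hg hL ht x)).congr_deriv (by unfold Md2; ring)
lemma KC_at {K : ℝ → ℝ → ℝ → ℝ} (hK : KC K) (hc : ∀ s s' r x, K s r x = K s' r x) {t : ℝ} (ht : 0 < t) (x : ℝ) :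
    ContinuousAt (fun p : ℝ × ℝ => K 0 p.1 p.2) (t, x) := by
  have ho : IsOpen {p : ℝ × ℝ × ℝ | 0 < p.1 ∧ 0 < p.2.1} :=
      (isOpen_lt continuous_const continuous_fst).inter (isOpen_lt continuous_const (continuous_fst.comp continuous_snd))
  have h3 := hK.continuousAt (ho.mem_nhds (show ((1:ℝ), t, x) ∈ _ from ⟨one_pos, ht⟩))
  have h4 := ContinuousAt.comp (f := fun p : ℝ × ℝ => ((1:ℝ), p.1, p.2)) (x := (t, x)) h3 (by fun_prop)
  refine h4.congr (eO fun p => ?_)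
  exact hc _ _ _ _
lemma Md1_contAt (hd : 0 < d) (hf : GC (fun _ => f)) (hg : GC g) {t : ℝ} (ht : 0 < t) (x : ℝ) :
    ContinuousAt (fun p : ℝ × ℝ => Md1 d f g p.1 p.2) (t, x) :=
  (KC_at (E1_KC hd hf) (fun _ _ _ _ => rfl) ht x).add (CV_contAt (E1_KC hd hg) (E1_bd hd hg).kbd ht x)
lemma Md2_contAt (hd : 0 < d) (hf : GC (fun _ => f)) (hg : GC g) (hL : SL g) {t : ℝ} (ht : 0 < t) (x : ℝ) :
    ContinuousAt (fun p : ℝ × ℝ => Md2 d f g p.1 p.2) (t, x) :=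
  (KC_at (E2_KC hd hf) (fun _ _ _ _ => rfl) ht x).add (CV_contAt (E2_KC hd hg) (E2_bd hd hg hL) ht x)
lemma Md_GC (hf : GC (fun _ => f)) (hg : GC g) : GC (fun t x => Md d f g (max t 0) x) := by
  constructor
  · refine Continuous.add ?_ (CV_cont (E0_KC hg) (E0_bd hg))
    exact (E0_cont hf).comp (by fun_prop : Continuous fun p : ℝ × ℝ => ((0:ℝ), max p.1 0, p.2))
  · intro T
    obtain ⟨C, hC⟩ := hf.2 0
    obtain ⟨C', hC'⟩ := CV_locbdd (E0_bd (d := d) hg) T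
    refine ⟨C * cT + C', fun s hs x => (abs_add_le _ _).trans (add_le_add ?_ (hC' s hs x))⟩
    exact TT_bound KB0 (hC 0 le_rfl) _ _
end

lemma second_le {p p' : ℝ → ℝ} {p'' x : ℝ} (h1 : ∀ y, HasDerivAt p (p' y) y) (h2 : HasDerivAt p' p'' x)
    (hmax : IsLocalMax p x) : p'' ≤ 0 := by
  by_contra hpos
  push Not at hpos
  have e : deriv p = p' := funext fun y => (h1 y).deriv
  have h0 : p' x = 0 := hmax.hasDerivAt_eq_zero (h1 x)
  have hmin := isLocalMin_of_deriv_deriv_pos (f := p) (x₀ := x) (by rw [e, h2.deriv]; exact hpos) (by rw [e, h0]) (h1 x).continuousAt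
  have hc : p =ᶠ[nhds x] fun _ => p x := by
    filter_upwards [hmax, hmin] with y hy hy' using le_antisymm hy hy'
  have hc' : p' =ᶠ[nhds x] fun _ => 0 := by
    have := hc.deriv
    rw [e] at this
    simpa using this
  have h3 : p'' = 0 := by
    have := (h2.congr_of_eventuallyEq hc'.symm).unique (hasDerivAt_const x (0:ℝ))
    exact this
  linarith

lemma maxp {d c T P C : ℝ} (hd : 0 < d) {z zt zx zxx : ℝ → ℝ → ℝ}
    (hz : ContinuousOn (Function.uncurry z) (Icc 0 T ×ˢ univ))
    (hC : ∀ t ∈ Icc 0 T, ∀ x, z t x ≤ C) (h0 : ∀ x, z 0 x ≤ 0)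
    (hzt : ∀ t ∈ Ioc 0 T, ∀ x, HasDerivAt (fun t => z t x) (zt t x) t)
    (hzx : ∀ t ∈ Ioc 0 T, ∀ x, HasDerivAt (fun x => z t x) (zx t x) x)
    (hzxx : ∀ t ∈ Ioc 0 T, ∀ x, HasDerivAt (fun x => zx t x) (zxx t x) x)
    (hine : ∀ t ∈ Ioc 0 T, ∀ x, 0 < z t x → zt t x ≤ d * zxx t x + c * zx t x + P * z t x) :
    ∀ t ∈ Icc 0 T, ∀ x, z t x ≤ 0 := by
  intro t₁ ht₁ x₁
  by_contra hpos
  push Not at hpos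
  set K : ℝ := 2 * d + |c| + 1 with hK
  set m : ℝ := eX (-P * t₁) * z t₁ x₁ with hm
  have hmp : 0 < m := by positivity
  set ρ : ℝ := m / (2 * (eX (K * t₁) * (1 + x₁ ^ 2))) with hρ
  have hρp : 0 < ρ := by positivity
  set q : ℝ → ℝ → ℝ := fun t x => eX (-P * t) * z t x - ρ * eX (K * t) * (1 + x ^ 2) with hq
  have hq1 : 0 < q t₁ x₁ := by
    have : ρ * eX (K * t₁) * (1 + x₁ ^ 2) = m / 2 := by rw [hρ]; field_simp
    simp only [hq]; rw [this, ← hm]; linarith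
  have hKp : 0 < K := by positivity
  have hT : 0 ≤ T := ht₁.1.trans ht₁.2
  set E : ℝ := eX (|P| * T) * |C| with hE
  have hEp : 0 ≤ E := by positivity
  have hbig : ∀ t ∈ Icc 0 T, ∀ x, 0 < q t x → |x| ≤ E / ρ + 1 := by
    intro t ht x hqx
    simp only [hq] at hqx
    have h1 : eX (-P * t) * z t x ≤ E := by
      have : eX (-P * t) ≤ eX (|P| * T) := by
        apply Real.exp_le_exp.mpr
        calc -P * t ≤ |P| * t := by gcongr; exacts [ht.1, neg_le_abs P]
          _ ≤ |P| * T := by gcongr; exact ht.2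
      calc _ ≤ eX (-P * t) * |C| := by gcongr; exact (hC t ht x).trans (le_abs_self _)
        _ ≤ _ := by rw [hE]; gcongr
    have h2 : 1 ≤ eX (K * t) := Real.one_le_exp (mul_nonneg hKp.le ht.1)
    have h3 : ρ * (1 + x ^ 2) ≤ ρ * eX (K * t) * (1 + x ^ 2) := by
      have : ρ * 1 ≤ ρ * eX (K * t) := by gcongr
      gcongr; linarith
    have h4 : 1 + x ^ 2 < E / ρ := by rw [lt_div_iff₀ hρp]; linarith
    rw [abs_le]; constructor <;> nlinarith [sq_nonneg (x - 1), sq_nonneg (x + 1)]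
  set R := E / ρ + 1 with hR
  have hcomp : IsCompact (Icc 0 T ×ˢ Icc (-R) R) := isCompact_Icc.prod isCompact_Icc
  have hqc : ContinuousOn (fun p : ℝ × ℝ => q p.1 p.2) (Icc 0 T ×ˢ Icc (-R) R) := by
    have := hz.mono (prod_mono_right (s := Icc 0 T) (subset_univ (Icc (-R) R)))
    refine ContinuousOn.sub (ContinuousOn.mul (by fun_prop) this) (by fun_prop)
  have hm1 : (t₁, x₁) ∈ Icc 0 T ×ˢ Icc (-R) R := ⟨ht₁, abs_le.mp (hbig t₁ ht₁ x₁ hq1)⟩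
  obtain ⟨⟨t, x⟩, hp, hmx⟩ := hcomp.exists_isMaxOn ⟨_, hm1⟩ hqc
  have hmx' : ∀ t' ∈ Icc 0 T, ∀ x', q t' x' ≤ q t x := by
    intro t' ht' x'
    by_cases h : 0 < q t' x'
    · exact hmx (show (t', x') ∈ _ from ⟨ht', abs_le.mp (hbig t' ht' x' h)⟩)
    · push Not at h
      exact h.trans (hq1.le.trans (hmx hm1))
  have hqp : 0 < q t x := lt_of_lt_of_le hq1 (hmx' _ ht₁ _)
  have hzp : 0 < z t x := by
    simp only [hq] at hqp
    have : 0 < ρ * eX (K * t) * (1 + x ^ 2) := by positivity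
    have h5 : 0 < eX (-P * t) * z t x := by linarith
    exact (mul_pos_iff_of_pos_left (Real.exp_pos _)).mp h5
  have ht0 : t ≠ 0 := by
    rintro rfl
    exact absurd hzp (not_lt.mpr (h0 x))
  have htm : t ∈ Ioc 0 T := ⟨lt_of_le_of_ne hp.1.1 (Ne.symm ht0), hp.1.2⟩
  have hqx : ∀ y, HasDerivAt (fun y => q t y) (eX (-P * t) * zx t y - ρ * eX (K * t) * (2 * y)) y := by
    intro y
    have h1 : HasDerivAt (fun y : ℝ => 1 + y ^ 2) (2 * y) y := by
      simpa using ((hasDerivAt_pow 2 y).const_add 1)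
    exact ((hzx t htm y).const_mul _).sub (h1.const_mul _)
  have hqxx : HasDerivAt (fun y => eX (-P * t) * zx t y - ρ * eX (K * t) * (2 * y))
      (eX (-P * t) * zxx t x - ρ * eX (K * t) * 2) x := by
    have h1 : HasDerivAt (fun y : ℝ => 2 * y) 2 x := by
      simpa using ((hasDerivAt_id x).const_mul 2)
    exact ((hzxx t htm x).const_mul _).sub (h1.const_mul _)
  have hlm : IsLocalMax (fun y => q t y) x := eO fun y => hmx' t hp.1 y
  have hd1 := hlm.hasDerivAt_eq_zero (hqx x)
  have hd2 := second_le hqx hqxx hlm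
  have hqt : HasDerivAt (fun s => q s x) ((-P * eX (-P * t)) * z t x + eX (-P * t) * zt t x
      - ρ * (K * eX (K * t)) * (1 + x ^ 2)) t := by
    have e1 : ∀ a : ℝ, HasDerivAt (fun s => eX (a * s)) (a * eX (a * t)) t := by
      intro a
      have := ((hasDerivAt_id t).const_mul a).exp
      simpa [mul_comm] using this
    exact ((e1 (-P)).mul (hzt t htm x)).sub (((e1 K).const_mul ρ).mul_const _)
  have hd3 : 0 ≤ (-P * eX (-P * t)) * z t x + eX (-P * t) * zt t x
      - ρ * (K * eX (K * t)) * (1 + x ^ 2) := by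
    have hlt := hasDerivAt_iff_tendsto_slope_left_right.mp hqt
    refine ge_of_tendsto hlt.1 ?_
    have : Ioo 0 t ∈ nhdsWithin t (Iio t) := Ioo_mem_nhdsLT htm.1
    filter_upwards [this] with s hs
    rw [slope_def_field]
    refine div_nonneg_of_nonpos ?_ (by linarith [hs.2])
    have := hmx' s ⟨hs.1.le, hs.2.le.trans hp.1.2⟩ x
    linarith
  have hin := hine t htm x hzp
  have e0 : 0 < eX (-P * t) := Real.exp_pos _
  have h6 : eX (-P * t) * zt t x ≤ eX (-P * t) * (d * zxx t x + c * zx t x + P * z t x) := by gcongr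
  set X := eX (-P * t)
  set Y := ρ * eX (K * t) with hY
  have hYp : 0 < Y := by positivity
  have h7 : X * zx t x = Y * (2 * x) := by linarith
  have h8 : Y * (K * (1 + x ^ 2)) ≤ d * (X * zxx t x) + c * (X * zx t x) := by
    have : ρ * (K * eX (K * t)) * (1 + x ^ 2) = Y * (K * (1 + x ^ 2)) := by rw [hY]; ring
    linarith
  rw [h7] at h8
  have h9 : d * (X * zxx t x) ≤ d * (Y * 2) := mul_le_mul_of_nonneg_left (by linarith) hd.le
  have h10 : c * (2 * x) ≤ |c| * (1 + x ^ 2) := by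
    calc c * (2 * x) ≤ |c * (2 * x)| := le_abs_self _
      _ = |c| * |2 * x| := abs_mul _ _
      _ ≤ _ := by gcongr; rw [abs_le]; constructor <;> nlinarith [sq_nonneg (x - 1), sq_nonneg (x + 1)]
  have h11 : Y * (K * (1 + x ^ 2)) ≤ Y * (2 * d + |c| * (1 + x ^ 2)) := by
    have := mul_le_mul_of_nonneg_left h10 hYp.le
    linarith
  have h12 := le_of_mul_le_mul_left h11 hYp
  rw [hK] at h12
  linarith [mul_nonneg hd.le (sq_nonneg x), sq_nonneg x]

structure Par where
  d₁ : ℝ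
  d₂ : ℝ
  c : ℝ
  α : ℝ
  γ : ℝ
  μ : ℝ
  η : ℝ
  hd₁ : 0 < d₁
  hd₂ : 0 < d₂
  hc : 0 < c
  hμ : 0 < μ
  hη : 0 < η
  hη1 : η ≤ 1

def tp (t : ℝ) : ℝ := max t 0
def ta (t : ℝ) : ℝ := 1 + max t 0
def Wf (η t x : ℝ) : ℝ := η * (ta t) ^ xB * ((ta t + x ^ 2) / (ta t ^ 2 + x ^ 2))
def cl (w z : ℝ) : ℝ := max (-w) (min w z)

lemma tp_nonneg (t : ℝ) : 0 ≤ tp t := le_max_right _ _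
lemma tp_of {t : ℝ} (h : 0 ≤ t) : tp t = t := max_eq_left h
lemma tp_cont : Continuous tp := by unfold tp; fun_prop
lemma ta_ge (t : ℝ) : 1 ≤ ta t := by unfold ta; linarith [le_max_right t 0]
lemma ta_pos (t : ℝ) : 0 < ta t := by linarith [ta_ge t]
lemma ta_of {t : ℝ} (h : 0 ≤ t) : ta t = 1 + t := by rw [ta, max_eq_left h]
lemma ta_cont : Continuous ta := by unfold ta; fun_prop
lemma Wf_den (t x : ℝ) : 0 < ta t ^ 2 + x ^ 2 := by have := ta_pos t; positivity
lemma Wf_cont (η : ℝ) : Continuous (Function.uncurry (Wf η)) := by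
  unfold Function.uncurry Wf
  have h := ta_cont
  refine (continuous_const.mul ((h.comp continuous_fst).rpow_const fun p => Or.inl (ta_pos p.1).ne')).mul ?_
  refine Continuous.div (by fun_prop) (by fun_prop) fun p => (Wf_den p.1 p.2).ne'
lemma Wf_pos {η : ℝ} (hη : 0 < η) (t x : ℝ) : 0 < Wf η t x := by
  have := ta_pos t; unfold Wf; positivity
lemma Wf_quot (t x : ℝ) : (ta t + x ^ 2) / (ta t ^ 2 + x ^ 2) ≤ 1 := by
  rw [div_le_one (Wf_den t x)]; nlinarith [ta_ge t]
lemma Wf_le {η : ℝ} (hη : 0 < η) (t x : ℝ) : Wf η t x ≤ η := by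
  unfold Wf
  have h1 : ta t ^ xB ≤ 1 := Real.rpow_le_one_of_one_le_of_nonpos (ta_ge t) (by norm_num)
  have h2 := Wf_quot t x
  have h3 : 0 ≤ ta t ^ xB := Real.rpow_nonneg (ta_pos t).le _
  have h4 : 0 ≤ (ta t + x ^ 2) / (ta t ^ 2 + x ^ 2) := by have := ta_pos t; positivity
  calc _ ≤ η * 1 * 1 := by gcongr
    _ = η := by ring
lemma Wf_lip {η : ℝ} (hη : 0 < η) (t x y : ℝ) : |Wf η t x - Wf η t y| ≤ η * |x - y| := by
  unfold Wf
  have hp := ta_pos t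
  have h1 : ta t ^ xB ≤ 1 := Real.rpow_le_one_of_one_le_of_nonpos (ta_ge t) (by norm_num)
  have h3 : 0 ≤ ta t ^ xB := Real.rpow_nonneg (ta_pos t).le _
  set a := ta t with ha
  have ha1 : 1 ≤ a := ta_ge t
  have e : (a + x ^ 2) / (a ^ 2 + x ^ 2) - (a + y ^ 2) / (a ^ 2 + y ^ 2) =
      (x - y) * ((a ^ 2 - a) * (x + y) / ((a ^ 2 + x ^ 2) * (a ^ 2 + y ^ 2))) := by
    field_simp; ring
  have h5 : |(a ^ 2 - a) * (x + y) / ((a ^ 2 + x ^ 2) * (a ^ 2 + y ^ 2))| ≤ 1 := by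
    rw [abs_div, abs_of_pos (by positivity : 0 < (a ^ 2 + x ^ 2) * (a ^ 2 + y ^ 2)), div_le_one (by positivity)]
    have h6 : |x + y| ≤ 1 + x ^ 2 + y ^ 2 := by
      rw [abs_le]; constructor <;> nlinarith [sq_nonneg (x - 1), sq_nonneg (y - 1), sq_nonneg (x + 1), sq_nonneg (y + 1)]
    have h7 : 0 ≤ a ^ 2 - a := by nlinarith
    rw [abs_mul, abs_of_nonneg h7]
    have h8 : 1 ≤ a ^ 2 := by nlinarith
    calc _ ≤ a ^ 2 * (1 + x ^ 2 + y ^ 2) := by gcongr; linarith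
      _ ≤ a ^ 2 * (a ^ 2 + x ^ 2 + y ^ 2) := by gcongr
      _ ≤ _ := by nlinarith [mul_nonneg (sq_nonneg x) (sq_nonneg y)]
  rw [← mul_sub, e, abs_mul, abs_mul, abs_mul, abs_of_pos hη, abs_of_nonneg h3]
  calc _ ≤ η * 1 * (|x - y| * 1) := by gcongr
    _ = _ := by ring

lemma cl_abs {w : ℝ} (hw : 0 ≤ w) (z : ℝ) : |cl w z| ≤ w := by
  unfold cl; rw [abs_le]; exact ⟨le_max_left _ _, max_le (by linarith) (min_le_left _ _)⟩
lemma cl_of {w z : ℝ} (h : |z| ≤ w) : cl w z = z := by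
  rw [abs_le] at h; unfold cl; rw [min_eq_right h.2, max_eq_right h.1]
lemma cl_abs' (w z : ℝ) (hw : 0 ≤ w) : |cl w z| ≤ |z| := by
  rcases le_total |z| w with h | h
  · rw [cl_of h]
  · exact (cl_abs hw z).trans h
lemma cl_lip (w w' z z' : ℝ) : |cl w z - cl w' z'| ≤ |w - w'| + |z - z'| := by
  unfold cl
  have h1 := abs_max_sub_max_le_max (-w) (min w z) (-w') (min w' z')
  have h2 := abs_min_sub_min_le_max w z w' z'
  have h3 : |-w - -w'| = |w - w'| := by rw [← abs_neg]; congr 1; ring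
  have h4 := abs_nonneg (w - w')
  have h5 := abs_nonneg (z - z')
  refine h1.trans (max_le (by rw [h3]; linarith) (h2.trans (max_le (by linarith) (by linarith))))
lemma cl_cont {X : Type*} [TopologicalSpace X] {f h : X → ℝ} (hf : Continuous f) (hh : Continuous h) :
    Continuous (fun x => cl (f x) (h x)) := by unfold cl; fun_prop

def hF (P : Par) (u : ℝ → ℝ → ℝ) (s y : ℝ) : ℝ := (cl 1 (u s (y - P.c * s))) ^ 2
def Vh (P : Par) (v₀ : ℝ → ℝ) (u : ℝ → ℝ → ℝ) (t x : ℝ) : ℝ :=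
  E0 P.d₂ (fun _ => v₀) 0 t x + P.γ * CV (E1 P.d₂ (hF P u)) t x
def Vop (P : Par) (v₀ : ℝ → ℝ) (u : ℝ → ℝ → ℝ) (t x : ℝ) : ℝ := Vh P v₀ u (tp t) (x + P.c * tp t)
def gF (P : Par) (v₀ : ℝ → ℝ) (u : ℝ → ℝ → ℝ) (t x : ℝ) : ℝ :=
  (P.α * cl (Wf P.η t x) (Vop P v₀ u t x + P.γ / P.c * (cl 1 (u t x)) ^ 2) - P.μ * (cl 1 (u t x)) ^ 2) * cl 1 (u t x)
def Uop (P : Par) (u₀ v₀ : ℝ → ℝ) (u : ℝ → ℝ → ℝ) (t x : ℝ) : ℝ := Md P.d₁ u₀ (gF P v₀ u) (tp t) x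

lemma sq_le_one' {z : ℝ} (h : |z| ≤ 1) : |z ^ 2| ≤ 1 := by rw [abs_pow]; exact pow_le_one₀ (abs_nonneg _) h

lemma hF_GC (P : Par) {u : ℝ → ℝ → ℝ} (hu : Continuous (Function.uncurry u)) : GC (hF P u) := by
  refine ⟨?_, fun _ => ⟨1, fun s _ x => sq_le_one' (cl_abs zero_le_one _)⟩⟩
  unfold Function.uncurry hF
  exact (cl_cont continuous_const (hu.comp (by fun_prop : Continuous fun p : ℝ × ℝ => (p.1, p.2 - P.c * p.1)))).pow 2

lemma Vop_cont (P : Par) {v₀ : ℝ → ℝ} {u : ℝ → ℝ → ℝ} (hv : GC (fun _ => v₀)) (hu : Continuous (Function.uncurry u)) :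
    Continuous (Function.uncurry (Vop P v₀ u)) := by
  unfold Function.uncurry Vop Vh
  have h := tp_cont
  refine Continuous.add ?_ (continuous_const.mul ?_)
  · exact (E0_cont hv).comp (by fun_prop : Continuous fun p : ℝ × ℝ => ((0:ℝ), tp p.1, p.2 + P.c * tp p.1))
  · exact (CV_cont (E1_KC P.hd₂ (hF_GC P hu)) (E1_bd P.hd₂ (hF_GC P hu))).comp (by fun_prop : Continuous fun p : ℝ × ℝ => (p.1, p.2 + P.c * tp p.1))

lemma gF_bd (P : Par) (v₀ : ℝ → ℝ) (u : ℝ → ℝ → ℝ) (t x : ℝ) : |gF P v₀ u t x| ≤ |P.α| + P.μ := by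
  unfold gF
  have h1 := cl_abs zero_le_one (u t x)
  have h2 := cl_abs (Wf_pos P.hη t x).le (Vop P v₀ u t x + P.γ / P.c * (cl 1 (u t x)) ^ 2)
  have h3 := (h2.trans (Wf_le P.hη t x)).trans P.hη1
  rw [abs_mul]
  have hμ := P.hμ
  calc _ ≤ (|P.α| * 1 + P.μ * 1) * 1 := by
        gcongr
        refine (abs_sub _ _).trans ?_
        rw [abs_mul, abs_mul, abs_of_pos hμ]
        gcongr
        exact sq_le_one' h1
    _ = _ := by ring

lemma gF_GC (P : Par) {v₀ : ℝ → ℝ} {u : ℝ → ℝ → ℝ} (hv : GC (fun _ => v₀)) (hu : Continuous (Function.uncurry u)) :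
    GC (gF P v₀ u) := by
  refine ⟨?_, fun _ => ⟨|P.α| + P.μ, fun s _ x => gF_bd P v₀ u s x⟩⟩
  have hV := Vop_cont P hv hu
  have hW := Wf_cont P.η
  have hc : Continuous (fun p : ℝ × ℝ => cl 1 (u p.1 p.2)) := cl_cont continuous_const hu
  unfold Function.uncurry gF
  exact ((continuous_const.mul (cl_cont hW (hV.add (continuous_const.mul (hc.pow 2))))).sub (continuous_const.mul (hc.pow 2))).mul hc

lemma TT_sub {k : ℝ → ℝ} (hk : KB k) {f f' : ℝ → ℝ} (hf : GC (fun _ => f)) (hf' : GC (fun _ => f')) (a x : ℝ) :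
    TT k f a x - TT k f' a x = TT k (fun y => f y - f' y) a x := by
  obtain ⟨C, hC⟩ := hf.2 0
  obtain ⟨C', hC'⟩ := hf'.2 0
  unfold TT
  rw [← integral_sub (TT_integrable hk (hf.sec 0) (hC 0 le_rfl) a x) (TT_integrable hk (hf'.sec 0) (hC' 0 le_rfl) a x)]
  congr 1; ext ξ; ring

lemma GC.at {g : ℝ → ℝ → ℝ} (hg : GC g) (s : ℝ) : GC (fun _ => g s) := by
  obtain ⟨C, hC⟩ := hg.2 s
  exact GC_const (hg.sec s) (hC s le_rfl)

lemma CV_sub {K K' : ℝ → ℝ → ℝ → ℝ} (hc : KC K) (hb : KBd K) (hc' : KC K') (hb' : KBd K') {t : ℝ} (ht : 0 < t) (x : ℝ) :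
    CV K t x - CV K' t x = CV (fun s r x => K s r x - K' s r x) t x := by
  rw [CV_eq, CV_eq, CV_eq, ← intervalIntegral.integral_sub (CV_ii hc hb ht x) (CV_ii hc' hb' ht x)]
  congr 1; ext θ; ring

def Lm (l t : ℝ) : ℝ := l * (1 + t) ^ 2

lemma exp_le_rpow {x q : ℝ} (hx : 0 < x) (hq : 0 ≤ q) (hq1 : q ≤ 1) : eX (-x) ≤ x ^ (-q) := by
  rw [Real.rpow_neg hx.le, Real.exp_neg]
  refine inv_anti₀ (by positivity) ?_
  rcases le_total x 1 with h | h
  · exact (Real.rpow_le_one hx.le h hq).trans (Real.one_le_exp hx.le)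
  · calc x ^ q ≤ x ^ (1:ℝ) := Real.rpow_le_rpow_of_exponent_le h hq1
      _ = x := Real.rpow_one x
      _ ≤ _ := by linarith [Real.add_one_le_exp x]

lemma wgt {l s r t q : ℝ} (hl : 0 < l) (hs : 0 < s) (hr : 0 < r) (h : s + r = t) (hq : 0 ≤ q) (hq1 : q ≤ 1) :
    eX (Lm l s) ≤ eX (Lm l t) * (l ^ (-q) * (1 + t) ^ (-q) * r ^ (-q)) := by
  have h1 : Lm l s ≤ Lm l t + -(l * (1 + t) * r) := by
    have : s = t - r := by linarith
    unfold Lm; subst this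
    have : 0 ≤ l * r * (1 + (t - r)) := by positivity
    nlinarith
  calc _ ≤ eX (Lm l t + -(l * (1 + t) * r)) := Real.exp_le_exp.mpr h1
    _ = eX (Lm l t) * eX (-(l * (1 + t) * r)) := Real.exp_add _ _
    _ ≤ eX (Lm l t) * (l * (1 + t) * r) ^ (-q) := by
      gcongr; exact exp_le_rpow (by have : 0 < t := by linarith
                                    positivity) hq hq1
    _ = _ := by
      have : 0 < t := by linarith
      rw [Real.mul_rpow (by positivity) hr.le, Real.mul_rpow hl.le (by positivity)]

lemma t_aux {t q : ℝ} (ht : 0 < t) (hq : 0 ≤ q) : t ^ q * (1 + t) ^ (-q) ≤ 1 := by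
  rw [Real.rpow_neg (by positivity), ← div_eq_mul_inv, div_le_one (by positivity)]
  exact Real.rpow_le_rpow ht.le (by linarith) hq

lemma DD0 {d l N : ℝ} {g g' : ℝ → ℝ → ℝ} (hl : 1 ≤ l) (hN : 0 ≤ N) (hg : GC g) (hg' : GC g')
    (h : ∀ s y, 0 ≤ s → |g s y - g' s y| ≤ N * eX (Lm l s)) {t : ℝ} (ht : 0 < t) (x : ℝ) :
    |CV (E0 d g) t x - CV (E0 d g') t x| ≤ N * eX (Lm l t) * (cT * bt (3/4) 0 * l ^ xB) := by
  rw [CV_sub (E0_KC hg) (E0_bd hg).kbd (E0_KC hg') (E0_bd hg').kbd ht]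
  have hl0 : 0 < l := by linarith
  have hb := CV_bound (K := fun s r x => E0 d g s r x - E0 d g' s r x) (p := 3/4) (q := 0) (x := x)
    (B := N * cT * (eX (Lm l t) * (l ^ xH * (1 + t) ^ xH))) (by norm_num) (by norm_num) ht ?_
  · refine hb.trans ?_
    have h1 : t ^ (1 - 3/4 - 0:ℝ) * (1 + t) ^ xH ≤ 1 := by
      refine le_trans ?_ (t_aux ht (q := 1/4) (by norm_num))
      norm_num
      gcongr
      · linarith
      · norm_num
    have h2 : l ^ xH ≤ l ^ xB := Real.rpow_le_rpow_of_exponent_le hl (by norm_num)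
    have hcT := cT_pos
    have hbt := bt_nonneg (3/4) 0
    calc _ = (N * eX (Lm l t) * cT * bt (3/4) 0) * (l ^ xH * (t ^ (1 - 3/4 - 0:ℝ) * (1 + t) ^ xH)) := by ring
      _ ≤ (N * eX (Lm l t) * cT * bt (3/4) 0) * (l ^ xB * 1) := by gcongr
      _ = _ := by ring
  · intro s r hs hr hsr
    have hw := wgt (q := 3/4) hl0 hs hr hsr (by norm_num) (by norm_num)
    simp only [E0]
    rw [TT_sub KB0 (hg.at s) (hg'.at s)]
    refine (TT_bound KB0 (fun y => h s y hs.le) _ _).trans ?_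
    rw [neg_zero, Real.rpow_zero, mul_one]
    have hcT := cT_pos
    calc _ = N * cT * eX (Lm l s) := by ring
      _ ≤ N * cT * _ := mul_le_mul_of_nonneg_left hw (by positivity)
      _ = _ := by ring

lemma DD1 {d l N : ℝ} {g g' : ℝ → ℝ → ℝ} (hd : 0 < d) (hl : 1 ≤ l) (hN : 0 ≤ N) (hg : GC g) (hg' : GC g')
    (h : ∀ s y, 0 ≤ s → |g s y - g' s y| ≤ N * eX (Lm l s)) {t : ℝ} (ht : 0 < t) (x : ℝ) :
    |CV (E1 d g) t x - CV (E1 d g') t x| ≤ N * eX (Lm l t) * ((√(2 * d))⁻¹ * cT * bt (3/4) 0) := by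
  rw [CV_sub (E1_KC hd hg) (E1_bd hd hg).kbd (E1_KC hd hg') (E1_bd hd hg').kbd ht]
  have hl0 : 0 < l := by linarith
  have hb := CV_bound (K := fun s r x => E1 d g s r x - E1 d g' s r x) (p := 3/4) (q := 0) (x := x)
    (B := (√(2 * d))⁻¹ * (N * cT) * (eX (Lm l t) * (l ^ xB * (1 + t) ^ xB))) (by norm_num) (by norm_num) ht ?_
  · refine hb.trans ?_
    have h1 : t ^ (1 - 3/4 - 0:ℝ) * (1 + t) ^ xB ≤ 1 := by
      refine le_trans (le_of_eq ?_) (t_aux ht (q := 1/4) (by norm_num))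
      norm_num
    have h2 : l ^ xB ≤ 1 := Real.rpow_le_one_of_one_le_of_nonpos hl (by norm_num)
    have hcT := cT_pos
    have hbt := bt_nonneg (3/4) 0
    calc _ = (N * eX (Lm l t) * cT * bt (3/4) 0 * (√(2 * d))⁻¹) * (l ^ xB * (t ^ (1 - 3/4 - 0:ℝ) * (1 + t) ^ xB)) := by ring
      _ ≤ (N * eX (Lm l t) * cT * bt (3/4) 0 * (√(2 * d))⁻¹) * (1 * 1) := by gcongr
      _ = _ := by ring
  · intro s r hs hr hsr
    have hw := wgt (q := 1/4) hl0 hs hr hsr (by norm_num) (by norm_num)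
    simp only [E1]
    rw [← mul_sub, TT_sub KB1 (hg.at s) (hg'.at s), abs_mul, abs_of_pos (inv_pos.mpr (Ar_pos hd hr)), Ar_inv hd hr.le]
    have hT := TT_bound KB1 (fun y => h s y hs.le) (Ar d r) x
    rw [neg_zero, Real.rpow_zero, mul_one]
    have hcT := cT_pos
    have hr34 : r ^ xH = r ^ xA * r ^ xB := by rw [← Real.rpow_add hr]; norm_num
    calc _ ≤ (√(2 * d))⁻¹ * r ^ xA * (N * eX (Lm l s) * cT) := by gcongr
      _ = (√(2 * d))⁻¹ * r ^ xA * (N * cT) * eX (Lm l s) := by ring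
      _ ≤ (√(2 * d))⁻¹ * r ^ xA * (N * cT) * _ := mul_le_mul_of_nonneg_left hw (by positivity)
      _ = _ := by rw [hr34]; ring

lemma gF_diff (P : Par) {v₀ : ℝ → ℝ} {u u' : ℝ → ℝ → ℝ} (hv : GC (fun _ => v₀))
    (hu : Continuous (Function.uncurry u)) (hu' : Continuous (Function.uncurry u')) {l N : ℝ} (hl : 1 ≤ l) (hN : 0 ≤ N)
    (h : ∀ s y, 0 ≤ s → |u s y - u' s y| ≤ N * eX (Lm l s)) (t x : ℝ) (ht : 0 ≤ t) :
    |gF P v₀ u t x - gF P v₀ u' t x| ≤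
      ((|P.α| * (|P.γ| * (2 * ((√(2 * P.d₂))⁻¹ * cT * bt (3/4) 0)) + 2 * |P.γ / P.c|) + |P.α| + 3 * P.μ) * N) * eX (Lm l t) := by
  set A := (√(2 * P.d₂))⁻¹ * cT * bt (3/4) 0 with hA
  set X := N * eX (Lm l t) with hX
  have hXp : 0 ≤ X := by positivity
  have hbt := bt_nonneg (3/4) 0
  have hcT := cT_pos
  have hcl : ∀ s y, 0 ≤ s → |cl 1 (u s y) - cl 1 (u' s y)| ≤ N * eX (Lm l s) := by
    intro s y hs
    have := cl_lip 1 1 (u s y) (u' s y)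
    rw [sub_self, abs_zero, zero_add] at this
    exact this.trans (h s y hs)
  have hsq : ∀ s y, 0 ≤ s → |cl 1 (u s y) ^ 2 - cl 1 (u' s y) ^ 2| ≤ 2 * N * eX (Lm l s) := by
    intro s y hs
    have h1 := hcl s y hs
    have h2 := cl_abs zero_le_one (u s y)
    have h3 := cl_abs zero_le_one (u' s y)
    rw [show cl 1 (u s y) ^ 2 - cl 1 (u' s y) ^ 2 = (cl 1 (u s y) - cl 1 (u' s y)) * (cl 1 (u s y) + cl 1 (u' s y)) by ring, abs_mul]
    have h4 := abs_add_le (cl 1 (u s y)) (cl 1 (u' s y))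
    calc _ ≤ (N * eX (Lm l s)) * 2 := by gcongr; linarith
      _ = _ := by ring
  have hV : |Vop P v₀ u t x - Vop P v₀ u' t x| ≤ |P.γ| * (2 * A) * X := by
    rcases ht.eq_or_lt with rfl | htp
    · simp only [Vop, Vh, tp, max_self, CV_zero, sub_self, abs_zero]; positivity
    · simp only [Vop, Vh, tp_of ht]
      rw [add_sub_add_left_eq_sub, ← mul_sub, abs_mul]
      have := DD1 (d := P.d₂) (l := l) (N := 2 * N) (g := hF P u) (g' := hF P u') P.hd₂ hl (by positivity) (hF_GC P hu) (hF_GC P hu')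
        (fun s y hs => hsq s _ hs) htp (x + P.c * t)
      calc _ ≤ |P.γ| * _ := mul_le_mul_of_nonneg_left this (abs_nonneg _)
        _ = _ := by rw [hA, hX]; ring
  unfold gF
  have k1 := hcl t x ht
  have k2 := hsq t x ht
  have k3 := cl_abs zero_le_one (u t x)
  have k4 := cl_abs zero_le_one (u' t x)
  have k5 := (cl_lip (Wf P.η t x) (Wf P.η t x) (Vop P v₀ u t x + P.γ / P.c * (cl 1 (u t x)) ^ 2) (Vop P v₀ u' t x + P.γ / P.c * (cl 1 (u' t x)) ^ 2))
  rw [sub_self, abs_zero, zero_add] at k5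
  have k6 := ((cl_abs (Wf_pos P.hη t x).le (Vop P v₀ u t x + P.γ / P.c * (cl 1 (u t x)) ^ 2)).trans (Wf_le P.hη t x)).trans P.hη1
  set p := cl 1 (u t x)
  set p' := cl 1 (u' t x)
  set a := cl (Wf P.η t x) (Vop P v₀ u t x + P.γ / P.c * p ^ 2)
  set a' := cl (Wf P.η t x) (Vop P v₀ u' t x + P.γ / P.c * p' ^ 2)
  rw [← hX] at k1
  rw [mul_assoc, ← hX] at k2
  have k7 : |a - a'| ≤ (|P.γ| * (2 * A) + 2 * |P.γ / P.c|) * X := by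
    refine k5.trans ?_
    rw [show Vop P v₀ u t x + P.γ / P.c * p ^ 2 - (Vop P v₀ u' t x + P.γ / P.c * p' ^ 2) =
      (Vop P v₀ u t x - Vop P v₀ u' t x) + P.γ / P.c * (p ^ 2 - p' ^ 2) by ring]
    refine (abs_add_le _ _).trans ?_
    rw [abs_mul]
    calc _ ≤ |P.γ| * (2 * A) * X + |P.γ / P.c| * (2 * X) := by gcongr
      _ = _ := by ring
  have e : (P.α * a - P.μ * p ^ 2) * p - (P.α * a' - P.μ * p' ^ 2) * p' =
      P.α * ((a - a') * p') + P.α * (a * (p - p')) - P.μ * ((p ^ 2 - p' ^ 2) * p' + p ^ 2 * (p - p')) := by ring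
  rw [e]
  have hμ := P.hμ
  calc _ ≤ |P.α| * (|a - a'| * |p'|) + |P.α| * (|a| * |p - p'|) + P.μ * (|p ^ 2 - p' ^ 2| * |p'| + |p ^ 2| * |p - p'|) := by
        refine (abs_sub _ _).trans (add_le_add ((abs_add_le _ _).trans (le_of_eq (by simp only [abs_mul]))) ?_)
        rw [abs_mul, abs_of_pos hμ]
        gcongr
        refine (abs_add_le _ _).trans (le_of_eq (by simp only [abs_mul]))
    _ ≤ |P.α| * (((|P.γ| * (2 * A) + 2 * |P.γ / P.c|) * X) * 1) + |P.α| * (1 * X) + P.μ * ((2 * X) * 1 + 1 * X) := by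
        gcongr
        exact sq_le_one' k3
    _ = _ := by rw [hX]; ring

lemma Uop_cont (P : Par) {u₀ v₀ : ℝ → ℝ} {u : ℝ → ℝ → ℝ} (hu₀ : GC (fun _ => u₀)) (hv : GC (fun _ => v₀))
    (hu : Continuous (Function.uncurry u)) : Continuous (Function.uncurry (Uop P u₀ v₀ u)) :=
  (Md_GC hu₀ (gF_GC P hv hu)).1

lemma Uop_growth (P : Par) {u₀ v₀ : ℝ → ℝ} {u : ℝ → ℝ → ℝ} {C : ℝ} (hC : ∀ x, |u₀ x| ≤ C) (t x : ℝ) :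
    |Uop P u₀ v₀ u t x| ≤ C * cT + (|P.α| + P.μ) * cT * tp t * bt 0 0 := by
  unfold Uop Md
  refine (abs_add_le _ _).trans (add_le_add (TT_bound KB0 hC _ _) ?_)
  rcases (tp_nonneg t).eq_or_lt with h | h
  · rw [← h, CV_zero]; simp
  · have := CV_bound (K := E0 P.d₁ (gF P v₀ u)) (p := 0) (q := 0) (x := x) (B := (|P.α| + P.μ) * cT) (by norm_num) (by norm_num) h (fun s r _ _ _ => by
      simpa [E0] using TT_bound KB0 (gF_bd P v₀ u s) (Ar P.d₁ r) x)
    simpa using this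

lemma exists_fix (P : Par) {u₀ v₀ : ℝ → ℝ} (hu₀ : GC (fun _ => u₀)) (hv : GC (fun _ => v₀)) :
    ∃ u : ℝ → ℝ → ℝ, Continuous (Function.uncurry u) ∧ ∀ t x, u t x = Uop P u₀ v₀ u t x := by
  obtain ⟨C, hC⟩ := hu₀.2 0
  replace hC := hC 0 le_rfl
  set Q := (|P.α| * (|P.γ| * (2 * ((√(2 * P.d₂))⁻¹ * cT * bt (3/4) 0)) + 2 * |P.γ / P.c|) + |P.α| + 3 * P.μ) with hQ
  set D := Q * (cT * bt (3/4) 0) with hD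
  have hbt := bt_nonneg (3/4) 0
  have hbt0 := bt_nonneg 0 0
  have hcT := cT_pos
  have hμ := P.hμ
  have hQ0 : 0 ≤ Q := by positivity
  have hD0 : 0 ≤ D := by positivity
  set l : ℝ := (2 * D + 1) ^ 4 with hl
  have hl1 : 1 ≤ l := one_le_pow₀ (by linarith)
  have hl0 : 0 < l := by linarith
  have hlq : l ^ xB = (2 * D + 1)⁻¹ := by
    rw [hl, Real.rpow_neg (by positivity), ← Real.rpow_natCast, ← Real.rpow_mul (by positivity)]; norm_num
  have hlc : Continuous fun p : ℝ × ℝ => Lm l (tp p.1) := by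
    have := tp_cont; unfold Lm; fun_prop
  let ext (φ : BoundedContinuousFunction (ℝ × ℝ) ℝ) : ℝ → ℝ → ℝ := fun t x => eX (Lm l (tp t)) * φ (t, x)
  have hext : ∀ φ, Continuous (Function.uncurry (ext φ)) := fun φ => hlc.rexp.mul φ.continuous
  have hbound : ∀ (φ : BoundedContinuousFunction (ℝ × ℝ) ℝ) (p : ℝ × ℝ),
      ‖eX (-Lm l (tp p.1)) * Uop P u₀ v₀ (ext φ) p.1 p.2‖ ≤ C * cT + (|P.α| + P.μ) * cT * bt 0 0 := by
    intro φ p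
    rw [norm_mul, Real.norm_of_nonneg (Real.exp_pos _).le, Real.norm_eq_abs]
    have h1 := Uop_growth P (v₀ := v₀) (u := ext φ) hC p.1 p.2
    have h2 := tp_nonneg p.1
    have hC0 : 0 ≤ C := (abs_nonneg _).trans (hC 0)
    have h3 : tp p.1 ≤ Lm l (tp p.1) := by unfold Lm; nlinarith
    have h4 : eX (-Lm l (tp p.1)) ≤ 1 := Real.exp_le_one_iff.mpr (by linarith)
    have h5 : eX (-Lm l (tp p.1)) * tp p.1 ≤ 1 := by
      calc _ ≤ eX (-Lm l (tp p.1)) * eX (Lm l (tp p.1)) := by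
            gcongr; linarith [Real.add_one_le_exp (Lm l (tp p.1))]
        _ = 1 := by rw [← Real.exp_add]; simp
    calc _ ≤ eX (-Lm l (tp p.1)) * (C * cT + (|P.α| + P.μ) * cT * tp p.1 * bt 0 0) := by gcongr
      _ = eX (-Lm l (tp p.1)) * (C * cT) + (|P.α| + P.μ) * cT * bt 0 0 * (eX (-Lm l (tp p.1)) * tp p.1) := by ring
      _ ≤ 1 * (C * cT) + (|P.α| + P.μ) * cT * bt 0 0 * 1 := by gcongr
      _ = _ := by ring
  let Φ (φ : BoundedContinuousFunction (ℝ × ℝ) ℝ) : BoundedContinuousFunction (ℝ × ℝ) ℝ :=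
    BoundedContinuousFunction.ofNormedAddCommGroup
      (fun p : ℝ × ℝ => eX (-Lm l (tp p.1)) * Uop P u₀ v₀ (ext φ) p.1 p.2)
      ((hlc.neg.rexp).mul (Uop_cont P hu₀ hv (hext φ))) _ (hbound φ)
  have hcontr : ContractingWith (1/2) Φ := by
    refine ⟨by rw [← NNReal.coe_lt_coe]; norm_num, LipschitzWith.of_dist_le_mul fun φ ψ => ?_⟩
    rw [BoundedContinuousFunction.dist_le (by positivity)]
    rintro ⟨t, x⟩
    have hN : ∀ s y, 0 ≤ s → |ext φ s y - ext ψ s y| ≤ dist φ ψ * eX (Lm l s) := by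
      intro s y hs
      simp only [ext, tp_of hs]
      rw [← mul_sub, abs_mul, abs_of_pos (Real.exp_pos _), mul_comm]
      gcongr
      exact BoundedContinuousFunction.dist_coe_le_dist (f := φ) (g := ψ) (s, y)
    show dist (eX (-Lm l (tp t)) * Uop P u₀ v₀ (ext φ) t x) (eX (-Lm l (tp t)) * Uop P u₀ v₀ (ext ψ) t x) ≤ _
    rw [Real.dist_eq, ← mul_sub, abs_mul, abs_of_pos (Real.exp_pos _)]
    simp only [Uop, Md]
    rw [add_sub_add_left_eq_sub]
    rcases (tp_nonneg t).eq_or_lt with h | h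
    · rw [← h, CV_zero, CV_zero]; simp
    · have hd := DD0 (d := P.d₁) (N := Q * dist φ ψ) (g := gF P v₀ (ext φ)) (g' := gF P v₀ (ext ψ)) hl1 (by positivity) (gF_GC P hv (hext φ)) (gF_GC P hv (hext ψ))
        (fun s y hs => gF_diff P hv (hext φ) (hext ψ) hl1 dist_nonneg hN s y hs) h x
      rw [hlq] at hd
      have hee : eX (-Lm l (tp t)) * eX (Lm l (tp t)) = 1 := by rw [← Real.exp_add]; simp
      calc _ ≤ eX (-Lm l (tp t)) * _ := mul_le_mul_of_nonneg_left hd (Real.exp_pos _).le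
        _ = (eX (-Lm l (tp t)) * eX (Lm l (tp t))) * (D * (2 * D + 1)⁻¹) * dist φ ψ := by rw [hD]; ring
        _ = (D * (2 * D + 1)⁻¹) * dist φ ψ := by rw [hee, one_mul]
        _ ≤ (1/2) * dist φ ψ := by
          gcongr
          rw [← div_eq_mul_inv, div_le_iff₀ (by positivity)]; linarith
        _ = _ := by simp
  have hfix := hcontr.fixedPoint_isFixedPt
  set φ := ContractingWith.fixedPoint Φ hcontr with hφ
  refine ⟨ext φ, hext φ, fun t x => ?_⟩
  have : φ (t, x) = eX (-Lm l (tp t)) * Uop P u₀ v₀ (ext φ) t x := by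
    conv_lhs => rw [← hfix]
    rfl
  show eX (Lm l (tp t)) * φ (t, x) = _
  rw [this, ← mul_assoc, ← Real.exp_add]; simp

structure Dat (P : Par) (M δ : ℝ) where
  u₀ : ℝ → ℝ
  u₀' : ℝ → ℝ
  v₀ : ℝ → ℝ
  u : ℝ → ℝ → ℝ
  hM : 1 ≤ M
  hδ : 0 < δ
  hδ1 : δ ≤ 1
  hd : ∀ x, HasDerivAt u₀ (u₀' x) x
  hd' : Continuous u₀'
  hv : Continuous v₀
  bu : ∀ x, |u₀ x| ≤ δ * eX (-M⁻¹ * (x - 0) ^ 2)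
  bu' : ∀ x, |u₀' x| ≤ δ * eX (-M⁻¹ * (x - 0) ^ 2)
  bv : ∀ x, |v₀ x| ≤ δ * eX (-M⁻¹ * (x - 0) ^ 2)
  hu : Continuous (Function.uncurry u)
  hfix : ∀ t x, u t x = Uop P u₀ v₀ u t x

lemma lip_of_deriv {f f' : ℝ → ℝ} {C : ℝ} (h : ∀ x, HasDerivAt f (f' x) x) (hb : ∀ x, |f' x| ≤ C) (x y : ℝ) :
    |f x - f y| ≤ C * |x - y| := by
  have := convex_univ.norm_image_sub_le_of_norm_hasDerivWithin_le (f := f) (f' := f') (C := C) (x := y) (y := x)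
    (fun z _ => (h z).hasDerivWithinAt) (fun z _ => by simpa using hb z) (mem_univ _) (mem_univ _)
  simpa using this

lemma gauss_le {δ l y : ℝ} (hδ : 0 < δ) (hl : 0 ≤ l) : δ * eX (-l * y ^ 2) ≤ δ := by
  have : eX (-l * y ^ 2) ≤ 1 := by rw [Real.exp_le_one_iff]; nlinarith [mul_nonneg hl (sq_nonneg y)]
  nlinarith

namespace Dat
variable {P : Par} {M δ : ℝ} (D : Dat P M δ)

def g : ℝ → ℝ → ℝ := gF P D.v₀ D.u
def ux (t x : ℝ) : ℝ := E0 P.d₁ (fun _ => D.u₀') 0 (tp t) x + CV (E1 P.d₁ D.g) (tp t) x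
def uxx (t x : ℝ) : ℝ := Md2 P.d₁ D.u₀ D.g t x

lemma hM0 (D : Dat P M δ) : 0 ≤ M⁻¹ := by have := D.hM; positivity
lemma bu1 (x : ℝ) : |D.u₀ x| ≤ δ := (D.bu x).trans (gauss_le D.hδ D.hM0)
lemma bu1' (x : ℝ) : |D.u₀' x| ≤ δ := (D.bu' x).trans (gauss_le D.hδ D.hM0)
lemma bv1 (x : ℝ) : |D.v₀ x| ≤ δ := (D.bv x).trans (gauss_le D.hδ D.hM0)
lemma u₀_cont : Continuous D.u₀ := continuous_iff_continuousAt.2 fun x => (D.hd x).continuousAt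
lemma u₀_GC : GC (fun _ => D.u₀) := GC_const D.u₀_cont D.bu1
lemma u₀'_GC : GC (fun _ => D.u₀') := GC_const D.hd' D.bu1'
lemma v₀_GC : GC (fun _ => D.v₀) := GC_const D.hv D.bv1
lemma g_GC : GC D.g := gF_GC P D.v₀_GC D.hu
lemma u_eq {t : ℝ} (ht : 0 ≤ t) (x : ℝ) : D.u t x = Md P.d₁ D.u₀ D.g t x := by
  rw [D.hfix, Uop, tp_of ht]; rfl
lemma u_GC : GC D.u := by
  have : D.u = fun t x => Md P.d₁ D.u₀ D.g (max t 0) x := by funext t x; rw [D.hfix]; rfl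
  rw [this]; exact Md_GC D.u₀_GC D.g_GC
lemma ux_GC : GC D.ux := by
  refine ⟨?_, fun T => ?_⟩
  · refine Continuous.add ?_ ?_
    · have := tp_cont
      exact (E0_cont D.u₀'_GC).comp (by fun_prop : Continuous fun p : ℝ × ℝ => ((0:ℝ), tp p.1, p.2))
    · exact CV_cont (E1_KC P.hd₁ D.g_GC) (E1_bd P.hd₁ D.g_GC)
  · obtain ⟨C, hC⟩ := CV_locbdd (E1_bd P.hd₁ D.g_GC) T
    exact ⟨δ * cT + C, fun s hs x => (abs_add_le _ _).trans (add_le_add (TT_bound KB0 D.bu1' _ _) (hC s hs x))⟩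
lemma ux_eq {t : ℝ} (ht : 0 < t) (x : ℝ) : D.ux t x = Md1 P.d₁ D.u₀ D.g t x := by
  rw [ux, tp_of ht.le, Md1, E1, TT_shift KB0 KB1 k0_deriv D.hd D.hd' D.bu1 D.bu1' (Ar_pos P.hd₁ ht)]; rfl
lemma u_dx (t x : ℝ) : HasDerivAt (fun y => D.u t y) (D.ux t x) x := by
  rcases (tp_nonneg t).eq_or_lt with h | h
  · have e : (fun y => D.u t y) = D.u₀ := by
      funext y; rw [D.hfix, Uop, ← h, Md_zero]
    rw [e, ux, ← h, CV_zero, E0, Ar_zero, TT_zero, add_zero]; exact D.hd x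
  · have ht : 0 < t := by unfold tp at h; by_contra hh; rw [max_eq_right (not_lt.1 hh)] at h; exact lt_irrefl _ h
    rw [D.ux_eq ht, funext fun y => D.u_eq ht.le y]
    exact Md_dx P.hd₁ D.u₀_GC D.g_GC ht x
lemma cl_u_lip {T C : ℝ} (hC : ∀ s ≤ T, ∀ x, |D.ux s x| ≤ C) (s : ℝ) (hs : s ≤ T) (x y : ℝ) :
    |cl 1 (D.u s x) - cl 1 (D.u s y)| ≤ C * |x - y| := by
  have := cl_lip 1 1 (D.u s x) (D.u s y)
  rw [sub_self, abs_zero, zero_add] at this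
  exact this.trans (lip_of_deriv (D.u_dx s) (hC s hs) x y)
lemma sq_lip {a b : ℝ} (ha : |a| ≤ 1) (hb : |b| ≤ 1) : |a ^ 2 - b ^ 2| ≤ 2 * |a - b| := by
  rw [show a ^ 2 - b ^ 2 = (a + b) * (a - b) by ring, abs_mul]
  gcongr; exact (abs_add_le _ _).trans (by linarith)
lemma hF_SL : SL (hF P D.u) := by
  intro T
  obtain ⟨C, hC⟩ := D.ux_GC.2 T
  refine ⟨2 * C * √T, fun s x y hs hsT => ?_⟩
  have h1 := D.cl_u_lip hC s hsT (x - P.c * s) (y - P.c * s)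
  have h0 := (abs_nonneg _).trans (hC s hsT 0)
  have h2 := one_le_half hs hsT
  rw [sub_sub_sub_cancel_right] at h1
  refine (sq_lip (cl_abs zero_le_one _) (cl_abs zero_le_one _)).trans ?_
  calc _ ≤ 2 * (C * |x - y|) * 1 := by linarith
    _ ≤ 2 * (C * |x - y|) * (√T * s ^ xA) := by gcongr
    _ = _ := by ring
lemma Vh_lip (T : ℝ) : ∃ L, ∀ s x y, 0 < s → s ≤ T → |Vh P D.v₀ D.u s x - Vh P D.v₀ D.u s y| ≤ L * s ^ xA * |x - y| := by
  obtain ⟨B, hB⟩ := E2_bd P.hd₂ (hF_GC P D.hu) D.hF_SL T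
  have hbt := bt_nonneg (1/2) (1/2)
  refine ⟨δ * cT * (√(2 * P.d₂))⁻¹ + |P.γ| * (B * bt (1/2) (1/2)) * √T, fun s x y hs hsT => ?_⟩
  refine lip_of_deriv (f := Vh P D.v₀ D.u s) (f' := fun x => E1 P.d₂ (fun _ => D.v₀) 0 s x + P.γ * CV (E2 P.d₂ (hF P D.u)) s x)
    (fun x => (E0_dx P.hd₂ D.v₀_GC 0 s x hs).add ((D1_dx P.hd₂ (hF_GC P D.hu) D.hF_SL hs x).const_mul _)) (fun x => ?_) x y
  have h1 := E1_le (g := fun _ => D.v₀) (s := 0) P.hd₂ hs D.bv1 x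
  have h2 := CV_bd hB hs hsT x
  have h3 := one_le_half hs hsT
  have h4 := (abs_nonneg _).trans h2
  refine (abs_add_le _ _).trans ?_
  rw [abs_mul, add_mul]
  refine add_le_add h1 ?_
  calc _ ≤ |P.γ| * (B * bt (1/2) (1/2)) * 1 := by rw [mul_one]; gcongr
    _ ≤ |P.γ| * (B * bt (1/2) (1/2)) * (√T * s ^ xA) := by gcongr
    _ = _ := by ring
lemma alg_lip {α μ a a' p p' : ℝ} (hμ : 0 < μ) (ha : |a| ≤ 1) (hp : |p| ≤ 1) (hp' : |p'| ≤ 1) :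
    |(α * a - μ * p ^ 2) * p - (α * a' - μ * p' ^ 2) * p'| ≤ |α| * |a - a'| + (|α| + 3 * μ) * |p - p'| := by
  have e : (α * a - μ * p ^ 2) * p - (α * a' - μ * p' ^ 2) * p' =
      α * ((a - a') * p') + α * (a * (p - p')) - μ * ((p ^ 2 + p * p' + p' ^ 2) * (p - p')) := by ring
  have h1 : |p ^ 2 + p * p' + p' ^ 2| ≤ 3 := by
    rw [abs_le] at hp hp' ⊢
    constructor <;> nlinarith [sq_nonneg (p + p')]
  rw [e]
  calc _ ≤ |α| * (|a - a'| * |p'|) + |α| * (|a| * |p - p'|) + μ * (|p ^ 2 + p * p' + p' ^ 2| * |p - p'|) := by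
        refine (abs_sub _ _).trans (add_le_add ((abs_add_le _ _).trans (le_of_eq (by simp only [abs_mul]))) ?_)
        rw [abs_mul, abs_of_pos hμ, abs_mul]
    _ ≤ |α| * (|a - a'| * 1) + |α| * (1 * |p - p'|) + μ * (3 * |p - p'|) := by gcongr
    _ = _ := by ring
lemma g_SL : SL D.g := by
  intro T
  obtain ⟨C, hC⟩ := D.ux_GC.2 T
  obtain ⟨L, hL⟩ := D.Vh_lip T
  refine ⟨|P.α| * (√T + L + 2 * |P.γ / P.c| * C * √T) + (|P.α| + 3 * P.μ) * C * √T, fun s x y hs hsT => ?_⟩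
  have hμ := P.hμ
  have h0 := (abs_nonneg _).trans (hC s hsT 0)
  have h1 := D.cl_u_lip hC s hsT x y
  have h2 := one_le_half hs hsT
  have h3 := hL s (x + P.c * s) (y + P.c * s) hs hsT
  have h4 := Wf_lip P.hη s x y
  have h5 : P.η * |x - y| ≤ |x - y| := by nlinarith [P.hη1, abs_nonneg (x - y)]
  have h6 := sq_lip (cl_abs zero_le_one (D.u s x)) (cl_abs zero_le_one (D.u s y))
  rw [add_sub_add_right_eq_sub] at h3
  unfold g gF
  refine (alg_lip hμ (((cl_abs (Wf_pos P.hη s x).le _).trans (Wf_le P.hη s x)).trans P.hη1) (cl_abs zero_le_one _) (cl_abs zero_le_one _)).trans ?_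
  set R := s ^ xA
  have hR : 0 ≤ R := Real.rpow_nonneg hs.le _
  have hx := abs_nonneg (x - y)
  set X := |x - y|
  have k0 : X ≤ √T * R * X := by nlinarith
  have k1 : |cl 1 (D.u s x) - cl 1 (D.u s y)| ≤ C * (√T * R * X) := h1.trans (by gcongr)
  have k2 : |cl (Wf P.η s x) (Vop P D.v₀ D.u s x + P.γ / P.c * (cl 1 (D.u s x)) ^ 2) -
      cl (Wf P.η s y) (Vop P D.v₀ D.u s y + P.γ / P.c * (cl 1 (D.u s y)) ^ 2)| ≤
      √T * R * X + (L * R * X + |P.γ / P.c| * (2 * (C * (√T * R * X)))) := by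
    refine (cl_lip _ _ _ _).trans (add_le_add ((h4.trans h5).trans k0) ?_)
    rw [add_sub_add_comm, ← mul_sub]
    refine (abs_add_le _ _).trans (add_le_add ?_ ?_)
    · unfold Vop; rw [tp_of hs.le]; exact h3
    · rw [abs_mul]; refine mul_le_mul_of_nonneg_left (h6.trans ?_) (abs_nonneg _); linarith
  calc _ ≤ |P.α| * (√T * R * X + (L * R * X + |P.γ / P.c| * (2 * (C * (√T * R * X))))) + (|P.α| + 3 * P.μ) * (C * (√T * R * X)) :=
        add_le_add (mul_le_mul_of_nonneg_left k2 (abs_nonneg _)) (mul_le_mul_of_nonneg_left k1 (by positivity))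
    _ = _ := by ring

lemma u_dxx {t : ℝ} (ht : 0 < t) (x : ℝ) : HasDerivAt (fun y => D.ux t y) (D.uxx t x) x := by
  rw [funext fun y => D.ux_eq ht y]; exact Md1_dx P.hd₁ D.u₀_GC D.g_GC D.g_SL ht x
lemma u_dt {t : ℝ} (ht : 0 < t) (x : ℝ) : HasDerivAt (fun t => D.u t x) (P.d₁ * D.uxx t x + D.g t x) t := by
  refine (Md_dt P.hd₁ D.u₀_GC D.g_GC D.g_SL ht x).congr_of_eventuallyEq ?_
  filter_upwards [lt_mem_nhds ht] with s hs
  exact D.u_eq hs.le x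
lemma uxx_contAt {t : ℝ} (ht : 0 < t) (x : ℝ) : ContinuousAt (fun p : ℝ × ℝ => D.uxx p.1 p.2) (t, x) :=
  Md2_contAt P.hd₁ D.u₀_GC D.g_GC D.g_SL ht x
lemma ux_SL : SL D.ux := by
  intro T
  obtain ⟨B, hB⟩ := E2_bd P.hd₁ D.g_GC D.g_SL T
  have hbt := bt_nonneg (1/2) (1/2)
  refine ⟨δ * cT * (√(2 * P.d₁))⁻¹ + (B * bt (1/2) (1/2)) * √T, fun s x y hs hsT => ?_⟩
  refine lip_of_deriv (D.u_dxx hs) (fun x => ?_) x y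
  have h1 := E2_le (g := fun _ => D.u₀) (s := 0) P.hd₁ hs D.u₀_cont D.bu1 (lip_of_deriv D.hd D.bu1') x
  have h2 := CV_bd hB hs hsT x
  have h3 := one_le_half hs hsT
  have h4 := (abs_nonneg _).trans h2
  refine (abs_add_le _ _).trans ?_
  rw [add_mul]
  refine add_le_add h1 (h2.trans ?_)
  calc _ = (B * bt (1/2) (1/2)) * 1 := by rw [mul_one]
    _ ≤ (B * bt (1/2) (1/2)) * (√T * s ^ xA) := by gcongr
    _ = _ := by ring

def hy (s y : ℝ) : ℝ := P.γ * (2 * D.u s (y - P.c * s) * D.ux s (y - P.c * s))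
def v (t x : ℝ) : ℝ := Vop P D.v₀ D.u t x
def vh (t x : ℝ) : ℝ := Vh P D.v₀ D.u t x

lemma hy_GC : GC D.hy := by
  refine ⟨?_, fun T => ?_⟩
  · have h := D.u_GC.1.comp (by fun_prop : Continuous fun p : ℝ × ℝ => (p.1, p.2 - P.c * p.1))
    have h' := D.ux_GC.1.comp (by fun_prop : Continuous fun p : ℝ × ℝ => (p.1, p.2 - P.c * p.1))
    exact continuous_const.mul ((continuous_const.mul h).mul h')
  · obtain ⟨C, hC⟩ := D.u_GC.2 T
    obtain ⟨C', hC'⟩ := D.ux_GC.2 T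
    refine ⟨|P.γ| * (2 * C * C'), fun s hs x => ?_⟩
    unfold hy
    have a := hC s hs (x - P.c * s)
    have b := hC' s hs (x - P.c * s)
    have := (abs_nonneg _).trans a
    rw [abs_mul, abs_mul, abs_mul, abs_two]
    gcongr
lemma hy_SL : SL D.hy := by
  intro T
  obtain ⟨C, hC⟩ := D.u_GC.2 T
  obtain ⟨C', hC'⟩ := D.ux_GC.2 T
  obtain ⟨L, hL⟩ := D.ux_SL T
  refine ⟨|P.γ| * (2 * (C' * C' * √T + C * L)), fun s x y hs hsT => ?_⟩
  unfold hy
  have k := one_le_half hs hsT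
  have hl := hL s (x - P.c * s) (y - P.c * s) hs hsT
  have hu := lip_of_deriv (D.u_dx s) (hC' s hsT) (x - P.c * s) (y - P.c * s)
  rw [sub_sub_sub_cancel_right] at hl hu
  have a := hC s hsT (x - P.c * s)
  have b := hC' s hsT (y - P.c * s)
  generalize D.u s (x - P.c * s) = p at *
  generalize D.u s (y - P.c * s) = p' at *
  generalize D.ux s (x - P.c * s) = q at *
  generalize D.ux s (y - P.c * s) = q' at *
  have hC0 := (abs_nonneg _).trans a
  have hC0' := (abs_nonneg _).trans b
  set R := s ^ xA
  have hR : 0 ≤ R := Real.rpow_nonneg hs.le _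
  set X := |x - y|
  have hX : 0 ≤ X := abs_nonneg _
  have k0 : X ≤ √T * R * X := by nlinarith
  rw [show P.γ * (2 * p * q) - P.γ * (2 * p' * q') = P.γ * (2 * ((p - p') * q' + p * (q - q'))) by ring, abs_mul, abs_mul, abs_two]
  have : |(p - p') * q' + p * (q - q')| ≤ (C' * (√T * R * X)) * C' + C * (L * R * X) := by
    refine (abs_add_le _ _).trans ?_
    rw [abs_mul, abs_mul]
    have := hu.trans (mul_le_mul_of_nonneg_left k0 hC0')
    gcongr
  calc _ ≤ |P.γ| * (2 * ((C' * (√T * R * X)) * C' + C * (L * R * X))) := by gcongr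
    _ = _ := by ring
lemma vh_eq (h1 : ∀ t x, |D.u t x| ≤ 1) {t : ℝ} (ht : 0 ≤ t) (x : ℝ) : D.vh t x = Md P.d₂ D.v₀ D.hy t x := by
  unfold vh Vh Md
  congr 1
  unfold CV
  rw [← intervalIntegral.integral_const_mul]
  refine intervalIntegral.integral_congr_ae ?_
  filter_upwards [ae_ne1 t] with s hs hs'
  rw [uIoc_of_le ht] at hs'
  have hst : 0 < t - s := sub_pos.2 (lt_of_le_of_ne hs'.2 hs)
  have hA := Ar_pos P.hd₂ hst
  obtain ⟨C, hC⟩ := D.hy_GC.2 s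
  have e := TT_shift (f := fun y => P.γ * hF P D.u s y) (f' := D.hy s) (C := |P.γ| * 1) (C' := C) KB0 KB1 k0_deriv (fun y => by
      have hd := ((D.u_dx s (y - P.c * s)).comp y ((hasDerivAt_id y).sub_const (P.c * s))).pow 2
      have e : (fun y => hF P D.u s y) = (fun y => D.u s (y - P.c * s) ^ 2) := by
        funext y; rw [hF, cl_of (h1 _ _)]
      have := (hd.const_mul P.γ)
      simp only [hF, cl_of (h1 _ _)]
      refine this.congr_deriv ?_
      simp [hy]) (D.hy_GC.sec s) (fun y => by rw [abs_mul]; exact mul_le_mul_of_nonneg_left (sq_le_one' (cl_abs zero_le_one _)) (abs_nonneg _)) (fun y => hC s le_rfl y) hA x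
  unfold E1 E0
  rw [← e]
  unfold TT
  simp only [mul_assoc]
  rw [integral_const_mul]
  ring
def vhx (t x : ℝ) : ℝ := Md1 P.d₂ D.v₀ D.hy t x
def vhxx (t x : ℝ) : ℝ := Md2 P.d₂ D.v₀ D.hy t x
lemma vh_dx (h1 : ∀ t x, |D.u t x| ≤ 1) {t : ℝ} (ht : 0 < t) (x : ℝ) : HasDerivAt (fun y => D.vh t y) (D.vhx t x) x := by
  rw [funext fun y => D.vh_eq h1 ht.le y]; exact Md_dx P.hd₂ D.v₀_GC D.hy_GC ht x
lemma vh_dxx {t : ℝ} (ht : 0 < t) (x : ℝ) : HasDerivAt (fun y => D.vhx t y) (D.vhxx t x) x :=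
  Md1_dx P.hd₂ D.v₀_GC D.hy_GC D.hy_SL ht x
lemma vh_dt (h1 : ∀ t x, |D.u t x| ≤ 1) {t : ℝ} (ht : 0 < t) (x : ℝ) : HasDerivAt (fun t => D.vh t x) (P.d₂ * D.vhxx t x + D.hy t x) t := by
  refine (Md_dt P.hd₂ D.v₀_GC D.hy_GC D.hy_SL ht x).congr_of_eventuallyEq ?_
  filter_upwards [lt_mem_nhds ht] with s hs
  exact D.vh_eq h1 hs.le x
end Dat

def Pf (l t x : ℝ) : ℝ := eX (-(l / (1 + t)) * x ^ 2)
lemma Pf_pos (l t x : ℝ) : 0 < Pf l t x := Real.exp_pos _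
lemma Pf_le_one {l t : ℝ} (hl : 0 ≤ l) (ht : 0 ≤ t) (x : ℝ) : Pf l t x ≤ 1 := by
  unfold Pf; rw [Real.exp_le_one_iff]
  have : 0 ≤ l / (1 + t) * x ^ 2 := by positivity
  linarith
lemma Pf_mono {l l' t : ℝ} (hl : l' ≤ l) (ht : 0 ≤ t) (x : ℝ) : Pf l t x ≤ Pf l' t x := by
  unfold Pf; rw [Real.exp_le_exp]
  have : l' / (1 + t) ≤ l / (1 + t) := by gcongr
  nlinarith [sq_nonneg x]

def sg (d M t : ℝ) : ℝ := M + 4 * d * t + 4 * (1 + t) ^ (3/4:ℝ)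
def psi (d M L t x : ℝ) : ℝ := -L * (1 + t) ^ xB - 1/2 * Real.log (sg d M t) - x ^ 2 / sg d M t
def mm (d : ℝ) : ℝ := min 4 (4 * d)
def mp (d M : ℝ) : ℝ := M + 4 * d + 4
def LL (d : ℝ) : ℝ := 4 * (3 / (2 * mm d) + 1)
def cc (d M : ℝ) : ℝ := min 1 (3 / (mp d M) ^ 2)

lemma mm_pos {d : ℝ} (hd : 0 < d) : 0 < mm d := by unfold mm; positivity
lemma sg_ge {d M t : ℝ} (hM : 1 ≤ M) (ht : 0 ≤ t) : mm d * (1 + t) ≤ sg d M t := by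
  have h1 : (1:ℝ) ≤ (1 + t) ^ (3/4:ℝ) := Real.one_le_rpow (by linarith) (by norm_num)
  have h2 : mm d ≤ 4 := min_le_left _ _
  have h3 : mm d ≤ 4 * d := min_le_right _ _
  unfold sg; nlinarith
lemma sg_le {d M t : ℝ} (hd : 0 < d) (hM : 1 ≤ M) (ht : 0 ≤ t) : sg d M t ≤ mp d M * (1 + t) := by
  have h1 : (1 + t) ^ (3/4:ℝ) ≤ (1 + t) ^ (1:ℝ) := Real.rpow_le_rpow_of_exponent_le (by linarith) (by norm_num)
  rw [Real.rpow_one] at h1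
  unfold sg mp; nlinarith [mul_nonneg hd.le ht]
lemma sg_pos {d M t : ℝ} (hd : 0 < d) (hM : 1 ≤ M) (ht : 0 ≤ t) : 0 < sg d M t :=
  lt_of_lt_of_le (by have := mm_pos hd; positivity) (sg_ge hM ht)
lemma sg_dt {d M t : ℝ} (ht : 0 ≤ t) : HasDerivAt (sg d M) (4 * d + 3 * (1 + t) ^ xB) t := by
  have h1 := ((hasDerivAt_id t).const_add 1).rpow_const (p := 3/4) (Or.inl (by simp; linarith))
  have h2 := (((hasDerivAt_id t).const_mul (4 * d)).const_add M).add (h1.const_mul 4)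
  refine h2.congr_deriv ?_
  simp only [id]
  rw [show (3/4:ℝ) - 1 = -(1/4) by norm_num]; ring
lemma psi_dt {d M L t : ℝ} (hd : 0 < d) (hM : 1 ≤ M) (ht : 0 ≤ t) (x : ℝ) : HasDerivAt (fun t => psi d M L t x)
    (L / 4 * (1 + t) ^ xC - (4 * d + 3 * (1 + t) ^ xB) / (2 * sg d M t)
      + x ^ 2 * (4 * d + 3 * (1 + t) ^ xB) / sg d M t ^ 2) t := by
  have hs := sg_pos hd hM ht
  have h0 := sg_dt (d := d) (M := M) ht
  have h1 := ((hasDerivAt_id t).const_add 1).rpow_const (p := -(1/4)) (Or.inl (by simp; linarith))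
  have h2 := ((h1.const_mul (-L)).sub ((h0.log hs.ne').const_mul (1/2))).sub ((h0.inv hs.ne').const_mul (x ^ 2))
  refine (h2.congr_deriv ?_)
  simp only [id]
  rw [show -(1/4:ℝ) - 1 = -(5/4) by norm_num]; field_simp; ring
lemma psi_dx {d M L t : ℝ} (x : ℝ) : HasDerivAt (fun x => psi d M L t x) (-2 * x / sg d M t) x := by
  have h := (((hasDerivAt_id x).pow 2).div_const (sg d M t)).const_sub (-L * (1 + t) ^ xB - 1/2 * Real.log (sg d M t))
  refine h.congr_deriv ?_
  simp; ring

lemma brk {d M t x η α : ℝ} (hd : 0 < d) (hM : 1 ≤ M) (ht : 0 ≤ t) (hη : 0 < η) (h : |α| * η ≤ cc d M) :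
    |α| * Wf η t x ≤ LL d / 4 * (1 + t) ^ xC + 3 * (1 + t) ^ xB * (x ^ 2 / sg d M t ^ 2 - 1 / (2 * sg d M t)) := by
  have hs := sg_pos hd hM ht
  have h1 := sg_ge (d := d) hM ht
  have h2 := sg_le hd hM ht
  have hm := mm_pos hd
  have hp : 0 < mp d M := by unfold mp; positivity
  unfold Wf; rw [ta_of ht]
  have e : (1 + t) ^ xC = (1 + t) ^ xB * (1 / (1 + t)) := by
    rw [one_div (1 + t), ← Real.rpow_neg_one (1 + t), ← Real.rpow_add (by linarith)]; norm_num
  rw [e]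
  have hq : 0 < (1 + t) ^ xB := Real.rpow_pos_of_pos (by linarith) _
  set q := (1 + t) ^ xB
  set τ := 1 + t with hτ
  have ht1 : 1 ≤ τ := by linarith
  have k1 : 1 / (2 * sg d M t) ≤ 1 / (2 * (mm d * τ)) := by gcongr
  have k2 : x ^ 2 / (mp d M * τ) ^ 2 ≤ x ^ 2 / sg d M t ^ 2 := by gcongr
  have k3 : (τ + x ^ 2) / (τ ^ 2 + x ^ 2) ≤ (τ + x ^ 2) / τ ^ 2 := by gcongr; nlinarith [sq_nonneg x]
  have k4 : cc d M ≤ 1 := min_le_left _ _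
  have k5 : cc d M ≤ 3 / (mp d M) ^ 2 := min_le_right _ _
  have k6 : |α| * η * (τ + x ^ 2) / τ ^ 2 ≤ 1 / τ + 3 * (x ^ 2 / (mp d M * τ) ^ 2) := by
    rw [show 1 / τ + 3 * (x ^ 2 / (mp d M * τ) ^ 2) = (1 * τ + 3 / (mp d M) ^ 2 * x ^ 2) / τ ^ 2 by field_simp]
    gcongr
    have a := h.trans k4
    have b := h.trans k5
    nlinarith [sq_nonneg x]
  have k7 : |α| * η * (τ + x ^ 2) / τ ^ 2 = |α| * (η * ((τ + x ^ 2) / τ ^ 2)) := by ring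
  have k8 : |α| * (η * ((τ + x ^ 2) / (τ ^ 2 + x ^ 2))) ≤ 1 / τ + 3 * (x ^ 2 / (mp d M * τ) ^ 2) := by
    refine le_trans ?_ (k7 ▸ k6); gcongr
  have k9 : LL d / 4 * (1 / τ) = 3 * (1 / (2 * (mm d * τ))) + 1 / τ := by unfold LL; field_simp
  have k10 : LL d / 4 * (1 / τ) + 3 * (x ^ 2 / sg d M t ^ 2 - 1 / (2 * sg d M t)) ≥ 1 / τ + 3 * (x ^ 2 / (mp d M * τ) ^ 2) := by
    rw [k9]; linarith
  calc _ = q * (|α| * (η * ((τ + x ^ 2) / (τ ^ 2 + x ^ 2)))) := by ring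
    _ ≤ q * (LL d / 4 * (1 / τ) + 3 * (x ^ 2 / sg d M t ^ 2 - 1 / (2 * sg d M t))) := by gcongr; linarith
    _ = _ := by ring

lemma cl_sgn {e z : ℝ} (he : e = 1 ∨ e = -1) (hz : 0 < e * z) : 0 ≤ e * cl 1 z ∧ e * cl 1 z ≤ e * z := by
  unfold cl
  rcases he with rfl | rfl
  · simp only [one_mul] at hz ⊢
    exact ⟨le_max_of_le_right (le_min zero_le_one hz.le), max_le (by linarith) (min_le_right _ _)⟩
  · have h : z < 0 := by linarith
    rw [min_eq_right (by linarith)]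
    refine ⟨?_, ?_⟩
    · have : max (-1) z ≤ 0 := max_le (by norm_num) h.le
      linarith
    · have := le_max_right (-1) z
      linarith

namespace Dat
variable {P : Par} {M δ : ℝ} (D : Dat P M δ)

lemma u_sup (h : |P.α| * P.η ≤ cc P.d₁ M) {e : ℝ} (he : e = 1 ∨ e = -1) {t : ℝ} (ht : 0 ≤ t) (x : ℝ) :
    e * D.u t x ≤ (δ * eX (LL P.d₁) * √(M + 4)) * eX (psi P.d₁ M (LL P.d₁) t x) := by
  have hd := P.hd₁
  have hM := D.hM
  set δ₁ := δ * eX (LL P.d₁) * √(M + 4) with hδ₁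
  have hδ := D.hδ
  have hδ₁0 : 0 < δ₁ := by positivity
  set ψ := psi P.d₁ M (LL P.d₁) with hψ
  set ψt := fun (t x : ℝ) => LL P.d₁ / 4 * (1 + t) ^ xC - (4 * P.d₁ + 3 * (1 + t) ^ xB) / (2 * sg P.d₁ M t)
      + x ^ 2 * (4 * P.d₁ + 3 * (1 + t) ^ xB) / sg P.d₁ M t ^ 2 with hψt
  obtain ⟨C, hC⟩ := D.u_GC.2 t
  have he1 : |e| = 1 := by rcases he with rfl | rfl <;> simp
  suffices H : e * D.u t x - δ₁ * eX (ψ t x) ≤ 0 by linarith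
  refine maxp (d := P.d₁) (c := 0) (T := t) (P := |P.α|) (C := C) hd (z := fun t x => e * D.u t x - δ₁ * eX (ψ t x))
    (zt := fun t x => e * (P.d₁ * D.uxx t x + D.g t x) - δ₁ * (eX (ψ t x) * ψt t x))
    (zx := fun t x => e * D.ux t x - δ₁ * (eX (ψ t x) * (-2 * x / sg P.d₁ M t)))
    (zxx := fun t x => e * D.uxx t x - δ₁ * (eX (ψ t x) * (-2 * x / sg P.d₁ M t) * (-2 * x / sg P.d₁ M t) + eX (ψ t x) * (-2 / sg P.d₁ M t)))
    ?_ ?_ ?_ ?_ ?_ ?_ ?_ t ⟨ht, le_rfl⟩ x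
  · have h1 := D.hu
    refine ContinuousOn.sub (continuousOn_const.mul h1.continuousOn) (continuousOn_const.mul (Real.continuous_exp.comp_continuousOn ?_))
    have hp : ∀ p ∈ Icc 0 t ×ˢ (univ : Set ℝ), 0 ≤ p.1 := fun p hp => hp.1.1
    have hs : ContinuousOn (fun p : ℝ × ℝ => sg P.d₁ M p.1) (Icc 0 t ×ˢ univ) := fun p hp' =>
      ((sg_dt (hp p hp')).continuousAt.comp (f := Prod.fst) continuous_fst.continuousAt).continuousWithinAt
    have hsp : ∀ p ∈ Icc 0 t ×ˢ (univ : Set ℝ), sg P.d₁ M p.1 ≠ 0 := fun p hp' => (sg_pos hd hM (hp p hp')).ne'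
    refine ((continuousOn_const.mul (ContinuousOn.rpow_const (by fun_prop) fun p hp' => Or.inl (by have := hp p hp'; linarith))).sub
      (continuousOn_const.mul (hs.log hsp))).sub (ContinuousOn.div (by fun_prop) hs hsp)
  · intro s hs y
    have h1 := hC s hs.2 y
    have h2 : e * D.u s y ≤ |D.u s y| := (le_abs_self _).trans (by rw [abs_mul, he1, one_mul])
    have h3 : 0 < δ₁ * eX (ψ s y) := by positivity
    show e * D.u s y - δ₁ * eX (ψ s y) ≤ C
    linarith
  · intro y
    have e0 : D.u 0 y = D.u₀ y := by rw [D.u_eq le_rfl, Md_zero]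
    have h2 : e * D.u 0 y ≤ |D.u 0 y| := (le_abs_self _).trans (by rw [abs_mul, he1, one_mul])
    have h3 := D.bu y
    rw [e0] at h2
    have hs0 : sg P.d₁ M 0 = M + 4 := by simp [sg]
    have h4 : δ₁ * eX (ψ 0 y) = δ * eX (-(y ^ 2) / (M + 4)) := by
      have hp : (0:ℝ) < M + 4 := by linarith
      have e1 : eX (ψ 0 y) = eX (-LL P.d₁) * (√(M + 4))⁻¹ * eX (-(y ^ 2) / (M + 4)) := by
        rw [Real.sqrt_eq_rpow, ← Real.rpow_neg hp.le, Real.rpow_def_of_pos hp, ← Real.exp_add, ← Real.exp_add]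
        congr 1
        rw [hψ, psi, hs0]; simp; ring
      rw [e1, hδ₁, Real.exp_neg]
      have : √(M + 4) ≠ 0 := (Real.sqrt_pos.2 hp).ne'
      have := Real.exp_ne_zero (LL P.d₁)
      field_simp
    have h5 : eX (-M⁻¹ * (y - 0) ^ 2) ≤ eX (-(y ^ 2) / (M + 4)) := by
      rw [Real.exp_le_exp, sub_zero, neg_div, neg_mul, neg_le_neg_iff, div_eq_inv_mul]
      gcongr; linarith
    show e * D.u 0 y - δ₁ * eX (ψ 0 y) ≤ 0
    rw [h4, e0]
    have := mul_le_mul_of_nonneg_left h5 hδ.le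
    linarith
  · intro s hs y
    exact ((D.u_dt hs.1 y).const_mul e).sub (((psi_dt hd hM hs.1.le y).exp).const_mul δ₁)
  · intro s hs y
    exact ((D.u_dx s y).const_mul e).sub (((psi_dx y).exp).const_mul δ₁)
  · intro s hs y
    have h1 : HasDerivAt (fun x : ℝ => -2 * x / sg P.d₁ M s) (-2 / sg P.d₁ M s) y := by
      simpa using ((hasDerivAt_id y).const_mul (-2)).div_const (sg P.d₁ M s)
    exact ((D.u_dxx hs.1 y).const_mul e).sub ((((psi_dx y).exp).mul h1).const_mul δ₁)
  · intro s hs y hz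
    have hs0 := hs.1.le
    have hb := brk (x := y) hd hM hs0 P.hη h
    have hE : 0 < δ₁ * eX (ψ s y) := by positivity
    have heu : 0 < e * D.u s y := by
      have : 0 < e * D.u s y - δ₁ * eX (ψ s y) := hz
      linarith
    obtain ⟨hc0, hc1⟩ := cl_sgn he heu
    have hW := cl_abs (Wf_pos P.hη s y).le (Vop P D.v₀ D.u s y + P.γ / P.c * (cl 1 (D.u s y)) ^ 2)
    have hW0 := (Wf_pos P.hη s y).le
    have hg : e * D.g s y ≤ |P.α| * Wf P.η s y * (e * D.u s y) := by
      unfold g gF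
      set p := cl 1 (D.u s y)
      set a := cl (Wf P.η s y) (Vop P D.v₀ D.u s y + P.γ / P.c * p ^ 2)
      have h1 : P.α * a ≤ |P.α| * Wf P.η s y := (le_abs_self _).trans (by rw [abs_mul]; gcongr)
      have h2 : P.α * a - P.μ * p ^ 2 ≤ |P.α| * Wf P.η s y := by nlinarith [P.hμ, sq_nonneg p]
      calc _ = (P.α * a - P.μ * p ^ 2) * (e * p) := by ring
        _ ≤ (|P.α| * Wf P.η s y) * (e * p) := by gcongr
        _ ≤ _ := by gcongr
    have hW1 := (Wf_le P.hη s y).trans P.hη1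
    have hz' : 0 < e * D.u s y - δ₁ * eX (ψ s y) := hz
    have hS := sg_pos hd hM hs0
    have e3 : ψt s y = (LL P.d₁ / 4 * (1 + s) ^ xC + 3 * (1 + s) ^ xB * (y ^ 2 / sg P.d₁ M s ^ 2 - 1 / (2 * sg P.d₁ M s)))
        + P.d₁ * ((-2 * y / sg P.d₁ M s) * (-2 * y / sg P.d₁ M s) + (-2 / sg P.d₁ M s)) := by
      rw [hψt]; simp only; field_simp; ring
    show e * (P.d₁ * D.uxx s y + D.g s y) - δ₁ * (eX (ψ s y) * ψt s y) ≤ P.d₁ * (e * D.uxx s y - δ₁ * (eX (ψ s y) * (-2 * y / sg P.d₁ M s) * (-2 * y / sg P.d₁ M s) + eX (ψ s y) * (-2 / sg P.d₁ M s))) + 0 * _ + |P.α| * (e * D.u s y - δ₁ * eX (ψ s y))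
    rw [e3]
    set B := (LL P.d₁ / 4 * (1 + s) ^ xC + 3 * (1 + s) ^ xB * (y ^ 2 / sg P.d₁ M s ^ 2 - 1 / (2 * sg P.d₁ M s)))
    set Z := e * D.u s y - δ₁ * eX (ψ s y) with hZ
    have f1 : |P.α| * Wf P.η s y * Z ≤ |P.α| * Z := by
      have := abs_nonneg P.α
      calc _ ≤ |P.α| * 1 * Z := by gcongr
        _ = _ := by ring
    have f2 : |P.α| * Wf P.η s y * (δ₁ * eX (ψ s y)) ≤ B * (δ₁ * eX (ψ s y)) := by gcongr
    have f3 : |P.α| * Wf P.η s y * (e * D.u s y) = |P.α| * Wf P.η s y * Z + |P.α| * Wf P.η s y * (δ₁ * eX (ψ s y)) := by rw [hZ]; ring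
    linarith

lemma exp_psi_le {d M : ℝ} (hd : 0 < d) (hM : 1 ≤ M) {t : ℝ} (ht : 0 ≤ t) (x : ℝ) :
    eX (psi d M (LL d) t x) ≤ mm d ^ xA * (1 + t) ^ xA * Pf (mp d M)⁻¹ t x := by
  have hs := sg_pos hd hM ht
  have hm := mm_pos hd
  have h1 := sg_ge (d := d) hM ht
  have h2 := sg_le hd hM ht
  have hp : 0 < mp d M := by unfold mp; positivity
  have e : eX (psi d M (LL d) t x) = eX (-LL d * (1 + t) ^ xB) * (sg d M t) ^ xA * eX (-(x ^ 2 / sg d M t)) := by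
    rw [Real.rpow_def_of_pos hs, ← Real.exp_add, ← Real.exp_add]; congr 1; unfold psi; ring
  rw [e, ← Real.mul_rpow hm.le (by linarith)]
  have k1 : eX (-LL d * (1 + t) ^ xB) ≤ 1 := by
    rw [Real.exp_le_one_iff]
    have : 0 ≤ LL d * (1 + t) ^ xB := by unfold LL; positivity
    linarith
  have k2 : (sg d M t) ^ xA ≤ (mm d * (1 + t)) ^ xA := Real.rpow_le_rpow_of_nonpos (by positivity) h1 (by norm_num)
  have k3 : eX (-(x ^ 2 / sg d M t)) ≤ Pf (mp d M)⁻¹ t x := by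
    unfold Pf; rw [Real.exp_le_exp, neg_mul, neg_le_neg_iff]
    calc (mp d M)⁻¹ / (1 + t) * x ^ 2 = x ^ 2 / (mp d M * (1 + t)) := by field_simp
      _ ≤ _ := by gcongr
  calc _ ≤ 1 * (mm d * (1 + t)) ^ xA * Pf (mp d M)⁻¹ t x := by gcongr
    _ = _ := by ring

end Dat

lemma u_bound (P : Par) (M : ℝ) (h : |P.α| * P.η ≤ cc P.d₁ M) : ∃ C > 0, ∀ δ (D : Dat P M δ) (t x : ℝ), 0 ≤ t →
    |D.u t x| ≤ C * δ * ((1 + t) ^ xA * Pf (mp P.d₁ M)⁻¹ t x) := by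
  by_cases hM : 1 ≤ M
  swap
  · exact ⟨1, one_pos, fun δ D => absurd D.hM hM⟩
  have hm := mm_pos P.hd₁
  refine ⟨eX (LL P.d₁) * √(M + 4) * mm P.d₁ ^ xA, by positivity, fun δ D t x ht => ?_⟩
  have hδ := D.hδ
  have h1 := D.u_sup h (Or.inl rfl) ht x
  have h2 := D.u_sup h (Or.inr rfl) ht x
  have h3 := Dat.exp_psi_le P.hd₁ D.hM ht x
  have h4 : |D.u t x| ≤ (δ * eX (LL P.d₁) * √(M + 4)) * eX (psi P.d₁ M (LL P.d₁) t x) := abs_le.2 ⟨by linarith, by linarith⟩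
  refine h4.trans ?_
  calc _ ≤ (δ * eX (LL P.d₁) * √(M + 4)) * (mm P.d₁ ^ xA * (1 + t) ^ xA * Pf (mp P.d₁ M)⁻¹ t x) := by gcongr
    _ = _ := by ring

def cK (d l : ℝ) : ℝ := cT * (√(16 * d * l))⁻¹
lemma cK_pos {d l : ℝ} (hd : 0 < d) (hl : 0 < l) : 0 < cK d l := by have := cT_pos; unfold cK; positivity

lemma TT_prof {k f : ℝ → ℝ} (hk : KB k) {d l B s r y₀ : ℝ} (hd : 0 < d) (hl : 0 < l) (hdl : 16 * d * l ≤ 1) (hs : 0 ≤ s) (hr : 0 ≤ r)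
    (hB : 0 ≤ B) (hf : ∀ y, |f y| ≤ B * Pf l s (y - y₀)) (x : ℝ) :
    |TT k f (Ar d r) x| ≤ B * cK d l * ((1 + s) ^ (1/2:ℝ) * (1 + s + r) ^ xA) * Pf l (s + r) (x - y₀) := by
  have h1 := TT_gauss (f := f) (l := l / (1 + s)) (y₀ := y₀) (B := B) hk (by positivity) hf (Ar d r) x
  rw [Ar_sq hd hr] at h1
  refine h1.trans ?_
  set q := 1 + 8 * (l / (1 + s)) * (2 * d * r) with hq
  have hq' : q = (1 + s + 16 * d * l * r) / (1 + s) := by rw [hq]; field_simp; ring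
  have k1 : q ≤ (1 + s + r) / (1 + s) := by
    rw [hq']; gcongr; nlinarith
  have k2 : 16 * d * l * (1 + s + r) / (1 + s) ≤ q := by
    rw [hq']; gcongr; nlinarith
  have hq0 : 0 < q := lt_of_lt_of_le (by positivity) k2
  have hcT := cT_pos
  have k3 : (√q)⁻¹ ≤ (√(16 * d * l))⁻¹ * ((1 + s) ^ (1/2:ℝ) * (1 + s + r) ^ xA) := by
    calc (√q)⁻¹ ≤ (√(16 * d * l * (1 + s + r) / (1 + s)))⁻¹ := by gcongr
      _ = _ := by
        rw [Real.rpow_neg (by positivity), ← Real.sqrt_eq_rpow, ← Real.sqrt_eq_rpow, Real.sqrt_div (by positivity), Real.sqrt_mul (by positivity)]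
        field_simp
  have k4 : eX (-(l / (1 + s)) * (x - y₀) ^ 2 / q) ≤ Pf l (s + r) (x - y₀) := by
    unfold Pf; rw [Real.exp_le_exp, neg_mul, neg_mul, neg_div, neg_le_neg_iff]
    calc l / (1 + (s + r)) * (x - y₀) ^ 2 = l / (1 + s) * (x - y₀) ^ 2 / ((1 + s + r) / (1 + s)) := by rw [← add_assoc]; field_simp
      _ ≤ _ := by gcongr
  unfold cK
  calc _ ≤ B * cT * ((√(16 * d * l))⁻¹ * ((1 + s) ^ (1/2:ℝ) * (1 + s + r) ^ xA)) * Pf l (s + r) (x - y₀) := by gcongr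
    _ = _ := by ring

def cV (q : ℝ) : ℝ := 2 * (bt (1/2) 0 + bt (1/2) q)
lemma cV_nonneg (q : ℝ) : 0 ≤ cV q := by
  have := bt_nonneg (1/2) 0; have := bt_nonneg (1/2) q; unfold cV; positivity
lemma CV_dec {K : ℝ → ℝ → ℝ → ℝ} {t x B q : ℝ} (hq0 : 0 ≤ q) (hq : q < 1) (ht : 0 ≤ t) (hB : 0 ≤ B)
    (h : ∀ s r, 0 < s → 0 < r → s + r = t → |K s r x| ≤ B * (r ^ xA * (1 + s) ^ (-q))) :
    |CV K t x| ≤ B * cV q * (1 + t) ^ (1/2 - q) := by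
  have b0 := bt_nonneg (1/2) 0
  have b1 := bt_nonneg (1/2) q
  have hp : 0 < (1 + t) ^ (1/2 - q) := by positivity
  rcases ht.eq_or_lt with rfl | ht
  · rw [CV_zero, abs_zero]; have := cV_nonneg q; positivity
  have hc : ∀ c : ℝ, 0 ≤ c → c ≤ 2 * (1 + t) ^ (1/2 - q) → ∀ b, 0 ≤ b → b ≤ bt (1/2) 0 + bt (1/2) q → B * c * b ≤ B * cV q * (1 + t) ^ (1/2 - q) := by
    intro c hc0 hc b hb0 hb
    calc _ ≤ B * (2 * (1 + t) ^ (1/2 - q)) * (bt (1/2) 0 + bt (1/2) q) := by gcongr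
      _ = _ := by unfold cV; ring
  rcases le_total t 1 with h1 | h1
  · refine (CV_bound (p := 1/2) (q := 0) (by norm_num) (by norm_num) ht (fun s r hs hr e => (h s r hs hr e).trans ?_)).trans (hc _ (by positivity) ?_ _ b0 (by linarith))
    · rw [neg_zero, Real.rpow_zero]
      have : (1 + s) ^ (-q) ≤ 1 := Real.rpow_le_one_of_one_le_of_nonpos (by linarith) (by linarith)
      gcongr
    · have a1 : t ^ (1 - 1/2 - 0 : ℝ) ≤ 1 := Real.rpow_le_one ht.le h1 (by norm_num)
      have a2 : (1 + t) ^ (-(1:ℝ)) ≤ (1 + t) ^ (1/2 - q) := Real.rpow_le_rpow_of_exponent_le (by linarith) (by linarith)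
      rw [Real.rpow_neg_one] at a2
      have a3 : (2:ℝ)⁻¹ ≤ (1 + t)⁻¹ := by gcongr; linarith
      linarith
  · refine (CV_bound (p := 1/2) (q := q) (by norm_num) hq ht (fun s r hs hr e => (h s r hs hr e).trans ?_)).trans (hc _ (by positivity) ?_ _ b1 (by linarith))
    · have : (1 + s) ^ (-q) ≤ s ^ (-q) := Real.rpow_le_rpow_of_nonpos hs (by linarith) (by linarith)
      gcongr
    · rw [show (1 - 1/2 - q : ℝ) = 1/2 - q by ring]
      rcases le_total q (1/2) with hh | hh
      · have : t ^ (1/2 - q) ≤ (1 + t) ^ (1/2 - q) := Real.rpow_le_rpow ht.le (by linarith) (by linarith)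
        linarith
      · have a1 : t ^ (1/2 - q) ≤ (2⁻¹ * (1 + t)) ^ (1/2 - q) := Real.rpow_le_rpow_of_nonpos (by positivity) (by linarith) (by linarith)
        rw [Real.mul_rpow (by norm_num) (by linarith)] at a1
        have a2 : (2⁻¹:ℝ) ^ (1/2 - q) ≤ 2⁻¹ ^ (-(1:ℝ)) := Real.rpow_le_rpow_of_exponent_ge (by norm_num) (by norm_num) (by linarith)
        have a3 : (2⁻¹:ℝ) ^ (-(1:ℝ)) = 2 := by rw [Real.rpow_neg_one]; norm_num
        rw [a3] at a2
        exact a1.trans (by gcongr)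

lemma zexp {l z : ℝ} (hl : 0 < l) (hz : 0 ≤ z) : (1 + z) * eX (-l * z) ≤ (1 + 2 / l) * eX (-(l / 2) * z) := by
  have h1 : eX (-l * z) = eX (-(l / 2) * z) * eX (-(l / 2) * z) := by rw [← Real.exp_add]; congr 1; ring
  have h2 : (1 + z) * eX (-(l / 2) * z) ≤ 1 + 2 / l := by
    have e : eX (-(l / 2) * z) = (eX (l / 2 * z))⁻¹ := by rw [← Real.exp_neg]; congr 1; ring
    rw [e, ← div_eq_mul_inv, div_le_iff₀ (Real.exp_pos _)]
    have := Real.add_one_le_exp (l / 2 * z)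
    have h3 : 1 + z ≤ (1 + 2 / l) * (l / 2 * z + 1) := by
      have : (1 + 2 / l) * (l / 2 * z + 1) = 1 + z + l / 2 * z + 2 / l := by field_simp; ring
      rw [this]
      have : 0 ≤ l / 2 * z := by positivity
      have : 0 ≤ 2 / l := by positivity
      linarith
    exact h3.trans (by gcongr)
  rw [h1, ← mul_assoc]; gcongr

lemma rp {a p q r : ℝ} (ha : 0 < a) (h : p + q = r) : a ^ p * a ^ q = a ^ r := by rw [← Real.rpow_add ha, h]

lemma g_bound (P : Par) (M : ℝ) (h : |P.α| * P.η ≤ cc P.d₁ M) : ∃ C > 0, ∀ δ (D : Dat P M δ) (t x : ℝ), 0 ≤ t →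
    |D.g t x| ≤ C * δ * ((1 + t) ^ xF * Pf ((mp P.d₁ M)⁻¹ / 2) t x) := by
  by_cases hM : 1 ≤ M
  swap
  · exact ⟨1, one_pos, fun δ D => absurd D.hM hM⟩
  obtain ⟨C, hC, hu⟩ := u_bound P M h
  have hp : 0 < (mp P.d₁ M)⁻¹ := by have := P.hd₁; unfold mp; positivity
  set l := (mp P.d₁ M)⁻¹ with hl
  have hμ := P.hμ
  refine ⟨|P.α| * (1 + 2 / l) * C + P.μ * C ^ 3, by positivity, fun δ D t x ht => ?_⟩
  have h1 := hu δ D t x ht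
  have hδ := D.hδ
  have h2 := cl_abs' 1 (D.u t x) zero_le_one
  have hW := cl_abs (Wf_pos P.hη t x).le (Vop P D.v₀ D.u t x + P.γ / P.c * (cl 1 (D.u t x)) ^ 2)
  unfold Dat.g gF
  set p := cl 1 (D.u t x)
  set a := cl (Wf P.η t x) (Vop P D.v₀ D.u t x + P.γ / P.c * p ^ 2)
  have h3 := h2.trans h1
  set τ := 1 + t with hτ
  have hτ1 : 1 ≤ τ := by linarith
  have hτ0 : 0 < τ := by linarith
  have hW2 : Wf P.η t x ≤ τ ^ (-(1:ℝ)) * (1 + x ^ 2 / τ) := by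
    unfold Wf; rw [ta_of ht, ← hτ]
    have a1 : (τ + x ^ 2) / (τ ^ 2 + x ^ 2) ≤ (τ + x ^ 2) / τ ^ 2 := by gcongr; nlinarith [sq_nonneg x]
    have a2 : τ ^ xB ≤ 1 := Real.rpow_le_one_of_one_le_of_nonpos hτ1 (by norm_num)
    have a3 := P.hη1
    have a4 := P.hη
    calc _ ≤ 1 * 1 * ((τ + x ^ 2) / τ ^ 2) := by gcongr
      _ = _ := by rw [Real.rpow_neg_one]; field_simp
  have hz : (1 + x ^ 2 / τ) * Pf l t x ≤ (1 + 2 / l) * Pf (l / 2) t x := by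
    have := zexp (z := x ^ 2 / τ) hp (by positivity)
    unfold Pf
    convert this using 3 <;> · rw [← hτ]; ring
  have hPf := Pf_le_one hp.le ht x
  have hPf0 := (Pf_pos l t x).le
  have hPfm := Pf_mono (show l / 2 ≤ l by linarith) ht x
  have e1 : |(P.α * a - P.μ * p ^ 2) * p| ≤ |P.α| * |a| * |p| + P.μ * |p| ^ 3 := by
    rw [sub_mul]
    refine (abs_sub _ _).trans (le_of_eq ?_)
    rw [abs_mul, abs_mul, abs_mul, abs_mul, abs_of_pos hμ, abs_pow]; ring
  refine e1.trans ?_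
  set q := τ ^ xA
  have hq0 : 0 < q := by positivity
  have b1 : |a| * |p| ≤ (1 + 2 / l) * C * δ * (τ ^ xF * Pf (l / 2) t x) := by
    calc |a| * |p| ≤ (τ ^ (-(1:ℝ)) * (1 + x ^ 2 / τ)) * (C * δ * (q * Pf l t x)) := by gcongr; exact hW.trans hW2
      _ = C * δ * (τ ^ (-(1:ℝ)) * q) * ((1 + x ^ 2 / τ) * Pf l t x) := by ring
      _ ≤ C * δ * (τ ^ (-(1:ℝ)) * q) * ((1 + 2 / l) * Pf (l / 2) t x) := by gcongr
      _ = _ := by rw [rp hτ0 (show -(1:ℝ) + -(1/2) = -(3/2) by norm_num)]; ring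
  have b2 : |p| ^ 3 ≤ C ^ 3 * δ * (τ ^ xF * Pf (l / 2) t x) := by
    calc |p| ^ 3 ≤ (C * δ * (q * Pf l t x)) ^ 3 := by gcongr
      _ = C ^ 3 * (δ * (δ * δ)) * ((q * q * q) * (Pf l t x * (Pf l t x * Pf l t x))) := by ring
      _ ≤ C ^ 3 * (δ * (1 * 1)) * ((q * q * q) * (Pf (l / 2) t x * (1 * 1))) := by
        have := D.hδ1; have := (Pf_pos (l / 2) t x).le; gcongr
      _ = _ := by
        rw [rp hτ0 (show -(1/2:ℝ) + -(1/2) = -1 by norm_num), rp hτ0 (show -(1:ℝ) + -(1/2) = -(3/2) by norm_num)]; ring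
  calc _ = |P.α| * (|a| * |p|) + P.μ * |p| ^ 3 := by ring
    _ ≤ |P.α| * ((1 + 2 / l) * C * δ * (τ ^ xF * Pf (l / 2) t x)) + P.μ * (C ^ 3 * δ * (τ ^ xF * Pf (l / 2) t x)) := by gcongr
    _ = _ := by ring

def lm (P : Par) (M : ℝ) : ℝ := min ((mp P.d₁ M)⁻¹ / 2) (min (16 * P.d₁)⁻¹ (16 * P.d₂)⁻¹)
lemma lm_spec (P : Par) {M : ℝ} (hM : 1 ≤ M) : 0 < lm P M ∧ lm P M ≤ (mp P.d₁ M)⁻¹ / 2 ∧ lm P M ≤ (mp P.d₁ M)⁻¹ ∧ lm P M ≤ M⁻¹ ∧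
    16 * P.d₁ * lm P M ≤ 1 ∧ 16 * P.d₂ * lm P M ≤ 1 := by
  have h1 := P.hd₁
  have h2 := P.hd₂
  have hp : 0 < (mp P.d₁ M)⁻¹ := by unfold mp; positivity
  have a1 : lm P M ≤ (mp P.d₁ M)⁻¹ / 2 := min_le_left _ _
  have a2 : lm P M ≤ (16 * P.d₁)⁻¹ := (min_le_right _ _).trans (min_le_left _ _)
  have a3 : lm P M ≤ (16 * P.d₂)⁻¹ := (min_le_right _ _).trans (min_le_right _ _)
  refine ⟨by unfold lm; positivity, a1, by linarith, ?_, ?_, ?_⟩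
  · have : (mp P.d₁ M)⁻¹ ≤ M⁻¹ := by unfold mp; gcongr; linarith
    linarith
  · calc _ ≤ 16 * P.d₁ * (16 * P.d₁)⁻¹ := by gcongr
      _ = 1 := by field_simp
  · calc _ ≤ 16 * P.d₂ * (16 * P.d₂)⁻¹ := by gcongr
      _ = 1 := by field_simp

lemma data_prof {f : ℝ → ℝ} {M δ l : ℝ} (hδ : 0 < δ) (hl : l ≤ M⁻¹) (h : ∀ x, |f x| ≤ δ * eX (-M⁻¹ * (x - 0) ^ 2)) (x : ℝ) :
    |f x| ≤ δ * Pf l 0 (x - 0) := by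
  refine (h x).trans ?_
  unfold Pf
  gcongr
  rw [add_zero, div_one]; exact hl

lemma ux_bound (P : Par) (M : ℝ) (h : |P.α| * P.η ≤ cc P.d₁ M) : ∃ C > 0, ∀ δ (D : Dat P M δ) (t x : ℝ), 0 ≤ t →
    |D.ux t x| ≤ C * δ * ((1 + t) ^ xE * Pf (lm P M) t x) := by
  by_cases hM : 1 ≤ M
  swap
  · exact ⟨1, one_pos, fun δ D => absurd D.hM hM⟩
  obtain ⟨C, hC, hg⟩ := g_bound P M h
  obtain ⟨hl, hl1, -, hl3, hl4, -⟩ := lm_spec P hM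
  set l := lm P M
  have hd := P.hd₁
  have hk := cK_pos hd hl
  have hcV := cV_nonneg (7/8)
  set d := P.d₁
  refine ⟨2 * cK d l + 2 * cK d l * (√(2 * d))⁻¹ + C * cK d l * (√(2 * d))⁻¹ * cV (7/8), by positivity, fun δ D t x ht => ?_⟩
  have hδ := D.hδ
  have hPf := Pf_pos l t x
  set F := Pf l t x
  have hτ0 : 0 < 1 + t := by linarith
  have h7 : 0 < (1 + t) ^ xE := by positivity
  have p1 : |E0 d (fun _ => D.u₀') 0 t x| ≤ (2 * cK d l + 2 * cK d l * (√(2 * d))⁻¹) * δ * ((1 + t) ^ xE * F) := by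
    rcases le_total t 1 with h1 | h1
    · have := TT_prof (f := D.u₀') (s := 0) (r := t) (y₀ := 0) KB0 hd hl hl4 le_rfl ht hδ.le (data_prof hδ hl3 D.bu') x
      simp only [add_zero, zero_add, sub_zero, Real.one_rpow, one_mul] at this
      have a2 : (1 + t) ^ xA ≤ 2 * (1 + t) ^ xE := by
        have b1 : (1 + t) ^ xA ≤ 1 := Real.rpow_le_one_of_one_le_of_nonpos (by linarith) (by norm_num)
        have b2 : (1 + t) ^ (-(1:ℝ)) ≤ (1 + t) ^ xE := Real.rpow_le_rpow_of_exponent_le (by linarith) (by norm_num)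
        rw [Real.rpow_neg_one] at b2
        have b3 : (2:ℝ)⁻¹ ≤ (1 + t)⁻¹ := by gcongr; linarith
        linarith
      calc _ ≤ _ := this
        _ ≤ δ * cK d l * (2 * (1 + t) ^ xE) * F := by gcongr
        _ = 2 * cK d l * (δ * ((1 + t) ^ xE * F)) + 0 := by ring
        _ ≤ 2 * cK d l * (δ * ((1 + t) ^ xE * F)) + 2 * cK d l * (√(2 * d))⁻¹ * (δ * ((1 + t) ^ xE * F)) := by gcongr; positivity
        _ = _ := by ring
    · have ht0 : 0 < t := by linarith
      have := TT_prof (f := D.u₀) (s := 0) (r := t) (y₀ := 0) KB1 hd hl hl4 le_rfl ht hδ.le (data_prof hδ hl3 D.bu) x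
      simp only [add_zero, zero_add, sub_zero, Real.one_rpow, one_mul] at this
      have e : E0 d (fun _ => D.u₀') 0 t x = (Ar d t)⁻¹ * TT k1 D.u₀ (Ar d t) x := by
        rw [TT_shift KB0 KB1 k0_deriv D.hd D.hd' D.bu1 D.bu1' (Ar_pos hd ht0)]; rfl
      have a1 : t ^ xA ≤ 2 * (1 + t) ^ xA := by
        have b1 : t ^ xA ≤ (4⁻¹ * (1 + t)) ^ xA := Real.rpow_le_rpow_of_nonpos (by positivity) (by linarith) (by norm_num)
        rw [Real.mul_rpow (by norm_num) (by linarith)] at b1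
        have b2 : (4⁻¹:ℝ) ^ xA = 2 := by
          rw [Real.rpow_neg (by norm_num), ← Real.sqrt_eq_rpow, Real.sqrt_inv, inv_inv, show (4:ℝ) = 2 ^ 2 by norm_num, Real.sqrt_sq (by norm_num)]
        rwa [b2] at b1
      have a2 : (1 + t) ^ xA * (1 + t) ^ xA ≤ (1 + t) ^ xE := by
        rw [rp hτ0 (show -(1/2:ℝ) + -(1/2) = -1 by norm_num)]
        exact Real.rpow_le_rpow_of_exponent_le (by linarith) (by norm_num)
      rw [e, abs_mul, abs_of_pos (inv_pos.2 (Ar_pos hd ht0)), Ar_inv hd ht]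
      calc _ ≤ (√(2 * d))⁻¹ * (2 * (1 + t) ^ xA) * (δ * cK d l * (1 + t) ^ xA * F) := by gcongr
        _ = 2 * cK d l * (√(2 * d))⁻¹ * δ * (((1 + t) ^ xA * (1 + t) ^ xA) * F) := by ring
        _ ≤ 2 * cK d l * (√(2 * d))⁻¹ * δ * ((1 + t) ^ xE * F) := by gcongr
        _ = 0 + 2 * cK d l * (√(2 * d))⁻¹ * (δ * ((1 + t) ^ xE * F)) := by ring
        _ ≤ 2 * cK d l * (δ * ((1 + t) ^ xE * F)) + 2 * cK d l * (√(2 * d))⁻¹ * (δ * ((1 + t) ^ xE * F)) := by gcongr; positivity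
        _ = _ := by ring
  have p2 : |CV (E1 d D.g) t x| ≤ (C * cK d l * (√(2 * d))⁻¹ * cV (7/8)) * δ * ((1 + t) ^ xE * F) := by
    have := CV_dec (K := E1 d D.g) (x := x) (q := 7/8) (B := (√(2 * d))⁻¹ * (C * δ * cK d l * (1 + t) ^ xA * F)) (by norm_num) (by norm_num) ht (by positivity) (fun s r hs hr e => by
      have := TT_prof (f := D.g s) (s := s) (r := r) (y₀ := 0) (B := C * δ * (1 + s) ^ xF) KB1 hd hl hl4 hs.le hr.le (by positivity) (fun y => by
        have := hg δ D s y hs.le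
        rw [sub_zero, mul_assoc]
        exact this.trans (by gcongr; exact Pf_mono hl1 hs.le y)) x
      rw [add_assoc, e, sub_zero] at this
      unfold E1
      rw [abs_mul, abs_of_pos (inv_pos.2 (Ar_pos hd hr)), Ar_inv hd hr.le]
      have a1 : (1 + s) ^ xF * (1 + s) ^ (1/2:ℝ) ≤ (1 + s) ^ xE := by
        rw [rp (by linarith) (show -(3/2:ℝ) + 1/2 = -1 by norm_num)]
        exact Real.rpow_le_rpow_of_exponent_le (by linarith) (by norm_num)
      calc _ ≤ (√(2 * d))⁻¹ * r ^ xA * (C * δ * (1 + s) ^ xF * cK d l * ((1 + s) ^ (1/2:ℝ) * (1 + t) ^ xA) * F) := by gcongr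
        _ = (√(2 * d))⁻¹ * r ^ xA * (C * δ * cK d l * (((1 + s) ^ xF * (1 + s) ^ (1/2:ℝ)) * (1 + t) ^ xA) * F) := by ring
        _ ≤ (√(2 * d))⁻¹ * r ^ xA * (C * δ * cK d l * ((1 + s) ^ xE * (1 + t) ^ xA) * F) := by gcongr
        _ = _ := by ring)
    refine this.trans (le_of_eq ?_)
    rw [show xE = -(1/2) + (1/2 - 7/8) by norm_num, Real.rpow_add hτ0]; ring
  rw [Dat.ux, tp_of ht]
  refine (abs_add_le _ _).trans ((add_le_add p1 p2).trans (le_of_eq (by ring)))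

lemma half_ii {t : ℝ} (ht : 0 ≤ t) : IntervalIntegrable (fun s => (t - s) ^ xA * (1 + s) ^ xA) volume 0 t := by
  have h1 : IntervalIntegrable (fun s => (t - s) ^ xA) volume 0 t := by
    have := (intervalIntegral.intervalIntegrable_rpow' (a := 0) (b := t) (r := -(1/2)) (by norm_num)).comp_sub_left t
    simpa using this.symm
  refine h1.mul_continuousOn ?_
  rw [uIcc_of_le ht]
  exact ContinuousOn.rpow_const (by fun_prop) fun s hs => Or.inl (by linarith [hs.1])

lemma Pf_int {l t : ℝ} (hl : 0 < l) (ht : 0 ≤ t) (y : ℝ) : Integrable (fun x => Pf l t (x + y)) ∧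
    ∫ x, Pf l t (x + y) = √(Real.pi / l) * (1 + t) ^ (1/2:ℝ) := by
  have hb : 0 < l / (1 + t) := by positivity
  refine ⟨(integrable_exp_neg_mul_sq hb).comp_add_right y, ?_⟩
  rw [integral_add_right_eq_self (fun x => Pf l t x) y]
  unfold Pf
  rw [integral_gaussian, ← Real.sqrt_eq_rpow, ← Real.sqrt_mul (by positivity)]
  congr 1; field_simp

lemma CV_L1 {K : ℝ → ℝ → ℝ → ℝ} {l t B c : ℝ} (hl : 0 < l) (ht : 0 ≤ t) (hB : 0 ≤ B) (hc : Continuous (fun x => CV K t (x + c * t)))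
    (h : ∀ s r x, 0 < s → 0 < r → s + r = t → |K s r (x + c * t)| ≤ B * (1 + t) ^ xA * (r ^ xA * (1 + s) ^ xA) * Pf l t (x + c * r)) :
    Integrable (fun x => CV K t (x + c * t)) ∧ ∫ x, |CV K t (x + c * t)| ≤ B * √(Real.pi / l) * cV (1/2) := by
  have hτ0 : 0 < 1 + t := by linarith
  set H : ℝ → ℝ → ℝ := fun x s => B * (1 + t) ^ xA * ((t - s) ^ xA * (1 + s) ^ xA) * Pf l t (x + c * (t - s)) with hH
  have hcV := cV_nonneg (1/2)
  have hR : 0 ≤ B * √(Real.pi / l) * cV (1/2) := by positivity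
  have hHm : Measurable (Function.uncurry H) := by
    unfold Function.uncurry; simp only [hH]; unfold Pf; fun_prop
  have key : ∫⁻ x, ENNReal.ofReal |CV K t (x + c * t)| ≤ ENNReal.ofReal (B * √(Real.pi / l) * cV (1/2)) := by
    calc ∫⁻ x, ENNReal.ofReal |CV K t (x + c * t)| ≤ ∫⁻ x, ∫⁻ s in Ioc 0 t, ENNReal.ofReal (H x s) := by
          refine lintegral_mono fun x => ?_
          unfold CV
          rw [intervalIntegral.integral_of_le ht, ← Real.enorm_eq_ofReal_abs]
          refine (enorm_integral_le_lintegral_enorm _).trans (lintegral_mono_ae ?_)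
          rw [ae_restrict_iff' measurableSet_Ioc]
          filter_upwards [ae_ne1 t] with s hs hs'
          rw [Real.enorm_eq_ofReal_abs]
          exact ENNReal.ofReal_le_ofReal (h s (t - s) x hs'.1 (sub_pos.2 (lt_of_le_of_ne hs'.2 hs)) (by ring))
      _ = ∫⁻ s in Ioc 0 t, ∫⁻ x, ENNReal.ofReal (H x s) := lintegral_lintegral_swap (hHm.ennreal_ofReal.aemeasurable)
      _ = ∫⁻ s in Ioc 0 t, ENNReal.ofReal (B * √(Real.pi / l) * ((t - s) ^ xA * (1 + s) ^ xA)) := by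
          refine setLIntegral_congr_fun measurableSet_Ioc fun s hs => ?_
          obtain ⟨i1, i2⟩ := Pf_int hl ht (c * (t - s))
          have hts : 0 ≤ t - s := by linarith [hs.2]
          have hs1 : 0 ≤ 1 + s := by linarith [hs.1]
          rw [← ofReal_integral_eq_lintegral_ofReal]
          · congr 1
            simp only [hH]
            rw [integral_const_mul, i2]
            calc _ = B * √(Real.pi / l) * ((t - s) ^ xA * (1 + s) ^ xA) * ((1 + t) ^ xA * (1 + t) ^ (1/2:ℝ)) := by ring
              _ = _ := by rw [rp hτ0 (show -(1/2:ℝ) + 1/2 = 0 by norm_num), Real.rpow_zero, mul_one]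
          · exact i1.const_mul _
          · exact eO fun x => by have := Pf_pos l t (x + c * (t - s)); simp only [hH]; positivity
      _ = ENNReal.ofReal (∫ s in (0:ℝ)..t, B * √(Real.pi / l) * ((t - s) ^ xA * (1 + s) ^ xA)) := by
          rw [intervalIntegral.integral_of_le ht, ofReal_integral_eq_lintegral_ofReal]
          · exact ((intervalIntegrable_iff_integrableOn_Ioc_of_le ht).1 (half_ii ht)).const_mul _
          · rw [Filter.EventuallyLE, ae_restrict_iff' measurableSet_Ioc]
            refine eO fun s hs => ?_
            have hts : 0 ≤ t - s := by linarith [hs.2]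
            have hs1 : 0 ≤ 1 + s := by linarith [hs.1]
            show 0 ≤ B * √(Real.pi / l) * ((t - s) ^ xA * (1 + s) ^ xA)
            positivity
      _ ≤ _ := by
          refine ENNReal.ofReal_le_ofReal ((le_abs_self _).trans ?_)
          have := CV_dec (K := fun s r _ => B * √(Real.pi / l) * (r ^ xA * (1 + s) ^ xA)) (x := 0) (q := 1/2) (B := B * √(Real.pi / l)) (by norm_num) (by norm_num) ht (by positivity)
            (fun s r hs hr e => le_of_eq (abs_of_nonneg (by positivity)))
          simpa [CV] using this
  have hi : Integrable (fun x => CV K t (x + c * t)) := by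
    refine ⟨hc.aestronglyMeasurable, ?_⟩
    rw [HasFiniteIntegral]
    simp only [Real.enorm_eq_ofReal_abs]
    exact key.trans_lt ENNReal.ofReal_lt_top
  refine ⟨hi, ?_⟩
  rw [integral_eq_lintegral_of_nonneg_ae (eO fun x => abs_nonneg _) hi.abs.1]
  exact ENNReal.toReal_le_of_le_ofReal hR key

lemma v_bound (P : Par) (M : ℝ) (h : |P.α| * P.η ≤ cc P.d₁ M) : ∃ C > 0, ∀ δ (D : Dat P M δ) (t : ℝ), 0 ≤ t →
    (∀ x, |D.v t x| ≤ C * δ * (1 + t) ^ xA) ∧ Integrable (fun x => D.v t x) ∧ ∫ x, |D.v t x| ≤ C * δ := by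
  by_cases hM : 1 ≤ M
  swap
  · exact ⟨1, one_pos, fun δ D => absurd D.hM hM⟩
  obtain ⟨C, hC, hu⟩ := u_bound P M h
  obtain ⟨hl, hl1, hl2, hl3, -, hl4⟩ := lm_spec P hM
  set l := lm P M
  have hd := P.hd₂
  have hk := cK_pos hd hl
  have hcV := cV_nonneg (1/2)
  set d := P.d₂
  have hpi : 0 < √(Real.pi / l) := by have := Real.pi_pos; positivity
  set B := C ^ 2 * cK d l * (√(2 * d))⁻¹ with hB
  have hB0 : 0 < B := by positivity
  refine ⟨(cK d l + |P.γ| * (B * cV (1/2))) * (1 + √(Real.pi / l)), by positivity, fun δ D t ht => ?_⟩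
  have hδ := D.hδ
  have hδ1 := D.hδ1
  have hτ0 : 0 < 1 + t := by linarith
  have p1 : ∀ x, |E0 d (fun _ => D.v₀) 0 t x| ≤ δ * cK d l * (1 + t) ^ xA * Pf l t (x + 0) := by
    intro x
    have := TT_prof (f := D.v₀) (s := 0) (r := t) (y₀ := 0) KB0 hd hl hl4 le_rfl ht hδ.le (data_prof hδ hl3 D.bv) x
    simpa only [E0, add_zero, zero_add, sub_zero, Real.one_rpow, one_mul] using this
  have p2 : ∀ s r x, 0 < s → 0 < r → s + r = t → |E1 d (hF P D.u) s r (x + P.c * t)| ≤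
      (B * δ) * (1 + t) ^ xA * (r ^ xA * (1 + s) ^ xA) * Pf l t (x + P.c * r) := by
    intro s r x hs hr e
    have := TT_prof (f := hF P D.u s) (s := s) (r := r) (y₀ := P.c * s) (B := C ^ 2 * δ * (1 + s) ^ (-(1:ℝ))) KB1 hd hl hl4 hs.le hr.le (by positivity) (fun y => by
      have a1 := (cl_abs' 1 (D.u s (y - P.c * s)) zero_le_one).trans (hu δ D s (y - P.c * s) hs.le)
      unfold hF
      rw [abs_pow]
      have a2 := Pf_mono hl2 hs.le (y - P.c * s)
      have a3 := Pf_le_one hl.le hs.le (y - P.c * s)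
      have a4 := Pf_pos l s (y - P.c * s)
      have a5 := Pf_pos (mp P.d₁ M)⁻¹ s (y - P.c * s)
      calc _ ≤ (C * δ * ((1 + s) ^ xA * Pf (mp P.d₁ M)⁻¹ s (y - P.c * s))) ^ 2 := by gcongr
        _ = C ^ 2 * (δ * δ) * (((1 + s) ^ xA * (1 + s) ^ xA)) * (Pf (mp P.d₁ M)⁻¹ s (y - P.c * s) * Pf (mp P.d₁ M)⁻¹ s (y - P.c * s)) := by ring
        _ ≤ C ^ 2 * (δ * 1) * (((1 + s) ^ xA * (1 + s) ^ xA)) * (Pf l s (y - P.c * s) * 1) := by gcongr; exact a2.trans a3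
        _ = _ := by rw [rp (by linarith) (show -(1/2:ℝ) + -(1/2) = -1 by norm_num)]; ring) (x + P.c * t)
    rw [add_assoc 1 s r, e, show x + P.c * t - P.c * s = x + P.c * r by rw [← e]; ring] at this
    unfold E1
    rw [abs_mul, abs_of_pos (inv_pos.2 (Ar_pos hd hr)), Ar_inv hd hr.le]
    calc _ ≤ (√(2 * d))⁻¹ * r ^ xA * (C ^ 2 * δ * (1 + s) ^ (-(1:ℝ)) * cK d l * ((1 + s) ^ (1/2:ℝ) * (1 + t) ^ xA) * Pf l t (x + P.c * r)) := by gcongr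
      _ = (√(2 * d))⁻¹ * r ^ xA * (C ^ 2 * δ * cK d l * (((1 + s) ^ (-(1:ℝ)) * (1 + s) ^ (1/2:ℝ)) * (1 + t) ^ xA) * Pf l t (x + P.c * r)) := by ring
      _ = _ := by rw [rp (by linarith) (show -(1:ℝ) + 1/2 = -(1/2) by norm_num), hB]; ring
  have hcont1 : Continuous (fun x => E0 d (fun _ => D.v₀) 0 t (x + P.c * t)) :=
    (E0_cont D.v₀_GC).comp (by fun_prop : Continuous fun x : ℝ => ((0:ℝ), t, x + P.c * t))
  have hcont2 : Continuous (fun x => CV (E1 d (hF P D.u)) t (x + P.c * t)) := by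
    have := (CV_cont (E1_KC hd (hF_GC P D.hu)) (E1_bd hd (hF_GC P D.hu))).comp (by fun_prop : Continuous fun x : ℝ => (t, x + P.c * t))
    simpa only [Function.comp_def, max_eq_left ht] using this
  have ev : ∀ x, D.v t x = E0 d (fun _ => D.v₀) 0 t (x + P.c * t) + P.γ * CV (E1 d (hF P D.u)) t (x + P.c * t) := fun x => by
    rw [Dat.v, Vop, tp_of ht]; rfl
  obtain ⟨q1, q2⟩ := CV_L1 hl ht (by positivity) hcont2 p2
  obtain ⟨r1, r2⟩ := Pf_int hl ht (P.c * t)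
  have r3 : Integrable (fun x => E0 d (fun _ => D.v₀) 0 t (x + P.c * t)) := by
    refine (r1.const_mul (δ * cK d l * (1 + t) ^ xA)).mono' hcont1.aestronglyMeasurable (eO fun x => ?_)
    have := p1 (x + P.c * t)
    rw [add_zero] at this; exact this
  refine ⟨fun x => ?_, ?_, ?_⟩
  · rw [ev]
    have a1 := p1 (x + P.c * t)
    have a2 := CV_dec (K := E1 d (hF P D.u)) (x := x + P.c * t) (q := 1/2) (B := (B * δ) * (1 + t) ^ xA) (by norm_num) (by norm_num) ht (by positivity)
      (fun s r hs hr e => (p2 s r x hs hr e).trans (mul_le_of_le_one_right (by positivity) (Pf_le_one hl.le ht _)))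
    rw [sub_self, Real.rpow_zero, mul_one] at a2
    have a3 := Pf_le_one hl.le ht (x + P.c * t + 0)
    refine (abs_add_le _ _).trans ?_
    rw [abs_mul]
    calc _ ≤ δ * cK d l * (1 + t) ^ xA * 1 + |P.γ| * (B * δ * (1 + t) ^ xA * cV (1/2)) := by
          refine add_le_add (a1.trans (by gcongr)) (by gcongr)
      _ = (cK d l + |P.γ| * (B * cV (1/2))) * (1 + 0) * δ * (1 + t) ^ xA := by ring
      _ ≤ _ := by gcongr
  · simp only [ev]
    exact r3.add (q1.const_mul _)
  · have a1 : ∫ x, |D.v t x| ≤ ∫ x, (δ * cK d l * (1 + t) ^ xA * Pf l t (x + P.c * t) + |P.γ| * |CV (E1 d (hF P D.u)) t (x + P.c * t)|) := by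
      refine integral_mono_of_nonneg (eO fun x => abs_nonneg _) ((r1.const_mul _).add (q1.abs.const_mul _)) (eO fun x => ?_)
      show |D.v t x| ≤ _
      rw [ev]
      refine (abs_add_le _ _).trans (add_le_add ?_ (le_of_eq (abs_mul _ _)))
      have := p1 (x + P.c * t)
      rwa [add_zero] at this
    rw [integral_add (r1.const_mul _) (q1.abs.const_mul _), integral_const_mul, integral_const_mul, r2] at a1
    refine a1.trans ?_
    calc _ = δ * cK d l * √(Real.pi / l) * ((1 + t) ^ xA * (1 + t) ^ (1/2:ℝ)) + |P.γ| * ∫ x, |CV (E1 d (hF P D.u)) t (x + P.c * t)| := by ring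
      _ ≤ δ * cK d l * √(Real.pi / l) * 1 + |P.γ| * (B * δ * √(Real.pi / l) * cV (1/2)) := by
          rw [rp hτ0 (show -(1/2:ℝ) + 1/2 = 0 by norm_num), Real.rpow_zero]
          gcongr
      _ = (cK d l + |P.γ| * (B * cV (1/2))) * (0 + √(Real.pi / l)) * δ := by ring
      _ ≤ _ := by gcongr; norm_num

lemma chain {f ft fx : ℝ → ℝ → ℝ} {t k m : ℝ} (ht : 0 < t)
    (h1 : ∀ t, 0 < t → ∀ x, HasDerivAt (fun s => f s x) (ft t x) t)
    (h2 : ∀ t, 0 < t → ∀ x, HasDerivAt (fun y => f t y) (fx t x) x)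
    (c1 : ContinuousAt (fun p : ℝ × ℝ => ft p.1 p.2) (t, k + m * t))
    (c2 : ContinuousAt (fun p : ℝ × ℝ => fx p.1 p.2) (t, k + m * t)) :
    HasDerivAt (fun s => f s (k + m * s)) (ft t (k + m * t) + m * fx t (k + m * t)) t := by
  have hev : ∀ᶠ p : ℝ × ℝ in nhds (t, k + m * t), 0 < p.1 :=
    (continuous_fst.continuousAt).eventually (lt_mem_nhds ht)
  have H := hasStrictFDerivAt_uncurry_coprod (𝕜 := ℝ) (u := (t, k + m * t)) (f := f)
    (f₁ := fun t x => ContinuousLinearMap.toSpanSingleton ℝ (ft t x))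
    (f₂ := fun t x => ContinuousLinearMap.toSpanSingleton ℝ (fx t x))
    (hev.mono fun p hp => (h1 p.1 hp p.2).hasFDerivAt) (hev.mono fun p hp => (h2 p.1 hp p.2).hasFDerivAt)
    ((ContinuousLinearMap.toSpanSingletonCLE (𝕜 := ℝ) (E := ℝ)).continuous.continuousAt.comp c1)
    ((ContinuousLinearMap.toSpanSingletonCLE (𝕜 := ℝ) (E := ℝ)).continuous.continuousAt.comp c2)
  have hg : HasDerivAt (fun s : ℝ => (s, k + m * s)) (1, m) t := by
    refine (hasDerivAt_id t).prodMk ?_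
    simpa using ((hasDerivAt_id t).const_mul m).const_add k
  have := H.hasFDerivAt.comp_hasDerivAt t hg
  refine this.congr_deriv ?_
  simp [Function.HasUncurry.uncurry]

namespace Dat
variable {P : Par} {M δ : ℝ} (D : Dat P M δ)
def vx (t x : ℝ) : ℝ := D.vhx t (x + P.c * t)
def vxx (t x : ℝ) : ℝ := D.vhxx t (x + P.c * t)
def vt (t x : ℝ) : ℝ := P.d₂ * D.vxx t x + P.c * D.vx t x + P.γ * (2 * D.u t x * D.ux t x)
lemma v_eq {t : ℝ} (ht : 0 ≤ t) (x : ℝ) : D.v t x = D.vh t (x + P.c * t) := by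
  unfold v Vop; rw [tp_of ht]; rfl
lemma v_cont : Continuous (Function.uncurry D.v) := Vop_cont P D.v₀_GC D.hu
lemma v_dx (h1 : ∀ t x, |D.u t x| ≤ 1) {t : ℝ} (ht : 0 < t) (x : ℝ) : HasDerivAt (fun y => D.v t y) (D.vx t x) x := by
  rw [funext fun y => D.v_eq ht.le y]
  exact (D.vh_dx h1 ht (x + P.c * t)).comp_add_const x (P.c * t)
lemma v_dxx {t : ℝ} (ht : 0 < t) (x : ℝ) : HasDerivAt (fun y => D.vx t y) (D.vxx t x) x :=
  (D.vh_dxx ht (x + P.c * t)).comp_add_const x (P.c * t)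
lemma vhx_c {t : ℝ} (ht : 0 < t) (x : ℝ) : ContinuousAt (fun p : ℝ × ℝ => D.vhx p.1 p.2) (t, x) :=
  Md1_contAt P.hd₂ D.v₀_GC D.hy_GC ht x
lemma vhxx_c {t : ℝ} (ht : 0 < t) (x : ℝ) : ContinuousAt (fun p : ℝ × ℝ => D.vhxx p.1 p.2) (t, x) :=
  Md2_contAt P.hd₂ D.v₀_GC D.hy_GC D.hy_SL ht x
lemma vx_c {t : ℝ} (ht : 0 < t) (x : ℝ) : ContinuousAt (fun p : ℝ × ℝ => D.vx p.1 p.2) (t, x) :=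
  ContinuousAt.comp (x := (t, x)) (f := fun p : ℝ × ℝ => (p.1, p.2 + P.c * p.1)) (g := fun p : ℝ × ℝ => D.vhx p.1 p.2) (D.vhx_c ht (x + P.c * t)) (by fun_prop)
lemma vxx_c {t : ℝ} (ht : 0 < t) (x : ℝ) : ContinuousAt (fun p : ℝ × ℝ => D.vxx p.1 p.2) (t, x) :=
  ContinuousAt.comp (x := (t, x)) (f := fun p : ℝ × ℝ => (p.1, p.2 + P.c * p.1)) (g := fun p : ℝ × ℝ => D.vhxx p.1 p.2) (D.vhxx_c ht (x + P.c * t)) (by fun_prop)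
lemma vt_c {t : ℝ} (ht : 0 < t) (x : ℝ) : ContinuousAt (fun p : ℝ × ℝ => D.vt p.1 p.2) (t, x) := by
  have h1 := D.vx_c ht x
  have h2 := D.vxx_c ht x
  have h3 : ContinuousAt (fun p : ℝ × ℝ => D.u p.1 p.2) (t, x) := D.hu.continuousAt
  have h4 : ContinuousAt (fun p : ℝ × ℝ => D.ux p.1 p.2) (t, x) := D.ux_GC.1.continuousAt
  unfold vt; fun_prop
lemma v_dt (h1 : ∀ t x, |D.u t x| ≤ 1) {t : ℝ} (ht : 0 < t) (x : ℝ) : HasDerivAt (fun s => D.v s x) (D.vt t x) t := by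
  have := chain (f := D.vh) (ft := fun t x => P.d₂ * D.vhxx t x + D.hy t x) (k := x) (m := P.c) ht (fun t ht x => D.vh_dt h1 ht x) (fun t ht x => D.vh_dx h1 ht x)
    ((D.vhxx_c ht _).const_mul _ |>.add D.hy_GC.1.continuousAt) (D.vhx_c ht _)
  have h := this.congr_deriv (g' := D.vt t x) (by simp only [vt, vxx, vx, hy, add_sub_cancel_right]; ring)
  refine h.congr_of_eventuallyEq ?_
  filter_upwards [lt_mem_nhds ht] with s hs
  exact D.v_eq hs.le x
lemma uxx_bd {t : ℝ} (ht : 0 < t) : ∃ B, ∀ s ∈ Icc (t / 2) (2 * t), ∀ x, |D.uxx s x| ≤ B := by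
  obtain ⟨L, hL⟩ := D.ux_SL (2 * t)
  refine ⟨|L| * (t / 2) ^ xA, fun s hs x => ?_⟩
  have hs0 : 0 < s := by linarith [hs.1]
  have h := (D.u_dxx hs0 x).le_of_lip' (C := |L| * s ^ xA) (by positivity) (eO fun y => by
    refine (hL s y x hs0 hs.2).trans ?_
    rw [Real.norm_eq_abs]
    gcongr; exact le_abs_self _)
  rw [Real.norm_eq_abs] at h
  refine h.trans (mul_le_mul_of_nonneg_left ?_ (abs_nonneg _))
  exact Real.rpow_le_rpow_of_nonpos (by linarith) hs.1 (by norm_num)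
end Dat

def Lc (c : ℝ) (h : ℝ → ℝ) : ℝ := ∫ y in Ioi (0:ℝ), eX (-c * y) * h y

lemma Lc_i {c B : ℝ} (hc : 0 < c) {h : ℝ → ℝ} (hh : Continuous h) (hB : ∀ y, |h y| ≤ B) :
    IntegrableOn (fun y => eX (-c * y) * h y) (Ioi 0) := by
  refine ((integrableOn_exp_mul_Ioi (neg_lt_zero.2 hc) 0).mul_const B).mono' (Continuous.aestronglyMeasurable (by fun_prop)) ?_
  refine eO fun y => ?_
  rw [Real.norm_eq_abs, abs_mul, abs_of_pos (Real.exp_pos _)]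
  exact mul_le_mul_of_nonneg_left (hB y) (Real.exp_pos _).le
lemma exp_int {c : ℝ} (hc : 0 < c) : ∫ y in Ioi (0:ℝ), eX (-c * y) = c⁻¹ := by
  rw [integral_exp_mul_Ioi (neg_lt_zero.2 hc)]; simp
lemma Lc_le {c a B : ℝ} (hc : 0 < c) (ha : a ≤ c / 2) {h : ℝ → ℝ} (hB : ∀ y, 0 < y → |h y| ≤ B * eX (a * y)) (hB0 : 0 ≤ B) :
    |Lc c h| ≤ B * (2 / c) := by
  rw [← Real.norm_eq_abs]
  refine (norm_integral_le_of_norm_le ((integrableOn_exp_mul_Ioi (neg_lt_zero.2 (half_pos hc)) 0).mul_const B) ?_).trans_eq ?_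
  · refine (ae_restrict_mem measurableSet_Ioi).mono fun y hy => ?_
    rw [Real.norm_eq_abs, abs_mul, abs_of_pos (Real.exp_pos _)]
    have hy' : 0 < y := hy
    calc _ ≤ eX (-c * y) * (B * eX (a * y)) := mul_le_mul_of_nonneg_left (hB y hy) (Real.exp_pos _).le
      _ = eX (-c * y + a * y) * B := by rw [Real.exp_add]; ring
      _ ≤ _ := by gcongr; nlinarith
  · rw [integral_mul_const, exp_int (half_pos hc)]; field_simp
lemma Lc_d {c B r p : ℝ} (hc : 0 < c) (hr : 0 < r) {h h' : ℝ → ℝ → ℝ} (hh : ∀ q, Continuous (h q)) (hh' : Continuous (h' p))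
    (hb : ∃ C, ∀ y, |h p y| ≤ C)
    (hd : ∀ q ∈ Metric.ball p r, ∀ y, HasDerivAt (fun q => h q y) (h' q y) q) (hB : ∀ q ∈ Metric.ball p r, ∀ y, |h' q y| ≤ B) :
    HasDerivAt (fun q => Lc c (h q)) (Lc c (h' p)) p := by
  obtain ⟨C, hC⟩ := hb
  refine (hasDerivAt_integral_of_dominated_loc_of_deriv_le (F := fun q y => eX (-c * y) * h q y) (F' := fun q y => eX (-c * y) * h' q y)
    (bound := fun y => eX (-c * y) * B) (Metric.ball_mem_nhds p hr) ?_ (Lc_i hc (hh p) hC) ?_ ?_ ?_ ?_).2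
  · exact eO fun q => Continuous.aestronglyMeasurable (by have := hh q; fun_prop)
  · exact Continuous.aestronglyMeasurable (by fun_prop)
  · refine eO fun y q hq => ?_
    rw [Real.norm_eq_abs, abs_mul, abs_of_pos (Real.exp_pos _)]
    exact mul_le_mul_of_nonneg_left (hB q hq y) (Real.exp_pos _).le
  · exact (integrableOn_exp_mul_Ioi (neg_lt_zero.2 hc) 0).mul_const B
  · exact eO fun y q hq => (hd q hq y).const_mul _
lemma Lc_parts {c k x C C' : ℝ} (hc : 0 < c) {f f' : ℝ → ℝ} (hd : ∀ x, HasDerivAt f (f' x) x) (hf' : Continuous f')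
    (hC : ∀ x, |f x| ≤ C) (hC' : ∀ x, |f' x| ≤ C') :
    k * Lc c (fun y => f' (x - k * y)) + c * Lc c (fun y => f (x - k * y)) = f x := by
  have hf : Continuous f := continuous_iff_continuousAt.2 fun x => (hd x).continuousAt
  have i1 : IntegrableOn (fun y => eX (-c * y) * f' (x - k * y)) (Ioi 0) := Lc_i hc (hf'.comp (by fun_prop : Continuous fun y => x - k * y)) (fun y => hC' _)
  have i2 : IntegrableOn (fun y => eX (-c * y) * f (x - k * y)) (Ioi 0) := Lc_i hc (hf.comp (by fun_prop : Continuous fun y => x - k * y)) (fun y => hC _)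
  have key := integral_Ioi_of_hasDerivAt_of_tendsto' (f := fun y => eX (-c * y) * f (x - k * y))
    (f' := fun y => -(k * (eX (-c * y) * f' (x - k * y)) + c * (eX (-c * y) * f (x - k * y)))) (a := 0) (m := 0) (fun y _ => by
      have e1 : HasDerivAt (fun y => eX (-c * y)) (eX (-c * y) * (-c)) y := by
        simpa using ((hasDerivAt_id y).const_mul (-c)).exp
      have e2 : HasDerivAt (fun y => x - k * y) (-k) y := by simpa using ((hasDerivAt_id y).const_mul k).const_sub x
      exact (e1.mul ((hd (x - k * y)).comp y e2)).congr_deriv (by simp only [Function.comp]; ring))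
    ((i1.const_mul k).add (i2.const_mul c)).neg ?_
  · rw [integral_neg, integral_add (i1.const_mul k) (i2.const_mul c), integral_const_mul, integral_const_mul] at key
    simp only [mul_zero, Real.exp_zero, sub_zero, one_mul] at key
    unfold Lc; linarith
  · refine squeeze_zero_norm (a := fun y => eX (-c * y) * C) (fun y => ?_) ?_
    · rw [Real.norm_eq_abs, abs_mul, abs_of_pos (Real.exp_pos _)]
      exact mul_le_mul_of_nonneg_left (hC _) (Real.exp_pos _).le
    · have : Filter.Tendsto (fun y : ℝ => -c * y) Filter.atTop Filter.atBot := Filter.tendsto_id.const_mul_atTop_of_neg (neg_lt_zero.2 hc)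
      simpa using (Real.tendsto_exp_atBot.comp this).mul_const C

lemma Lc_lin {c a B B' : ℝ} (hc : 0 < c) {h k : ℝ → ℝ} (hh : Continuous h) (hk : Continuous k) (hB : ∀ y, |h y| ≤ B) (hB' : ∀ y, |k y| ≤ B') :
    Lc c (fun y => a * h y + k y) = a * Lc c h + Lc c k := by
  unfold Lc
  rw [← integral_const_mul, ← integral_add ((Lc_i hc hh hB).const_mul a) (Lc_i hc hk hB')]
  congr 1; funext y; ring

def Par.κ (P : Par) : ℝ := P.d₂ - P.d₁
namespace Dat
variable {P : Par} {M δ : ℝ} (D : Dat P M δ)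
def om (t x : ℝ) : ℝ := D.v t x + P.γ * Lc P.c (fun y => D.u t (x - P.κ * y) ^ 2)
def ph1 (t x : ℝ) : ℝ := 2 * D.u t x * D.ux t x
def ph2 (t x : ℝ) : ℝ := 2 * (D.ux t x ^ 2 + D.u t x * D.uxx t x)
def psi (t x : ℝ) : ℝ := 2 * D.u t x * D.g t x - 2 * P.d₁ * D.ux t x ^ 2
def omx (t x : ℝ) : ℝ := D.vx t x + P.γ * Lc P.c (fun y => D.ph1 t (x - P.κ * y))
def omxx (t x : ℝ) : ℝ := D.vxx t x + P.γ * Lc P.c (fun y => D.ph2 t (x - P.κ * y))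
def omt (t x : ℝ) : ℝ := D.vt t x + P.γ * Lc P.c (fun y => P.d₁ * D.ph2 t (x - P.κ * y) + D.psi t (x - P.κ * y))

lemma uxx_cont {t : ℝ} (ht : 0 < t) : Continuous (D.uxx t) := continuous_iff_continuousAt.2 fun x =>
  ContinuousAt.comp (x := x) (f := fun y => (t, y)) (g := fun p : ℝ × ℝ => D.uxx p.1 p.2) (D.uxx_contAt ht x) (by fun_prop)
lemma ph1_cont (t : ℝ) : Continuous (D.ph1 t) := by
  have h1 := D.u_GC.sec t; have h2 := D.ux_GC.sec t
  unfold ph1; fun_prop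
lemma ph2_cont {t : ℝ} (ht : 0 < t) : Continuous (D.ph2 t) := by
  have h1 := D.u_GC.sec t; have h2 := D.ux_GC.sec t; have h3 := D.uxx_cont ht
  unfold ph2; fun_prop
lemma psi_cont (t : ℝ) : Continuous (D.psi t) := by
  have h1 := D.u_GC.sec t; have h2 := D.ux_GC.sec t; have h3 := D.g_GC.sec t
  unfold psi; fun_prop
lemma ph_dx (t x : ℝ) : HasDerivAt (fun y => D.u t y ^ 2) (D.ph1 t x) x :=
  ((D.u_dx t x).pow 2).congr_deriv (by simp [ph1])
lemma ph_dxx {t : ℝ} (ht : 0 < t) (x : ℝ) : HasDerivAt (fun y => D.ph1 t y) (D.ph2 t x) x :=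
  (((D.u_dx t x).const_mul 2).mul (D.u_dxx ht x)).congr_deriv (by simp only [ph2]; ring)
lemma ph_dt {t : ℝ} (ht : 0 < t) (x : ℝ) : HasDerivAt (fun s => D.u s x ^ 2) (P.d₁ * D.ph2 t x + D.psi t x) t :=
  ((D.u_dt ht x).pow 2).congr_deriv (by simp [ph2, psi]; ring)
lemma ph_bd (h1 : ∀ t x, |D.u t x| ≤ 1) {t : ℝ} (ht : 0 < t) : ∃ B, ∀ s ∈ Icc (t / 2) (2 * t), ∀ x,
    |D.ph1 s x| ≤ B ∧ |D.ph2 s x| ≤ B ∧ |D.psi s x| ≤ B ∧ |P.d₁ * D.ph2 s x + D.psi s x| ≤ B := by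
  obtain ⟨B, hB⟩ := D.uxx_bd ht
  obtain ⟨C, hC⟩ := D.ux_GC.2 (2 * t)
  have hd := P.hd₁
  set G := |P.α| + P.μ
  refine ⟨2 * C + 2 * (C ^ 2 + B) + (2 * G + 2 * P.d₁ * C ^ 2) + P.d₁ * (2 * (C ^ 2 + B)), fun s hs x => ?_⟩
  have a0 := h1 s x
  have a1 := hC s hs.2 x
  have a2 := hB s hs x
  have a3 : |D.g s x| ≤ G := gF_bd P D.v₀ D.u s x
  have hC0 := (abs_nonneg _).trans a1
  have hB0 := (abs_nonneg _).trans a2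
  have hG0 := (abs_nonneg _).trans a3
  have b1 : |D.ph1 s x| ≤ 2 * C := by
    unfold ph1; rw [abs_mul, abs_mul, abs_two]
    calc _ ≤ 2 * 1 * C := by gcongr
      _ = _ := by ring
  have b2 : |D.ph2 s x| ≤ 2 * (C ^ 2 + B) := by
    unfold ph2; rw [abs_mul, abs_two]
    refine mul_le_mul_of_nonneg_left ((abs_add_le _ _).trans ?_) zero_le_two
    rw [abs_mul, abs_pow]
    calc _ ≤ C ^ 2 + 1 * B := by gcongr
      _ = _ := by ring
  have b3 : |D.psi s x| ≤ 2 * G + 2 * P.d₁ * C ^ 2 := by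
    unfold psi
    refine (abs_sub _ _).trans ?_
    rw [abs_mul, abs_mul, abs_mul, abs_mul, abs_two, abs_pow, abs_of_pos hd]
    calc _ ≤ 2 * 1 * G + 2 * P.d₁ * C ^ 2 := by gcongr
      _ = _ := by ring
  have b4 : |P.d₁ * D.ph2 s x + D.psi s x| ≤ P.d₁ * (2 * (C ^ 2 + B)) + (2 * G + 2 * P.d₁ * C ^ 2) := by
    refine (abs_add_le _ _).trans (add_le_add ?_ b3)
    rw [abs_mul, abs_of_pos hd]; gcongr
  have e1 : 0 ≤ 2 * C := by positivity
  have e2 : 0 ≤ 2 * (C ^ 2 + B) := by positivity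
  have e3 : 0 ≤ 2 * G + 2 * P.d₁ * C ^ 2 := by positivity
  have e4 : 0 ≤ P.d₁ * (2 * (C ^ 2 + B)) := by positivity
  refine ⟨?_, ?_, ?_, ?_⟩ <;> linarith
lemma mem_mid {t : ℝ} (ht : 0 < t) : t ∈ Icc (t / 2) (2 * t) := ⟨by linarith, by linarith⟩
lemma ball_mid {t s : ℝ} (hs : s ∈ Metric.ball t (t / 2)) : s ∈ Icc (t / 2) (2 * t) := by
  rw [Metric.mem_ball, Real.dist_eq, abs_lt] at hs
  exact ⟨by linarith, by linarith⟩
lemma om_dx (h1 : ∀ t x, |D.u t x| ≤ 1) {t : ℝ} (ht : 0 < t) (x : ℝ) : HasDerivAt (fun y => D.om t y) (D.omx t x) x := by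
  obtain ⟨B, hB⟩ := D.ph_bd h1 ht
  have hu := D.u_GC.sec t
  have hp := D.ph1_cont t
  refine (D.v_dx h1 ht x).add (HasDerivAt.const_mul _ (Lc_d (B := B) (r := 1) (h' := fun q y => D.ph1 t (q - P.κ * y)) P.hc one_pos (fun q => by fun_prop) (by fun_prop)
    ⟨1, fun y => sq_le_one' (h1 _ _)⟩ (fun q _ y => (D.ph_dx t (q - P.κ * y)).comp_sub_const q (P.κ * y)) fun q _ y => (hB t (mem_mid ht) _).1))
lemma om_dxx (h1 : ∀ t x, |D.u t x| ≤ 1) {t : ℝ} (ht : 0 < t) (x : ℝ) : HasDerivAt (fun y => D.omx t y) (D.omxx t x) x := by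
  obtain ⟨B, hB⟩ := D.ph_bd h1 ht
  have hu := D.ph1_cont t
  have hp := D.ph2_cont ht
  refine (D.v_dxx ht x).add (HasDerivAt.const_mul _ (Lc_d (B := B) (r := 1) (h' := fun q y => D.ph2 t (q - P.κ * y)) P.hc one_pos (fun q => by fun_prop) (by fun_prop)
    ⟨B, fun y => (hB t (mem_mid ht) _).1⟩ (fun q _ y => (D.ph_dxx ht (q - P.κ * y)).comp_sub_const q (P.κ * y)) fun q _ y => (hB t (mem_mid ht) _).2.1))
lemma om_dt (h1 : ∀ t x, |D.u t x| ≤ 1) {t : ℝ} (ht : 0 < t) (x : ℝ) : HasDerivAt (fun s => D.om s x) (D.omt t x) t := by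
  obtain ⟨B, hB⟩ := D.ph_bd h1 ht
  have hp := D.ph2_cont ht
  have hs := D.psi_cont t
  refine (D.v_dt h1 ht x).add (HasDerivAt.const_mul _ (Lc_d (B := B) (r := t / 2) (h' := fun q y => P.d₁ * D.ph2 q (x - P.κ * y) + D.psi q (x - P.κ * y)) P.hc (half_pos ht)
    (fun q => by have hu := D.u_GC.sec q; fun_prop) (by fun_prop)
    ⟨1, fun y => sq_le_one' (h1 _ _)⟩ (fun q hq y => D.ph_dt (by have := (ball_mid hq).1; linarith) (x - P.κ * y)) fun q hq y => (hB q (ball_mid hq) _).2.2.2))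
lemma om_eq (h1 : ∀ t x, |D.u t x| ≤ 1) {t : ℝ} (ht : 0 < t) (x : ℝ) :
    D.omt t x = P.d₂ * D.omxx t x + P.c * D.omx t x + P.γ * Lc P.c (fun y => D.psi t (x - P.κ * y)) := by
  obtain ⟨B, hB⟩ := D.ph_bd h1 ht
  have hB := hB t (mem_mid ht)
  have hp := D.ph2_cont ht
  have hs := D.psi_cont t
  have k := Lc_parts (k := P.κ) (x := x) P.hc (D.ph_dxx ht) hp (fun x => (hB x).1) (fun x => (hB x).2.1)
  unfold omt omxx omx vt
  rw [Lc_lin (B := B) (B' := B) P.hc (by fun_prop) (by fun_prop) (fun y => (hB _).2.1) (fun y => (hB _).2.2.1)]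
  change _ + P.γ * D.ph1 t x + _ = _
  rw [← k]; unfold Par.κ; ring
lemma om_cont (h1 : ∀ t x, |D.u t x| ≤ 1) : Continuous (Function.uncurry D.om) := by
  have hu := D.hu
  have hu' : Continuous fun q : ℝ × ℝ => D.u q.1 q.2 := hu
  refine D.v_cont.add (continuous_const.mul ?_)
  refine continuous_of_dominated (F := fun (p : ℝ × ℝ) y => eX (-P.c * y) * D.u p.1 (p.2 - P.κ * y) ^ 2) (bound := fun y => eX (-P.c * y) * 1) ?_ ?_ ?_ ?_
  · intro p
    have := D.u_GC.sec p.1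
    exact Continuous.aestronglyMeasurable (by fun_prop)
  · refine fun p => eO fun y => ?_
    rw [Real.norm_eq_abs, abs_mul, abs_of_pos (Real.exp_pos _)]
    exact mul_le_mul_of_nonneg_left (sq_le_one' (h1 _ _)) (Real.exp_pos _).le
  · exact (integrableOn_exp_mul_Ioi (neg_lt_zero.2 P.hc) 0).mul_const 1
  · refine eO fun y => continuous_const.mul (Continuous.pow ?_ 2)
    exact hu'.comp (by fun_prop : Continuous fun p : ℝ × ℝ => (p.1, p.2 - P.κ * y))
lemma om_w (h1 : ∀ t x, |D.u t x| ≤ 1) (t x : ℝ) :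
    D.v t x + P.γ / P.c * D.u t x ^ 2 = D.om t x + P.γ * P.κ / P.c * Lc P.c (fun y => D.ph1 t (x - P.κ * y)) := by
  obtain ⟨C, hC⟩ := D.ux_GC.2 t
  have k := Lc_parts (C := 1) (C' := 2 * C) (k := P.κ) (x := x) P.hc (D.ph_dx t) (D.ph1_cont t) (fun x => sq_le_one' (h1 _ _)) (fun x => by
    unfold ph1; rw [abs_mul, abs_mul, abs_two]
    have := hC t le_rfl x
    calc _ ≤ 2 * 1 * C := by gcongr; exact h1 _ _
      _ = _ := by ring)
  have hc := P.hc.ne'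
  rw [← k]; unfold om; field_simp; ring
end Dat

def Rk (K s : ℝ) : ℝ := √(s ^ 2 + K ^ 2)
def bk (K s : ℝ) : ℝ := Rk K s + s
def fk (K s : ℝ) : ℝ := bk K s ^ xC
def fk1 (K s : ℝ) : ℝ := -(5/4) * fk K s * (Rk K s)⁻¹
def fk2 (K s : ℝ) : ℝ := -(5/4) * (fk1 K s * (Rk K s)⁻¹ - fk K s * (s * (Rk K s)⁻¹ / Rk K s ^ 2))

section
variable {K : ℝ}
lemma Rk_sq (K s : ℝ) : Rk K s ^ 2 = s ^ 2 + K ^ 2 := Real.sq_sqrt (by positivity)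
lemma Rk_nn (K s : ℝ) : 0 ≤ Rk K s := Real.sqrt_nonneg _
lemma Rk_ge (hK : 0 < K) (s : ℝ) : K ≤ Rk K s := by
  refine Real.le_sqrt_of_sq_le ?_; nlinarith
lemma Rk_pos (hK : 0 < K) (s : ℝ) : 0 < Rk K s := hK.trans_le (Rk_ge hK s)
lemma Rk_abs (K s : ℝ) : |s| ≤ Rk K s := Real.abs_le_sqrt (by nlinarith)
lemma bk_pos (hK : 0 < K) (s : ℝ) : 0 < bk K s := by
  have : |s| < Rk K s := by rw [← sq_lt_sq₀ (abs_nonneg _) (Rk_nn K s), Rk_sq, sq_abs]; nlinarith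
  unfold bk; linarith [neg_abs_le s]
lemma fk_pos (hK : 0 < K) (s : ℝ) : 0 < fk K s := Real.rpow_pos_of_pos (bk_pos hK s) _
lemma Rk_d (hK : 0 < K) (s : ℝ) : HasDerivAt (Rk K) (s * (Rk K s)⁻¹) s := by
  have h : HasDerivAt (fun s : ℝ => s ^ 2 + K ^ 2) (2 * s) s := by simpa using (hasDerivAt_pow 2 s).add_const (K ^ 2)
  refine (h.sqrt (by positivity)).congr_deriv ?_
  unfold Rk; have := Rk_pos hK s; unfold Rk at this; field_simp
lemma fk_d (hK : 0 < K) (s : ℝ) : HasDerivAt (fk K) (fk1 K s) s := by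
  have hb := bk_pos hK s
  have hR := Rk_pos hK s
  have h := ((Rk_d hK s).add (hasDerivAt_id s)).rpow_const (p := xC) (Or.inl hb.ne')
  refine h.congr_deriv ?_
  have e : (Rk K s + s) ^ xC = (Rk K s + s) ^ (-(5/4)-1:ℝ) * (Rk K s + s) := by
    rw [← Real.rpow_add_one (show Rk K s + s ≠ 0 from hb.ne')]; norm_num
  simp only [fk1, fk, bk, Pi.add_apply, id]
  rw [e]; field_simp; rw [add_comm s]
lemma fk1_d (hK : 0 < K) (s : ℝ) : HasDerivAt (fk1 K) (fk2 K s) s := by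
  have hR := Rk_pos hK s
  have h := (((fk_d hK s).const_mul (-(5/4))).mul ((Rk_d hK s).inv hR.ne'))
  refine h.congr_deriv ?_
  simp only [fk2, Pi.inv_apply]; ring
lemma fk_N {a : ℝ} (hK : 0 < K) (ha : 0 ≤ a) (h : 9 * a ≤ 2 * K) (s : ℝ) : 5 / 8 * (fk K s * (Rk K s)⁻¹) ≤ -fk1 K s - a * fk2 K s := by
  have hR := Rk_pos hK s
  have hf := fk_pos hK s
  have e : -fk1 K s - a * fk2 K s = (fk K s * (Rk K s)⁻¹) * (5 / 4 - a * (25 / 16 * (Rk K s)⁻¹ + 5 / 4 * (s * (Rk K s)⁻¹ / Rk K s))) := by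
    unfold fk2 fk1; field_simp; ring
  rw [e, mul_comm]
  refine mul_le_mul_of_nonneg_left ?_ (by positivity)
  have h1 : s * (Rk K s)⁻¹ / Rk K s ≤ (Rk K s)⁻¹ := by
    rw [div_le_iff₀ hR, mul_comm s]
    exact mul_le_mul_of_nonneg_left ((le_abs_self s).trans (Rk_abs K s)) (by positivity)
  have h2 : a * (Rk K s)⁻¹ ≤ 2 / 9 := by
    rw [← div_eq_mul_inv, div_le_iff₀ hR]; linarith [Rk_ge hK s]
  have h3 : 0 ≤ (Rk K s)⁻¹ := by positivity
  nlinarith [mul_le_mul_of_nonneg_left h1 ha]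
end

def th (ρ z : ℝ) : ℝ := (1 + eX (ρ * z))⁻¹
def th1 (ρ z : ℝ) : ℝ := -(ρ * eX (ρ * z)) / (1 + eX (ρ * z)) ^ 2
def th2 (ρ z : ℝ) : ℝ := ρ ^ 2 * eX (ρ * z) * (eX (ρ * z) - 1) / (1 + eX (ρ * z)) ^ 3
lemma exp_d (ρ z : ℝ) : HasDerivAt (fun z => 1 + eX (ρ * z)) (ρ * eX (ρ * z)) z := by
  have := (((hasDerivAt_id z).const_mul ρ).exp).const_add 1
  exact this.congr_deriv (by simp; ring)
lemma th_d (ρ z : ℝ) : HasDerivAt (th ρ) (th1 ρ z) z := (exp_d ρ z).inv (by positivity)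
lemma th1_d (ρ z : ℝ) : HasDerivAt (th1 ρ) (th2 ρ z) z := by
  have h1 : HasDerivAt (fun z => -(ρ * eX (ρ * z))) (-(ρ * (ρ * eX (ρ * z)))) z := by
    have := ((exp_d ρ z).sub_const 1).const_mul ρ
    simp only [add_sub_cancel_left] at this
    exact this.neg
  refine (h1.div ((exp_d ρ z).pow 2) (by simp only [Pi.pow_apply]; positivity)).congr_deriv ?_
  have : 0 < 1 + eX (ρ * z) := by positivity
  unfold th2; simp only [Pi.pow_apply]; field_simp; ring
lemma th_pos (ρ z : ℝ) : 0 < th ρ z := by unfold th; positivity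
lemma th_le1 (ρ z : ℝ) : th ρ z ≤ 1 := by unfold th; exact inv_le_one_of_one_le₀ (by linarith [Real.exp_pos (ρ * z)])
lemma th_le2 (ρ z : ℝ) : th ρ z ≤ eX (-(ρ * z)) := by
  unfold th; rw [Real.exp_neg]; exact inv_anti₀ (Real.exp_pos _) (by linarith)
lemma th_lo {ρ : ℝ} (hρ : 0 < ρ) (z : ℝ) : 1 / 2 * eX (-ρ * |z|) ≤ th ρ z ∧ ρ / 4 * eX (-ρ * |z|) ≤ -th1 ρ z := by
  have hE := Real.exp_pos (ρ * z)
  unfold th th1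
  rcases le_total 0 z with h | h
  · have e : eX (-ρ * |z|) = (eX (ρ * z))⁻¹ := by rw [abs_of_nonneg h, ← Real.exp_neg]; ring_nf
    have h1 : 1 ≤ eX (ρ * z) := Real.one_le_exp (by positivity)
    rw [e]; set E := eX (ρ * z)
    constructor
    · rw [← div_eq_mul_inv, div_div, ← one_div (1 + E), div_le_div_iff₀ (by positivity) (by positivity)]; linarith
    · rw [neg_div, neg_neg, ← div_eq_mul_inv, div_div, div_le_div_iff₀ (by positivity) (by positivity)]
      nlinarith [mul_nonneg hρ.le (sub_nonneg.2 h1), mul_pos hρ hE]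
  · have e : eX (-ρ * |z|) = eX (ρ * z) := by rw [abs_of_nonpos h]; ring_nf
    have h1 : eX (ρ * z) ≤ 1 := Real.exp_le_one_iff.2 (by nlinarith)
    rw [e]; set E := eX (ρ * z)
    constructor
    · rw [← one_div, le_div_iff₀ (by positivity)]; nlinarith
    · rw [neg_div, neg_neg, le_div_iff₀ (by positivity)]
      have : (1 + E) ^ 2 ≤ 4 := by nlinarith
      have h2 : 0 ≤ ρ / 4 * E := by positivity
      nlinarith [mul_le_mul_of_nonneg_left this h2]
lemma th_er {ρ : ℝ} (z : ℝ) : -(z * th1 ρ z) ≥ - th ρ z ∧ |th2 ρ z| ≤ ρ ^ 2 * th ρ z := by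
  have hE := Real.exp_pos (ρ * z)
  have h := Real.add_one_le_exp (-(ρ * z))
  rw [Real.exp_neg] at h
  unfold th th1 th2
  set E := eX (ρ * z)
  constructor
  · have h2 : -(ρ * z) * E ≤ 1 := by
      have := mul_le_mul_of_nonneg_right h hE.le
      rw [inv_mul_cancel₀ hE.ne'] at this; nlinarith
    rw [ge_iff_le, ← sub_nonneg]
    have : -(z * (-(ρ * E) / (1 + E) ^ 2)) - -(1 + E)⁻¹ = (1 + E + ρ * z * E) / (1 + E) ^ 2 := by field_simp; ring
    rw [this]; apply div_nonneg _ (by positivity); nlinarith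
  · have e : ρ ^ 2 * E * (E - 1) / (1 + E) ^ 3 = ρ ^ 2 * (1 + E)⁻¹ * (E * (E - 1) / (1 + E) ^ 2) := by field_simp
    rw [e, abs_mul, abs_of_nonneg (by positivity : 0 ≤ ρ ^ 2 * (1 + E)⁻¹)]
    refine mul_le_of_le_one_right (by positivity) ?_
    rw [abs_div, abs_mul, abs_of_pos hE, abs_of_pos (by positivity : 0 < (1 + E) ^ 2), div_le_one (by positivity)]
    have : |E - 1| ≤ 1 + E := by rw [abs_le]; constructor <;> linarith
    nlinarith

def Gs (ρ t x : ℝ) : ℝ := (1 + t) ^ xC * th ρ (x * (1 + t) ^ xA)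
def Gsx (ρ t x : ℝ) : ℝ := (1 + t) ^ xD * th1 ρ (x * (1 + t) ^ xA)
def Gsxx (ρ t x : ℝ) : ℝ := (1 + t) ^ xG * th2 ρ (x * (1 + t) ^ xA)
def Gst (ρ t x : ℝ) : ℝ := (1 + t) ^ xG * (-(5/4) * th ρ (x * (1 + t) ^ xA) - 1 / 2 * ((x * (1 + t) ^ xA) * th1 ρ (x * (1 + t) ^ xA)))
lemma Gs_dx {t : ℝ} (ht : 0 ≤ t) (ρ x : ℝ) : HasDerivAt (fun x => Gs ρ t x) (Gsx ρ t x) x := by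
  have hτ : 0 < 1 + t := by linarith
  have := ((th_d ρ (x * (1 + t) ^ xA)).comp x ((hasDerivAt_id x).mul_const ((1 + t) ^ xA))).const_mul ((1 + t) ^ xC)
  refine this.congr_deriv ?_
  unfold Gsx; rw [← rp hτ (show -(5/4:ℝ) + -(1/2) = -(7/4) by norm_num)]; ring
lemma Gs_dxx {t : ℝ} (ht : 0 ≤ t) (ρ x : ℝ) : HasDerivAt (fun x => Gsx ρ t x) (Gsxx ρ t x) x := by
  have hτ : 0 < 1 + t := by linarith
  have := ((th1_d ρ (x * (1 + t) ^ xA)).comp x ((hasDerivAt_id x).mul_const ((1 + t) ^ xA))).const_mul ((1 + t) ^ xD)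
  refine this.congr_deriv ?_
  unfold Gsxx; rw [← rp hτ (show -(7/4:ℝ) + -(1/2) = -(9/4) by norm_num)]; ring
lemma tau_d {t : ℝ} (ht : 0 ≤ t) (p : ℝ) : HasDerivAt (fun t : ℝ => (1 + t) ^ p) (p * (1 + t) ^ (p - 1)) t := by
  have hτ : 0 < 1 + t := by linarith
  have := ((hasDerivAt_id t).const_add 1).rpow_const (p := p) (Or.inl hτ.ne')
  exact this.congr_deriv (by simp)
lemma Gs_dt {t : ℝ} (ht : 0 ≤ t) (ρ x : ℝ) : HasDerivAt (fun t => Gs ρ t x) (Gst ρ t x) t := by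
  have hτ : 0 < 1 + t := by linarith
  have := (tau_d ht (-(5/4))).mul ((th_d ρ (x * (1 + t) ^ xA)).comp t ((tau_d ht (-(1/2))).const_mul x))
  refine this.congr_deriv ?_
  have e1 : (-(5/4) - 1 : ℝ) = -(9/4) := by norm_num
  have e2 := rp hτ (show -(9/4:ℝ) + -(1/2) = -(11/4) by norm_num)
  have e3 := rp hτ (show -(5/4:ℝ) + (-(1/2) - 1) = -(11/4) by norm_num)
  have e4 := e2.trans e3.symm
  unfold Gst; rw [e1]; simp only [Function.comp]
  linear_combination (x * (1 / 2) * th1 ρ (x * (1 + t) ^ xA)) * e4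
lemma Gs_N {c d ρ t : ℝ} (hc : 0 < c) (hd : 0 < d) (hρ : 0 < ρ) (ht : 0 ≤ t) (x : ℝ) :
    c * ρ / 4 * ((1 + t) ^ xD * eX (-ρ * |x * (1 + t) ^ xA|)) - (7 / 4 + d * ρ ^ 2) * ((1 + t) ^ xG * th ρ (x * (1 + t) ^ xA)) ≤
    Gst ρ t x - d * Gsxx ρ t x - c * Gsx ρ t x := by
  have hτ : 0 < 1 + t := by linarith
  unfold Gst Gsxx Gsx
  set z := x * (1 + t) ^ xA
  have h1 := (th_lo hρ z).2
  obtain ⟨h2, h3⟩ := th_er (ρ := ρ) z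
  have h4 := (abs_le.1 h3).2
  have p7 : 0 < (1 + t) ^ xD := by positivity
  have p9 : 0 < (1 + t) ^ xG := by positivity
  set X := (1 + t) ^ xD
  set Y := (1 + t) ^ xG
  have a1 := mul_le_mul_of_nonneg_left h1 (by positivity : 0 ≤ c * X)
  have a2 := mul_le_mul_of_nonneg_left h2.le (by positivity : 0 ≤ 1 / 2 * Y)
  have a3 := mul_le_mul_of_nonneg_left h4 (by positivity : 0 ≤ d * Y)
  nlinarith

lemma f_lo {c K ρ : ℝ} (hc : 0 < c) (hK : 1 ≤ K) (hρ : 0 < ρ) : ∃ c₂ > 0, ∀ t x : ℝ, 0 ≤ t →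
    c₂ * ((1 + t) ^ xG * th ρ (x * (1 + t) ^ xA)) ≤ fk K (t + 2 * x / c) * (Rk K (t + 2 * x / c))⁻¹ := by
  have hK0 : 0 < K := by linarith
  set A := K + 2 + 4 / (c * ρ) with hA
  have hA0 : 0 < A := by positivity
  refine ⟨A ^ xG * (9 / 4) ^ xG, by positivity, fun t x ht => ?_⟩
  have hτ : 0 < 1 + t := by linarith
  set s := t + 2 * x / c with hs
  set ξ := x * (1 + t) ^ xA with hξ
  set z := ρ * max ξ 0 with hz
  have hz0 : 0 ≤ z := by positivity
  have hx : x ≤ max ξ 0 * (1 + t) := by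
    have e : x = ξ * (1 + t) ^ (1/2:ℝ) := by rw [hξ, mul_assoc, rp hτ (show -(1/2:ℝ) + 1/2 = 0 by norm_num)]; simp
    have h1 : (1 + t) ^ (1/2:ℝ) ≤ (1 + t) ^ (1:ℝ) := Real.rpow_le_rpow_of_exponent_le (by linarith) (by norm_num)
    rw [Real.rpow_one] at h1
    calc x = ξ * (1 + t) ^ (1/2:ℝ) := e
      _ ≤ max ξ 0 * (1 + t) ^ (1/2:ℝ) := by gcongr; exact le_max_left _ _
      _ ≤ _ := by gcongr
  have hsA : 2 * max s 0 + K ≤ A * (1 + t) * (1 + z) := by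
    have h1 : max s 0 ≤ t + 2 / c * (max ξ 0 * (1 + t)) := by
      refine max_le ?_ (by positivity)
      rw [hs, mul_div_right_comm]; gcongr
    have h2 : 4 / c * (max ξ 0 * (1 + t)) = 4 / (c * ρ) * (1 + t) * z := by rw [hz]; field_simp
    have h3 : 0 ≤ 4 / (c * ρ) * (1 + t) := by positivity
    have h4 : 2 * (2 / c * (max ξ 0 * (1 + t))) = 4 / c * (max ξ 0 * (1 + t)) := by ring
    have h5 : 0 ≤ K * (1 + t) * z := by positivity
    have h6 : 0 ≤ (1 + t) * z := by positivity
    have h7 : 0 ≤ K * t := by positivity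
    rw [hA]; nlinarith
  set B := A * (1 + t) * (1 + z) with hB
  have hb := bk_pos hK0 s
  have hR := Rk_pos hK0 s
  have hbB : bk K s ≤ B := by
    refine le_trans ?_ hsA
    have h1 : Rk K s ≤ K + |s| := by
      refine Real.sqrt_le_iff.2 ⟨by positivity, ?_⟩
      nlinarith [sq_abs s, mul_nonneg hK0.le (abs_nonneg s)]
    have h2 : |s| + s ≤ 2 * max s 0 := by
      rcases le_total 0 s with h | h
      · rw [abs_of_nonneg h, max_eq_left h]; linarith
      · rw [abs_of_nonpos h, max_eq_right h]; linarith
    unfold bk; linarith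
  have hKB : K ≤ B := by linarith [le_max_right s 0]
  have hB0 : 0 < B := by positivity
  have hRb : bk K s * Rk K s ≤ B ^ 2 := by
    have : 2 * (bk K s * Rk K s) = bk K s ^ 2 + K ^ 2 := by have := Rk_sq K s; unfold bk; nlinarith
    nlinarith
  have e1 : B ^ xG ≤ fk K s * (Rk K s)⁻¹ := by
    have h1 : bk K s * (B ^ 2)⁻¹ ≤ (Rk K s)⁻¹ := by
      rw [← div_eq_mul_inv, div_le_iff₀ (by positivity), inv_mul_eq_div, le_div_iff₀ hR]; exact hRb
    have h2 : fk K s * bk K s = bk K s ^ xB := by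
      unfold fk; rw [← Real.rpow_add_one hb.ne']; norm_num
    have h3 : B ^ xB ≤ bk K s ^ xB := Real.rpow_le_rpow_of_nonpos hb hbB (by norm_num)
    have h4 : B ^ xG = B ^ xB * (B ^ 2)⁻¹ := by
      rw [← Real.rpow_natCast, ← Real.rpow_neg hB0.le, rp hB0]; norm_num
    calc _ = B ^ xB * (B ^ 2)⁻¹ := h4
      _ ≤ (fk K s * bk K s) * (B ^ 2)⁻¹ := by rw [h2]; gcongr
      _ = fk K s * (bk K s * (B ^ 2)⁻¹) := by ring
      _ ≤ _ := mul_le_mul_of_nonneg_left h1 (fk_pos hK0 s).le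
  refine le_trans ?_ e1
  have e2 : th ρ ξ ≤ eX (-z) := by
    rcases le_total 0 ξ with h | h
    · rw [hz, max_eq_left h]; exact th_le2 _ _
    · rw [hz, max_eq_right h]; simpa using th_le1 ρ ξ
  have e3 : (9 / 4:ℝ) ^ xG * eX (-z) ≤ (1 + z) ^ xG := by
    have h1 : 1 + z ≤ 9 / 4 * eX (4 / 9 * z) := by linarith [Real.add_one_le_exp (4 / 9 * z)]
    have h2 := Real.rpow_le_rpow_of_nonpos (by positivity : 0 < 1 + z) h1 (show xG ≤ 0 by norm_num)
    rw [Real.mul_rpow (by norm_num) (Real.exp_pos _).le, ← Real.exp_mul] at h2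
    rw [show 4 / 9 * z * (-(9/4)) = -z by ring] at h2
    exact h2
  rw [hB, Real.mul_rpow (by positivity) (by positivity), Real.mul_rpow hA0.le hτ.le]
  calc _ ≤ A ^ xG * (9 / 4) ^ xG * ((1 + t) ^ xG * eX (-z)) := by gcongr
    _ = A ^ xG * (1 + t) ^ xG * ((9 / 4) ^ xG * eX (-z)) := by ring
    _ ≤ _ := by gcongr

lemma fk_up {c K t x : ℝ} (hc : 0 < c) (hK : 1 ≤ K) (ht : 0 ≤ t) (hx : -(c / 4 * t) ≤ x) :
    fk K (t + 2 * x / c) ≤ 2 ^ (5/4:ℝ) * (1 + t) ^ xC := by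
  have hτ : 0 < 1 + t := by linarith
  have h1 : t / 2 ≤ t + 2 * x / c := by
    have : -(t / 2) ≤ 2 * x / c := by rw [le_div_iff₀ hc]; nlinarith
    linarith
  have h2 := Rk_ge (by linarith : 0 < K) (t + 2 * x / c)
  have h3 : 2⁻¹ * (1 + t) ≤ bk K (t + 2 * x / c) := by unfold bk; linarith
  refine (Real.rpow_le_rpow_of_nonpos (by positivity) h3 (by norm_num)).trans_eq ?_
  rw [Real.mul_rpow (by norm_num) hτ.le, Real.inv_rpow (by norm_num), ← Real.rpow_neg (by norm_num)]; norm_num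

lemma Pf_exp {l ρ t : ℝ} (hl : 0 < l) (ht : 0 ≤ t) (x : ℝ) :
    Pf l t x ≤ eX (ρ ^ 2 / (4 * l)) * eX (-ρ * |x * (1 + t) ^ xA|) := by
  have hτ : 0 < 1 + t := by linarith
  unfold Pf
  rw [← Real.exp_add]
  refine Real.exp_le_exp.2 ?_
  have e : (x * (1 + t) ^ xA) ^ 2 = x ^ 2 / (1 + t) := by
    rw [mul_pow, ← Real.rpow_natCast ((1 + t) ^ xA), ← Real.rpow_mul hτ.le]
    norm_num [Real.rpow_neg_one, div_eq_mul_inv]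
  set y := |x * (1 + t) ^ xA| with hy
  have e2 : -(l / (1 + t)) * x ^ 2 = -l * y ^ 2 := by rw [hy, sq_abs, e]; ring
  rw [e2]
  have h1 : 0 ≤ l * (y - ρ / (2 * l)) ^ 2 := by positivity
  have e3 : l * (y - ρ / (2 * l)) ^ 2 = l * y ^ 2 - ρ * y + ρ ^ 2 / (4 * l) := by field_simp; ring
  linarith

lemma Lc_prof {c k ρ w B : ℝ} (hc : 0 < c) (hρ : 0 < ρ) (hk : ρ * |k| ≤ c / 2) (hw : 0 ≤ w) (hw1 : w ≤ 1) (hB : 0 ≤ B) {h : ℝ → ℝ}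
    (hh : ∀ x, |h x| ≤ B * eX (-ρ * |x * w|)) (x : ℝ) :
    |Lc c (fun y => h (x - k * y))| ≤ B * eX (-ρ * |x * w|) * (2 / c) := by
  refine Lc_le hc hk (fun y hy => (hh _).trans ?_) (by positivity)
  rw [mul_assoc, ← Real.exp_add]
  refine mul_le_mul_of_nonneg_left (Real.exp_le_exp.2 ?_) hB
  have h1 : |x * w| ≤ |(x - k * y) * w| + |k| * y := by
    have e : x * w = (x - k * y) * w + k * y * w := by ring
    calc |x * w| = |(x - k * y) * w + k * y * w| := by rw [← e]
      _ ≤ |(x - k * y) * w| + |k * y * w| := abs_add_le _ _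
      _ ≤ _ := by
        gcongr
        rw [abs_mul, abs_mul, abs_of_pos hy, abs_of_nonneg hw]
        exact mul_le_of_le_one_right (by positivity) hw1
  nlinarith [mul_le_mul_of_nonneg_left h1 hρ.le]

def Par.K (P : Par) : ℝ := max 1 (18 * P.d₂ / P.c ^ 2)
def Par.ρ (P : Par) : ℝ := P.c / (2 * (1 + |P.κ|))
lemma Par.ρ_spec (P : Par) : 0 < P.ρ ∧ P.ρ * |P.κ| ≤ P.c / 2 := by
  have hc := P.hc
  have : 0 < 1 + |P.κ| := by positivity
  refine ⟨by unfold Par.ρ; positivity, ?_⟩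
  unfold Par.ρ
  rw [div_mul_eq_mul_div, div_le_div_iff₀ (by positivity) two_pos]; nlinarith [abs_nonneg P.κ]
lemma half_le_one {t : ℝ} (ht : 0 ≤ t) : (1 + t) ^ xA ≤ 1 :=
  Real.rpow_le_one_of_one_le_of_nonpos (by linarith) (by norm_num)

lemma psi_bound (P : Par) (M : ℝ) (h : |P.α| * P.η ≤ cc P.d₁ M) : ∃ C > 0, ∀ δ (D : Dat P M δ) (t x : ℝ), 0 ≤ t →
    |D.psi t x| ≤ C * δ * (1 + t) ^ xD * eX (-P.ρ * |x * (1 + t) ^ xA|) ∧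
    |D.u t x ^ 2| ≤ C * δ * eX (-P.ρ * |x * (1 + t) ^ xA|) ∧ (t = 0 → |D.v t x| ≤ C * δ * eX (-P.ρ * |x * (1 + t) ^ xA|)) ∧
    |D.ph1 t x| ≤ C * δ * (1 + t) ^ xC := by
  by_cases hM : 1 ≤ M
  swap
  · exact ⟨1, one_pos, fun δ D => absurd D.hM hM⟩
  obtain ⟨A, hA, hu⟩ := u_bound P M h
  obtain ⟨B, hB, hg⟩ := g_bound P M h
  obtain ⟨C, hC, hx⟩ := ux_bound P M h
  obtain ⟨hl, hl1, hl2, hl3, -, -⟩ := lm_spec P hM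
  set l := lm P M
  have hd := P.hd₁
  set S := eX (P.ρ ^ 2 / (4 * l)) with hS
  have hS0 : 0 < S := Real.exp_pos _
  have hS1 : 1 ≤ S := Real.one_le_exp (by positivity)
  obtain ⟨Q, hQ⟩ : ∃ Q, Q = 2 * A * B + 2 * P.d₁ * C ^ 2 + A ^ 2 + 1 + 2 * A * C := ⟨_, rfl⟩
  have q1 : 0 ≤ 2 * A * B := by positivity
  have q2 : 0 ≤ 2 * P.d₁ * C ^ 2 := by positivity
  have q3 : 0 ≤ A ^ 2 := by positivity
  have q4 : 0 ≤ 2 * A * C := by positivity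
  have Q1 : 2 * A * B + 2 * P.d₁ * C ^ 2 ≤ Q := by linarith
  have Q2 : A ^ 2 ≤ Q := by linarith
  have Q3 : 1 ≤ Q := by linarith
  have Q4 : 2 * A * C ≤ Q := by linarith
  clear hQ
  have Q0 : 0 < Q := by linarith
  refine ⟨Q * S, by positivity, fun δ D t x ht => ?_⟩
  have hδ := D.hδ
  have hδ2 : δ ^ 2 ≤ δ := by nlinarith [D.hδ1]
  have hτ : 0 < 1 + t := by linarith
  have hτ1 : 1 ≤ 1 + t := by linarith
  have pm := Pf_mono hl2 ht x
  have pm1 := Pf_mono hl1 ht x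
  have p1 := Pf_le_one hl.le ht x
  have p0 := Pf_pos l t x
  have pe := Pf_exp (ρ := P.ρ) hl ht x
  set p := Pf l t x
  set w := eX (-P.ρ * |x * (1 + t) ^ xA|) with hw
  have hw0 : 0 < w := Real.exp_pos _
  have a1 : |D.u t x| ≤ A * δ * ((1 + t) ^ xA * p) := (hu δ D t x ht).trans (by gcongr)
  have a2 : |D.g t x| ≤ B * δ * ((1 + t) ^ xF * p) := (hg δ D t x ht).trans (by gcongr)
  have a3 := hx δ D t x ht
  have r1 : (1 + t) ^ (-(2):ℝ) ≤ (1 + t) ^ xD := Real.rpow_le_rpow_of_exponent_le hτ1 (by norm_num)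
  have r2 := half_le_one ht
  have r3 : (1 + t) ^ (-(11/8):ℝ) ≤ (1 + t) ^ xC := Real.rpow_le_rpow_of_exponent_le hτ1 (by norm_num)
  have e1 := rp hτ (show -(1/2:ℝ) + -(3/2) = -(2) by norm_num)
  have e2 := rp hτ (show -(7/8:ℝ) + -(7/8) = -(7/4) by norm_num)
  have e3 := rp hτ (show -(1/2:ℝ) + -(7/8) = -(11/8) by norm_num)
  have pp : p ^ 2 ≤ p := by nlinarith
  have X0 : 0 < (1 + t) ^ xD := by positivity
  have Y0 : 0 < (1 + t) ^ xC := by positivity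
  have hp2 : p ^ 2 ≤ S * w := pp.trans pe
  refine ⟨?_, ?_, ?_, ?_⟩
  · unfold Dat.psi
    refine (abs_sub _ _).trans ?_
    rw [abs_mul, abs_mul, abs_mul, abs_mul, abs_two, abs_pow, abs_of_pos hd]
    calc _ ≤ 2 * (A * δ * ((1 + t) ^ xA * p)) * (B * δ * ((1 + t) ^ xF * p)) + 2 * P.d₁ * (C * δ * ((1 + t) ^ xE * p)) ^ 2 := by gcongr
      _ = 2 * A * B * δ ^ 2 * ((1 + t) ^ xA * (1 + t) ^ xF) * p ^ 2 + 2 * P.d₁ * C ^ 2 * δ ^ 2 * ((1 + t) ^ xE * (1 + t) ^ xE) * p ^ 2 := by ring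
      _ ≤ 2 * A * B * δ * (1 + t) ^ xD * (S * w) + 2 * P.d₁ * C ^ 2 * δ * (1 + t) ^ xD * (S * w) := by
        rw [e1, e2]; gcongr
      _ = (2 * A * B + 2 * P.d₁ * C ^ 2) * S * δ * (1 + t) ^ xD * w := by ring
      _ ≤ _ := by gcongr
  · rw [abs_pow]
    calc _ ≤ (A * δ * ((1 + t) ^ xA * p)) ^ 2 := by gcongr
      _ = A ^ 2 * δ ^ 2 * ((1 + t) ^ xA) ^ 2 * p ^ 2 := by ring
      _ ≤ A ^ 2 * δ * 1 ^ 2 * (S * w) := by gcongr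
      _ = A ^ 2 * S * δ * w := by ring
      _ ≤ _ := by gcongr
  · intro h0
    subst h0
    have e : D.v 0 x = D.v₀ x := by
      rw [D.v_eq le_rfl]; unfold Dat.vh Vh; rw [CV_zero, E0, Ar_zero, TT_zero]; simp
    rw [e]
    have := data_prof hδ hl3 D.bv x
    rw [sub_zero] at this
    calc _ ≤ δ * p := this
      _ ≤ δ * (S * w) := by gcongr
      _ = 1 * S * δ * w := by ring
      _ ≤ _ := by gcongr
  · unfold Dat.ph1
    rw [abs_mul, abs_mul, abs_two]
    calc _ ≤ 2 * (A * δ * ((1 + t) ^ xA * p)) * (C * δ * ((1 + t) ^ xE * p)) := by gcongr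
      _ = 2 * A * C * δ ^ 2 * ((1 + t) ^ xA * (1 + t) ^ xE) * p ^ 2 := by ring
      _ ≤ 2 * A * C * δ * (1 + t) ^ xC * 1 := by rw [e3]; gcongr; exact pp.trans p1
      _ = (2 * A * C) * 1 * δ * (1 + t) ^ xC := by ring
      _ ≤ _ := by gcongr

lemma om_bound (P : Par) (M : ℝ) (h : |P.α| * P.η ≤ cc P.d₁ M) : ∃ C > 0, ∀ δ (D : Dat P M δ), (∀ t x, |D.u t x| ≤ 1) → ∀ (t x : ℝ), 0 ≤ t →
    |D.om t x| ≤ C * δ * (fk P.K (t + 2 * x / P.c) + (1 + t) ^ xC) := by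
  obtain ⟨C, hC, hp⟩ := psi_bound P M h
  obtain ⟨V, hV, hv⟩ := v_bound P M h
  obtain ⟨hρ, hk⟩ := P.ρ_spec
  have hc := P.hc
  have hd := P.hd₂
  have hK : 1 ≤ P.K := le_max_left _ _
  have hK0 : 0 < P.K := by linarith
  have hK2 : 9 * (4 * P.d₂ / P.c ^ 2) ≤ 2 * P.K := by
    have : 18 * P.d₂ / P.c ^ 2 ≤ P.K := le_max_right _ _
    calc _ = 2 * (18 * P.d₂ / P.c ^ 2) := by ring
      _ ≤ _ := by linarith
  obtain ⟨c₂, hc₂, hf⟩ := f_lo hc hK hρ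
  set ρ := P.ρ
  set K := P.K
  set A := 7 / 4 + P.d₂ * ρ ^ 2 with hA
  have hA0 : 0 < A := by positivity
  set b₂ := |P.γ| * C * (2 / P.c) * (4 / (P.c * ρ)) with hb₂
  have hb₂0 : 0 ≤ b₂ := by positivity
  set b₁ := b₂ * A * (8 / 5) / c₂ + 2 * (C + |P.γ| * C * (2 / P.c)) / c₂ with hb₁
  have hb₁0 : 0 < b₁ := by positivity
  refine ⟨b₁ + b₂, by positivity, fun δ D h1 => ?_⟩
  have hδ := D.hδ
  have hL : ∀ t x, 0 ≤ t → |P.γ * Lc P.c (fun y => D.psi t (x - P.κ * y))| ≤ b₂ * δ * (P.c * ρ / 4 * ((1 + t) ^ xD * eX (-ρ * |x * (1 + t) ^ xA|))) := by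
    intro t x ht
    have := Lc_prof hc hρ hk (by positivity) (half_le_one ht) (by positivity) (fun x => (hp δ D t x ht).1) x
    rw [abs_mul]
    refine (mul_le_mul_of_nonneg_left this (abs_nonneg _)).trans_eq ?_
    rw [hb₂]; field_simp
  have key : ∀ σ : ℝ, |σ| ≤ 1 → ∀ T, 0 ≤ T → ∀ x, σ * D.om T x - (b₁ * δ * fk K (T + 2 * x / P.c) + b₂ * δ * Gs ρ T x) ≤ 0 := by
    intro σ hσ T hT
    have hcf : Continuous (fk K) := continuous_iff_continuousAt.2 fun s => (fk_d hK0 s).continuousAt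
    have hct : Continuous (th ρ) := continuous_iff_continuousAt.2 fun s => (th_d ρ s).continuousAt
    have lin : ∀ t x : ℝ, HasDerivAt (fun x : ℝ => t + 2 * x / P.c) (2 / P.c) x := fun t x => by
      simpa using (((hasDerivAt_id x).const_mul 2).div_const P.c).const_add t
    refine fun x => maxp (T := T) (P := 0) (c := P.c) (C := V * δ + |P.γ| * (C * δ * (2 / P.c))) hd
      (z := fun t x => σ * D.om t x - (b₁ * δ * fk K (t + 2 * x / P.c) + b₂ * δ * Gs ρ t x))
      (zt := fun t x => σ * D.omt t x - (b₁ * δ * fk1 K (t + 2 * x / P.c) + b₂ * δ * Gst ρ t x))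
      (zx := fun t x => σ * D.omx t x - (b₁ * δ * (fk1 K (t + 2 * x / P.c) * (2 / P.c)) + b₂ * δ * Gsx ρ t x))
      (zxx := fun t x => σ * D.omxx t x - (b₁ * δ * (fk2 K (t + 2 * x / P.c) * (2 / P.c) * (2 / P.c)) + b₂ * δ * Gsxx ρ t x))
      ?_ ?_ ?_ ?_ ?_ ?_ ?_ T ⟨hT, le_rfl⟩ x
    · have hom := D.om_cont h1
      have hr : ∀ q : ℝ, ContinuousOn (fun p : ℝ × ℝ => (1 + p.1) ^ q) (Icc 0 T ×ˢ univ) := fun q =>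
        ContinuousOn.rpow_const (by fun_prop) fun p hp => Or.inl (by have := hp.1.1; linarith)
      have hom' : Continuous fun p : ℝ × ℝ => D.om p.1 p.2 := hom
      have hff : Continuous fun p : ℝ × ℝ => fk K (p.1 + 2 * p.2 / P.c) := hcf.comp (by fun_prop)
      refine ((hom'.const_mul σ).continuousOn).sub (((hff.const_mul _).continuousOn).add (continuousOn_const.mul ((hr _).mul ?_)))
      exact hct.comp_continuousOn (continuousOn_snd.mul (hr _))
    · intro t ht x
      have i1 := (hv δ D t ht.1).1 x
      have i2 := half_le_one ht.1
      have i3 := Lc_prof (w := 0) (B := C * δ) hc hρ hk le_rfl zero_le_one (by positivity) (h := fun x => D.u t x ^ 2) (fun x => by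
        have := (hp δ D t x ht.1).2.1
        refine this.trans (mul_le_mul_of_nonneg_left ?_ (by positivity))
        simp only [mul_zero, abs_zero, Real.exp_zero]
        exact Real.exp_le_one_iff.2 (by have := abs_nonneg (x * (1 + t) ^ xA); nlinarith)) x
      have i4 : |D.om t x| ≤ V * δ + |P.γ| * (C * δ * (2 / P.c)) := by
        unfold Dat.om
        refine (abs_add_le _ _).trans (add_le_add (i1.trans (mul_le_of_le_one_right (by positivity) i2)) ?_)
        rw [abs_mul]
        simp only [mul_zero, abs_zero, Real.exp_zero, mul_one] at i3
        gcongr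
      have i5 : σ * D.om t x ≤ |D.om t x| := by
        refine (le_abs_self _).trans ?_
        rw [abs_mul]; exact mul_le_of_le_one_left (abs_nonneg _) hσ
      have i6 := fk_pos hK0 (t + 2 * x / P.c)
      have i7 : 0 < Gs ρ t x := by
        have := th_pos ρ (x * (1 + t) ^ xA); have := ht.1; unfold Gs; positivity
      have : 0 ≤ b₁ * δ * fk K (t + 2 * x / P.c) + b₂ * δ * Gs ρ t x := by positivity
      linarith
    · intro x
      have i1 := (hp δ D 0 x le_rfl).2.2.1 rfl
      have i3 := Lc_prof (w := (1 + 0) ^ xA) (B := C * δ) hc hρ hk (by positivity) (half_le_one le_rfl) (by positivity) (h := fun x => D.u 0 x ^ 2) (fun x => (hp δ D 0 x le_rfl).2.1) x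
      have i4 := hf 0 x le_rfl
      have i5 := (th_lo hρ (x * (1 + 0) ^ xA)).1
      set w := eX (-ρ * |x * (1 + 0) ^ xA|)
      have hw : 0 < w := Real.exp_pos _
      have i6 := fk_pos hK0 (0 + 2 * x / P.c)
      have i7 : 0 < Gs ρ 0 x := by
        have := th_pos ρ (x * (1 + 0) ^ xA); unfold Gs; positivity
      have i8 : c₂ * (1 / 2 * w) ≤ fk K (0 + 2 * x / P.c) := by
        have j1 : (Rk K (0 + 2 * x / P.c))⁻¹ ≤ 1 := inv_le_one_of_one_le₀ (hK.trans (Rk_ge hK0 _))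
        have j2 := mul_le_of_le_one_right i6.le j1
        have j3 : ((1:ℝ) + 0) ^ xG = 1 := by simp
        rw [j3, one_mul] at i4
        exact (mul_le_mul_of_nonneg_left i5 hc₂.le).trans (i4.trans j2)
      have i9 : |D.om 0 x| ≤ (C + |P.γ| * C * (2 / P.c)) * δ * w := by
        unfold Dat.om
        refine (abs_add_le _ _).trans ?_
        rw [abs_mul]
        refine (add_le_add i1 (mul_le_mul_of_nonneg_left i3 (abs_nonneg _))).trans_eq (by ring)
      have i10 : σ * D.om 0 x ≤ |D.om 0 x| := by
        refine (le_abs_self _).trans ?_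
        rw [abs_mul]; exact mul_le_of_le_one_left (abs_nonneg _) hσ
      have i11 : (C + |P.γ| * C * (2 / P.c)) * δ * w ≤ b₁ * δ * fk K (0 + 2 * x / P.c) := by
        calc _ = (2 * (C + |P.γ| * C * (2 / P.c)) / c₂) * δ * (c₂ * (1 / 2 * w)) := by field_simp
          _ ≤ _ := by
            gcongr
            rw [hb₁]; have : 0 ≤ b₂ * A * (8 / 5) / c₂ := by positivity
            linarith
      have : 0 ≤ b₂ * δ * Gs ρ 0 x := by positivity
      linarith
    · intro t ht x
      have := (fk_d hK0 (t + 2 * x / P.c)).comp t ((hasDerivAt_id t).add_const (2 * x / P.c))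
      simp only [mul_one] at this
      exact ((D.om_dt h1 ht.1 x).const_mul σ).sub ((this.const_mul _).add ((Gs_dt ht.1.le ρ x).const_mul _))
    · intro t ht x
      exact ((D.om_dx h1 ht.1 x).const_mul σ).sub ((((fk_d hK0 (t + 2 * x / P.c)).comp x (lin t x)).const_mul _).add ((Gs_dx ht.1.le ρ x).const_mul _))
    · intro t ht x
      exact ((D.om_dxx h1 ht.1 x).const_mul σ).sub (((((fk1_d hK0 (t + 2 * x / P.c)).comp x (lin t x)).mul_const (2 / P.c)).const_mul _).add ((Gs_dxx ht.1.le ρ x).const_mul _))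
    · intro t ht x _
      have ht0 := ht.1.le
      have hτ : 0 < 1 + t := by linarith
      have n1 := fk_N (a := 4 * P.d₂ / P.c ^ 2) hK0 (by positivity) hK2 (t + 2 * x / P.c)
      have n2 := Gs_N hc hd hρ ht0 x
      have n3 := hf t x ht0
      have n4 := hL t x ht0
      have n5 := D.om_eq h1 ht.1 x
      rw [n5]
      have n6 : σ * (P.γ * Lc P.c (fun y => D.psi t (x - P.κ * y))) ≤ |P.γ * Lc P.c (fun y => D.psi t (x - P.κ * y))| := by
        refine (le_abs_self _).trans ?_
        rw [abs_mul]; exact mul_le_of_le_one_left (abs_nonneg _) hσ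
      set Q := (1 + t) ^ xG * th ρ (x * (1 + t) ^ xA)
      have hQ : 0 < Q := mul_pos (by positivity) (th_pos _ _)
      have n7 : b₂ * A * Q ≤ b₁ * (-fk1 K (t + 2 * x / P.c) - 4 * P.d₂ / P.c ^ 2 * fk2 K (t + 2 * x / P.c)) := by
        calc _ = (b₂ * A * (8 / 5) / c₂) * (5 / 8 * (c₂ * Q)) := by field_simp
          _ ≤ b₁ * (5 / 8 * (c₂ * Q)) := by
            gcongr
            rw [hb₁]; have : 0 ≤ 2 * (C + |P.γ| * C * (2 / P.c)) / c₂ := by positivity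
            linarith
          _ ≤ b₁ * (5 / 8 * (fk K (t + 2 * x / P.c) * (Rk K (t + 2 * x / P.c))⁻¹)) := by gcongr
          _ ≤ _ := by gcongr
      have n8 := mul_le_mul_of_nonneg_left n2 (by positivity : 0 ≤ b₂ * δ)
      have n9 := mul_le_mul_of_nonneg_left n7 hδ.le
      have n10 : P.c * (fk1 K (t + 2 * x / P.c) * (2 / P.c)) = 2 * fk1 K (t + 2 * x / P.c) := by field_simp
      linear_combination n8 + n9 + n4 + n6 + (b₁ * δ) * n10
  intro t x ht
  have hτ : 0 < 1 + t := by linarith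
  have k1 := key 1 (by norm_num) t ht x
  have k2 := key (-1) (by norm_num) t ht x
  have k3 : Gs ρ t x ≤ (1 + t) ^ xC := mul_le_of_le_one_right (by positivity) (th_le1 _ _)
  have k4 := fk_pos hK0 (t + 2 * x / P.c)
  have k5 : b₁ * δ * fk K (t + 2 * x / P.c) + b₂ * δ * Gs ρ t x ≤ (b₁ + b₂) * δ * (fk K (t + 2 * x / P.c) + (1 + t) ^ xC) := by
    have l1 := mul_le_mul_of_nonneg_left k3 (by positivity : 0 ≤ b₂ * δ)
    have l2 : 0 ≤ b₁ * δ * (1 + t) ^ xC := by positivity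
    have l3 : 0 ≤ b₂ * δ * fk K (t + 2 * x / P.c) := by positivity
    linarith
  rw [abs_le]; constructor <;> linarith

lemma quot_lo {c t x : ℝ} (hc : 0 < c) (ht : 0 ≤ t) (hx : x < -(c / 4 * t)) :
    (2 + 32 / c ^ 2)⁻¹ ≤ ((1 + t) + x ^ 2) / ((1 + t) ^ 2 + x ^ 2) := by
  rw [le_div_iff₀ (by positivity), inv_mul_le_iff₀ (by positivity)]
  have t1 : (c / 4 * t) ^ 2 ≤ x ^ 2 := by
    have : 0 ≤ c / 4 * t := by positivity
    nlinarith
  have t2 : t ^ 2 ≤ 16 / c ^ 2 * x ^ 2 := by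
    calc _ = 16 / c ^ 2 * (c / 4 * t) ^ 2 := by field_simp; norm_num
      _ ≤ _ := by gcongr
  have t3 : 0 ≤ 32 / c ^ 2 * (1 + t) := by positivity
  have t4 : (1 + t) ^ 2 ≤ 2 + 2 * t ^ 2 := by nlinarith [sq_nonneg (t - 1)]
  linear_combination t3 + t4 + 2 * t2 + 2 * ht + sq_nonneg x

lemma clip (P : Par) (M : ℝ) (h : |P.α| * P.η ≤ cc P.d₁ M) : ∃ δ₀ > 0, ∀ δ (D : Dat P M δ), δ ≤ δ₀ →
    (∀ t x, |D.u t x| ≤ 1) ∧ ∀ t x, 0 ≤ t → D.g t x = (P.α * (D.v t x + P.γ / P.c * D.u t x ^ 2) - P.μ * D.u t x ^ 2) * D.u t x := by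
  obtain ⟨A, hA, hu⟩ := u_bound P M h
  obtain ⟨B, hB, hp⟩ := psi_bound P M h
  obtain ⟨V, hV, hv⟩ := v_bound P M h
  obtain ⟨C, hC, ho⟩ := om_bound P M h
  have hc := P.hc
  have hη := P.hη
  have hK : 1 ≤ P.K := le_max_left _ _
  obtain ⟨X, hX⟩ : ∃ X, X = C * (2 ^ (5/4:ℝ) + 1) + |P.γ * P.κ / P.c| * (B * (2 / P.c)) := ⟨_, rfl⟩
  obtain ⟨Y, hY⟩ : ∃ Y, Y = V + |P.γ / P.c| * A ^ 2 := ⟨_, rfl⟩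
  obtain ⟨q, hq⟩ : ∃ q, q = (2 + 32 / P.c ^ 2)⁻¹ := ⟨_, rfl⟩
  have X0 : 0 < X := by rw [hX]; positivity
  have Y0 : 0 < Y := by rw [hY]; positivity
  have q0 : 0 < q := by rw [hq]; positivity
  refine ⟨min A⁻¹ (min (P.η / X) (P.η * q / Y)), by positivity, fun δ D hδ0 => ?_⟩
  have hδ := D.hδ
  have dA : δ ≤ A⁻¹ := hδ0.trans (min_le_left _ _)
  have dX : δ ≤ P.η / X := hδ0.trans ((min_le_right _ _).trans (min_le_left _ _))
  have dY : δ ≤ P.η * q / Y := hδ0.trans ((min_le_right _ _).trans (min_le_right _ _))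
  rw [← one_div, le_div_iff₀ hA] at dA
  rw [le_div_iff₀ X0] at dX
  rw [le_div_iff₀ Y0] at dY
  have hl : 0 ≤ (mp P.d₁ M)⁻¹ := by
    obtain ⟨hl, -, hl2, -⟩ := lm_spec P D.hM
    by_contra hh
    push Not at hh
    linarith
  have ub : ∀ t x, 0 ≤ t → |D.u t x| ≤ A * δ * (1 + t) ^ xA := by
    intro t x ht
    refine (hu δ D t x ht).trans (mul_le_mul_of_nonneg_left ?_ (by positivity))
    exact mul_le_of_le_one_right (by positivity) (Pf_le_one hl ht x)
  have h1 : ∀ t x, |D.u t x| ≤ 1 := by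
    intro t x
    have e : D.u t x = D.u (tp t) x := by
      rw [D.hfix t, D.hfix (tp t), Uop, Uop, tp_of (tp_nonneg t)]
    rw [e]
    refine (ub _ x (tp_nonneg t)).trans ?_
    have := half_le_one (tp_nonneg t)
    calc _ ≤ A * δ * 1 := by gcongr
      _ ≤ 1 := by linarith
  refine ⟨h1, fun t x ht => ?_⟩
  have hw : |D.v t x + P.γ / P.c * D.u t x ^ 2| ≤ Wf P.η t x := by
    have hτ : 0 < 1 + t := by linarith
    have e1 := rp hτ (show -(1/4:ℝ) + -1 = -(5/4) by norm_num)
    unfold Wf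
    rw [ta_of ht]
    have den : 0 < (1 + t) ^ 2 + x ^ 2 := by positivity
    rcases le_or_gt (-(P.c / 4 * t)) x with hx | hx
    · have s1 := ho δ D h1 t x ht
      have s2 := fk_up hc hK ht hx
      have s3 := Lc_le (a := 0) (B := B * δ * (1 + t) ^ xC) hc (by positivity) (h := fun y => D.ph1 t (x - P.κ * y)) (fun y _ => by
        rw [zero_mul, Real.exp_zero, mul_one]; exact (hp δ D t _ ht).2.2.2) (by positivity)
      have s4 : (1 + t) ^ (-1:ℝ) ≤ ((1 + t) + x ^ 2) / ((1 + t) ^ 2 + x ^ 2) := by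
        rw [Real.rpow_neg_one, ← one_div, div_le_div_iff₀ hτ den]; nlinarith [mul_nonneg ht (sq_nonneg x)]
      rw [D.om_w h1]
      refine (abs_add_le _ _).trans ?_
      rw [abs_mul]
      calc _ ≤ C * δ * (2 ^ (5/4:ℝ) * (1 + t) ^ xC + (1 + t) ^ xC) + |P.γ * P.κ / P.c| * (B * δ * (1 + t) ^ xC * (2 / P.c)) := by
            refine add_le_add (s1.trans ?_) (mul_le_mul_of_nonneg_left s3 (abs_nonneg _))
            gcongr
        _ = δ * X * (1 + t) ^ xC := by rw [hX]; ring
        _ ≤ P.η * (1 + t) ^ xC := by gcongr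
        _ = P.η * (1 + t) ^ xB * (1 + t) ^ (-1:ℝ) := by rw [← e1]; ring
        _ ≤ _ := by gcongr
    · have s1 := (hv δ D t ht).1 x
      have s2 := ub t x ht
      have r1 : (1 + t) ^ xA ≤ (1 + t) ^ xB := Real.rpow_le_rpow_of_exponent_le (by linarith) (by norm_num)
      have r2 := half_le_one ht
      have r0 : 0 < (1 + t) ^ xA := by positivity
      have hδ2 : δ ^ 2 ≤ δ := by nlinarith [D.hδ1]
      have s4 : q ≤ ((1 + t) + x ^ 2) / ((1 + t) ^ 2 + x ^ 2) := hq ▸ quot_lo hc ht hx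
      refine (abs_add_le _ _).trans ?_
      rw [abs_mul, abs_pow]
      calc _ ≤ V * δ * (1 + t) ^ xA + |P.γ / P.c| * (A * δ * (1 + t) ^ xA) ^ 2 := by gcongr
        _ = V * δ * (1 + t) ^ xA + |P.γ / P.c| * A ^ 2 * δ ^ 2 * ((1 + t) ^ xA * (1 + t) ^ xA) := by ring
        _ ≤ V * δ * (1 + t) ^ xB + |P.γ / P.c| * A ^ 2 * δ * (1 * (1 + t) ^ xB) := by gcongr
        _ = δ * Y * (1 + t) ^ xB := by rw [hY]; ring
        _ ≤ P.η * q * (1 + t) ^ xB := by gcongr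
        _ = P.η * (1 + t) ^ xB * q := by ring
        _ ≤ _ := by gcongr
  unfold Dat.g gF
  rw [cl_of (h1 t x)]
  have : Vop P D.v₀ D.u t x = D.v t x := rfl
  rw [this, cl_of hw]

lemma u_int (P : Par) (M : ℝ) (h : |P.α| * P.η ≤ cc P.d₁ M) : ∃ C > 0, ∀ δ (D : Dat P M δ) (t : ℝ), 0 ≤ t →
    (∀ x, |D.u t x| ≤ C * δ * (1 + t) ^ xA) ∧ Integrable (D.u t) ∧ ∫ x, |D.u t x| ≤ C * δ := by
  by_cases hM : 1 ≤ M
  swap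
  · exact ⟨1, one_pos, fun δ D => absurd D.hM hM⟩
  obtain ⟨A, hA, hu⟩ := u_bound P M h
  obtain ⟨hl0, -, hl2, -⟩ := lm_spec P hM
  have hl : 0 < (mp P.d₁ M)⁻¹ := hl0.trans_le hl2
  set l := (mp P.d₁ M)⁻¹
  refine ⟨A * (1 + Real.sqrt (Real.pi / l)), by positivity, fun δ D t ht => ?_⟩
  have hδ := D.hδ
  have hτ : 0 < 1 + t := by linarith
  have hs : 0 ≤ Real.sqrt (Real.pi / l) := Real.sqrt_nonneg _
  have r0 : 0 < (1 + t) ^ xA := by positivity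
  have e1 := rp hτ (show -(1/2:ℝ) + 1/2 = 0 by norm_num)
  rw [Real.rpow_zero] at e1
  obtain ⟨i1, i2⟩ := Pf_int hl ht 0
  simp only [add_zero] at i1 i2
  have i3 := (i1.const_mul ((1 + t) ^ xA)).const_mul (A * δ)
  have iu : Integrable (D.u t) := i3.mono' (D.u_GC.sec t).aestronglyMeasurable (eO fun x => hu δ D t x ht)
  refine ⟨fun x => ?_, iu, ?_⟩
  · refine (hu δ D t x ht).trans ?_
    have := Pf_le_one hl.le ht x
    calc _ ≤ A * δ * ((1 + t) ^ xA * 1) := by gcongr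
      _ = A * 1 * δ * (1 + t) ^ xA := by ring
      _ ≤ _ := by gcongr; linarith
  · refine (integral_mono iu.abs i3 fun x => hu δ D t x ht).trans ?_
    simp only [integral_const_mul]
    rw [i2]
    calc _ = A * Real.sqrt (Real.pi / l) * δ * ((1 + t) ^ xA * (1 + t) ^ (1/2:ℝ)) := by ring
      _ = A * Real.sqrt (Real.pi / l) * δ := by rw [e1, mul_one]
      _ ≤ _ := by gcongr; linarith

lemma wrap {P : Par} {M δ : ℝ} (D : Dat P M δ) (h1 : ∀ t x, |D.u t x| ≤ 1)
    (hg : ∀ t x, 0 ≤ t → D.g t x = (P.α * (D.v t x + P.γ / P.c * D.u t x ^ 2) - P.μ * D.u t x ^ 2) * D.u t x)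
    {e c₁ c₂ β γ B : ℝ} {u₀ v₀ : ℝ → ℝ} (he : e * e = 1) (hc : P.c = e * (c₂ - c₁)) (hγ : P.γ = e * γ)
    (hβ : P.α * (P.γ / P.c) - P.μ = β) (hu : ∀ x, D.u₀ (e * x) = u₀ x) (hv : ∀ x, D.v₀ (e * x) = v₀ x)
    (hb : ∀ t x, 0 ≤ t → |D.u t x| + |D.v t x| ≤ B) :
    IsClassicalSolution P.d₁ P.d₂ c₁ c₂ (fun p : ℝ × ℝ => P.α * p.1 * p.2 + β * p.1 ^ 3) (fun _ : ℝ × ℝ => 0)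
      (fun _ : ℝ × ℝ => 0) (fun p : ℝ × ℝ => γ * p.1 ^ 2) ⊤ u₀ v₀
      (fun x t => D.u t (e * x + e * c₁ * t)) (fun x t => D.v t (e * x + e * c₁ * t)) := by
  have lin : ∀ t x : ℝ, HasDerivAt (fun x : ℝ => e * x + e * c₁ * t) e x := fun t x => by
    simpa using ((hasDerivAt_id x).const_mul e).add_const (e * c₁ * t)
  have hm : Continuous fun p : ℝ × ℝ => (p.2, e * p.1 + e * c₁ * p.2) := by fun_prop
  have cA : ∀ {f : ℝ → ℝ → ℝ}, (∀ t, 0 < t → ∀ x, ContinuousAt (fun p : ℝ × ℝ => f p.1 p.2) (t, x)) →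
      ContinuousOn (fun p : ℝ × ℝ => f p.2 (e * p.1 + e * c₁ * p.2)) {p : ℝ × ℝ | 0 < p.2 ∧ ENNReal.ofReal p.2 < ⊤} := by
    intro f hf p hp
    exact (ContinuousAt.comp (x := p) (f := fun p : ℝ × ℝ => (p.2, e * p.1 + e * c₁ * p.2)) (g := fun p : ℝ × ℝ => f p.1 p.2)
      (hf p.2 hp.1 _) hm.continuousAt).continuousWithinAt
  have cux : ∀ t, 0 < t → ∀ x, ContinuousAt (fun p : ℝ × ℝ => D.ux p.1 p.2) (t, x) := fun t _ x => D.ux_GC.1.continuousAt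
  have cut : ∀ t, 0 < t → ∀ x, ContinuousAt (fun p : ℝ × ℝ => P.d₁ * D.uxx p.1 p.2 + D.g p.1 p.2) (t, x) := fun t ht x =>
    ((D.uxx_contAt ht x).const_mul _).add D.g_GC.1.continuousAt
  refine ⟨fun x => ?_, fun x => ?_, ?_, fun t₁ _ _ => ⟨B, fun x t ht _ => hb t _ ht⟩, ?_⟩
  · simp only [mul_zero, add_zero]
    rw [D.u_eq le_rfl, Md_zero, hu]
  · simp only [mul_zero, add_zero]
    rw [D.v_eq le_rfl]; unfold Dat.vh Vh; rw [CV_zero, E0, Ar_zero, TT_zero]; simp [hv]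
  · exact ((D.hu.comp hm).prodMk (D.v_cont.comp hm)).continuousOn
  refine ⟨fun x t => (P.d₁ * D.uxx t (e * x + e * c₁ * t) + D.g t (e * x + e * c₁ * t)) + e * c₁ * D.ux t (e * x + e * c₁ * t),
    fun x t => D.vt t (e * x + e * c₁ * t) + e * c₁ * D.vx t (e * x + e * c₁ * t),
    fun x t => D.ux t (e * x + e * c₁ * t) * e, fun x t => D.vx t (e * x + e * c₁ * t) * e,
    fun x t => D.uxx t (e * x + e * c₁ * t) * e * e, fun x t => D.vxx t (e * x + e * c₁ * t) * e * e,
    fun _ _ => 0, fun x t => γ * (2 * D.u t (e * x + e * c₁ * t) * (D.ux t (e * x + e * c₁ * t) * e)), fun x t ht _ => ?_, ?_⟩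
  · have a1 := (D.u_dx t (e * x + e * c₁ * t)).comp x (lin t x)
    have a2 := ((D.u_dxx ht (e * x + e * c₁ * t)).comp x (lin t x)).mul_const e
    have a3 := ((D.v_dxx ht (e * x + e * c₁ * t)).comp x (lin t x)).mul_const e
    refine ⟨chain (f := D.u) (ft := fun t x => P.d₁ * D.uxx t x + D.g t x) (fx := D.ux) ht (fun t ht x => D.u_dt ht x) (fun t _ x => D.u_dx t x) (cut t ht _) (cux t ht _),
      a1, a2, hasDerivAt_const _ _,
      chain (f := D.v) (ft := D.vt) (fx := D.vx) ht (fun t ht x => D.v_dt h1 ht x) (fun t ht x => D.v_dx h1 ht x) (D.vt_c ht _) (D.vx_c ht _),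
      (D.v_dx h1 ht (e * x + e * c₁ * t)).comp x (lin t x), a3, ?_, ?_, ?_⟩
    · exact ((a1.pow 2).const_mul γ).congr_deriv (by simp)
    · simp only
      rw [hg t _ ht.le, ← hβ, mul_assoc _ e e, he]; ring
    · simp only [Dat.vt]
      rw [hc, hγ, mul_assoc _ e e, he]; ring
  · exact ((cA (f := fun t x => P.d₁ * D.uxx t x + D.g t x) cut).add ((cA cux).const_mul (e * c₁))).prodMk <| ((cA cux).mul_const e).prodMk <| (((cA fun t ht x => D.uxx_contAt ht x).mul_const e).mul_const e).prodMk <|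
      ((cA fun t ht x => D.vt_c ht x).add ((cA fun t ht x => D.vx_c ht x).const_mul (e * c₁))).prodMk <| ((cA fun t ht x => D.vx_c ht x).mul_const e).prodMk <|
      ((cA fun t ht x => D.vxx_c ht x).mul_const e).mul_const e

/-- Theorem 1.7: global existence and decay for the system
`u_t = d₁ u_xx + c₁ u_x + α u v + β u³`, `v_t = d₂ v_xx + c₂ v_x + γ ∂_x(u²)`
under the sign condition `β − γα/(c₂−c₁) < 0`. The weighted-supremum smallness
condition (1.11) is expressed through the existence of bounds `a`, `b`, `k` on the
weighted suprema whose combination with the `H²` norm is less than `δ`. -/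
theorem global_existence_burgers_compensation
    (d₁ d₂ c₁ c₂ α β γ : ℝ) (hd₁ : 0 < d₁) (hd₂ : 0 < d₂) (hc : c₁ ≠ c₂)
    (hsign : β - γ * α / (c₂ - c₁) < 0) :
    ∃ M₀ : ℝ, 1 ≤ M₀ ∧
      ∀ M : ℝ, M₀ ≤ M → ∀ ε : ℝ, 0 < ε → ∃ δ : ℝ, 0 < δ ∧
        ∀ u₀ v₀ : ℝ → ℝ,
          ContDiff ℝ 2 u₀ → ContDiff ℝ 2 v₀ →
          Integrable (fun x : ℝ => (u₀ x) ^ 2) →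
          Integrable (fun x : ℝ => (deriv u₀ x) ^ 2) →
          Integrable (fun x : ℝ => (deriv (deriv u₀) x) ^ 2) →
          Integrable (fun x : ℝ => (v₀ x) ^ 2) →
          Integrable (fun x : ℝ => (deriv v₀ x) ^ 2) →
          Integrable (fun x : ℝ => (deriv (deriv v₀) x) ^ 2) →
          (∃ a b k : ℝ,
            (∀ x : ℝ, |v₀ x| * Real.exp (x ^ 2 / M) ≤ a) ∧
            (∀ x : ℝ, |u₀ x| * Real.exp (x ^ 2 / M) ≤ b) ∧
            (∀ x : ℝ, |deriv u₀ x| * Real.exp (x ^ 2 / M) ≤ k) ∧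
            Real.sqrt ((∫ x : ℝ, (u₀ x) ^ 2) + (∫ x : ℝ, (deriv u₀ x) ^ 2) +
                (∫ x : ℝ, (deriv (deriv u₀) x) ^ 2) + (∫ x : ℝ, (v₀ x) ^ 2) +
                (∫ x : ℝ, (deriv v₀ x) ^ 2) + (∫ x : ℝ, (deriv (deriv v₀) x) ^ 2)) +
              a + Real.sqrt (M * Real.pi) * b + k < δ) →
          ∃ u v : ℝ → ℝ → ℝ,
            IsClassicalSolution d₁ d₂ c₁ c₂
              (fun p : ℝ × ℝ => α * p.1 * p.2 + β * p.1 ^ 3)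
              (fun _ : ℝ × ℝ => 0)
              (fun _ : ℝ × ℝ => 0)
              (fun p : ℝ × ℝ => γ * p.1 ^ 2) ⊤ u₀ v₀ u v ∧
            ∀ t : ℝ, 0 ≤ t →
              (∀ x : ℝ, |u x t| + |v x t| ≤ ε / Real.sqrt (1 + t)) ∧
              Integrable (fun x : ℝ => |u x t| + |v x t|) ∧
              (∫ x : ℝ, (|u x t| + |v x t|)) ≤ ε := by
  obtain ⟨e, he, he1, hce⟩ : ∃ e : ℝ, e * e = 1 ∧ |e| = 1 ∧ 0 < e * (c₂ - c₁) := by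
    rcases lt_or_gt_of_ne hc with h | h
    · exact ⟨1, by norm_num, by norm_num, by linarith⟩
    · exact ⟨-1, by norm_num, by norm_num, by linarith⟩
  have he0 : e ≠ 0 := by rintro rfl; norm_num at he
  have hes : ∀ x : ℝ, (e * x) ^ 2 = x ^ 2 := fun x => by rw [mul_pow, pow_two e, he, one_mul]
  have hee : ∀ x : ℝ, e * (e * x) = x := fun x => by rw [← mul_assoc, he, one_mul]
  refine ⟨1, le_rfl, fun M hM ε hε => ?_⟩
  have hcc : 0 < cc d₁ M := by unfold cc mp; positivity
  have ha : 0 < 1 + |α| := by positivity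
  let P : Par :=
    { d₁ := d₁, d₂ := d₂, c := e * (c₂ - c₁), α := α, γ := e * γ, μ := γ * α / (c₂ - c₁) - β, η := cc d₁ M / (1 + |α|)
      hd₁ := hd₁, hd₂ := hd₂, hc := hce, hμ := by linarith, hη := by positivity
      hη1 := by
        rw [div_le_one ha]
        exact (min_le_left _ _).trans (by linarith [abs_nonneg α]) }
  have hP : |P.α| * P.η ≤ cc P.d₁ M := by
    change |α| * (cc d₁ M / (1 + |α|)) ≤ cc d₁ M
    rw [mul_div_assoc', div_le_iff₀ ha]; nlinarith
  obtain ⟨δ₀, hδ₀, hcl⟩ := clip P M hP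
  obtain ⟨U, hU, hu⟩ := u_int P M hP
  obtain ⟨V, hV, hv⟩ := v_bound P M hP
  obtain ⟨δ, hδ⟩ : ∃ δ, δ = min 1 (min δ₀ (ε / (U + V))) := ⟨_, rfl⟩
  have hδ0 : 0 < δ := by rw [hδ]; positivity
  have hδ1 : δ ≤ 1 := by rw [hδ]; exact min_le_left _ _
  have hδ2 : δ ≤ δ₀ := by rw [hδ]; exact (min_le_right _ _).trans (min_le_left _ _)
  have hδ3 : (U + V) * δ ≤ ε := by
    rw [← le_div_iff₀' (by positivity), hδ]; exact (min_le_right _ _).trans (min_le_right _ _)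
  refine ⟨δ, hδ0, fun u₀ v₀ cu cv _ _ _ _ _ _ ⟨a, b, k, ba, bb, bk, hs⟩ => ?_⟩
  have a0 : 0 ≤ a := (by positivity : (0:ℝ) ≤ _).trans (ba 0)
  have b0 : 0 ≤ b := (by positivity : (0:ℝ) ≤ _).trans (bb 0)
  have k0 : 0 ≤ k := (by positivity : (0:ℝ) ≤ _).trans (bk 0)
  have s1 : 1 ≤ Real.sqrt (M * Real.pi) := Real.one_le_sqrt.2 (by nlinarith [Real.pi_gt_three])
  have s2 : b ≤ Real.sqrt (M * Real.pi) * b := le_mul_of_one_le_left b0 s1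
  have s3 := Real.sqrt_nonneg ((∫ x : ℝ, (u₀ x) ^ 2) + (∫ x : ℝ, (deriv u₀ x) ^ 2) +
                (∫ x : ℝ, (deriv (deriv u₀) x) ^ 2) + (∫ x : ℝ, (v₀ x) ^ 2) +
                (∫ x : ℝ, (deriv v₀ x) ^ 2) + (∫ x : ℝ, (deriv (deriv v₀) x) ^ 2))
  have aδ : a ≤ δ := by linarith
  have bδ : b ≤ δ := by linarith
  have kδ : k ≤ δ := by linarith
  clear hs s3
  have tr : ∀ {f : ℝ → ℝ} {q : ℝ}, (∀ x, |f x| * eX (x ^ 2 / M) ≤ q) → q ≤ δ → ∀ x, |f (e * x)| ≤ δ * eX (-M⁻¹ * (x - 0) ^ 2) := by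
    intro f q hf hq x
    have h := (hf (e * x)).trans hq
    rw [hes, ← le_div_iff₀ (Real.exp_pos _)] at h
    refine h.trans_eq ?_
    rw [div_eq_mul_inv, ← Real.exp_neg, sub_zero]; congr 2; ring
  have du : ∀ x, HasDerivAt (fun x => u₀ (e * x)) (deriv u₀ (e * x) * e) x := by
    intro x
    have := ((cu.differentiable (by norm_num)) (e * x)).hasDerivAt
    exact this.comp x (by simpa using (hasDerivAt_id x).const_mul e)
  have cd : Continuous (deriv u₀) := cu.continuous_deriv (by norm_num)
  have g0 : ∀ x, δ * eX (-M⁻¹ * (x - 0) ^ 2) ≤ δ := fun x => gauss_le hδ0 (by positivity)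
  have cu0 : Continuous fun x => u₀ (e * x) := cu.continuous.comp (by fun_prop)
  have cv0 : Continuous fun x => v₀ (e * x) := cv.continuous.comp (by fun_prop)
  obtain ⟨w, hw, hwf⟩ := exists_fix P (GC_const cu0 fun x => (tr bb bδ x).trans (g0 x)) (GC_const cv0 fun x => (tr ba aδ x).trans (g0 x))
  let D : Dat P M δ :=
    { u₀ := fun x => u₀ (e * x), u₀' := fun x => deriv u₀ (e * x) * e, v₀ := fun x => v₀ (e * x), u := w
      hM := hM, hδ := hδ0, hδ1 := hδ1, hd := du, hd' := (cd.comp (by fun_prop : Continuous fun x : ℝ => e * x)).mul continuous_const, hv := cv0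
      bu := tr bb bδ
      bu' := fun x => by rw [abs_mul, he1, mul_one]; exact tr bk kδ x
      bv := tr ba aδ, hu := hw, hfix := hwf }
  obtain ⟨h1, hg⟩ := hcl δ D hδ2
  have sup : ∀ t x, 0 ≤ t → |D.u t x| + |D.v t x| ≤ ε * (1 + t) ^ xA := by
    intro t x ht
    have i1 := (hu δ D t ht).1 x
    have i2 := (hv δ D t ht).1 x
    have r0 : 0 ≤ (1 + t) ^ xA := Real.rpow_nonneg (by linarith) _
    have := mul_le_mul_of_nonneg_right hδ3 r0
    linarith
  refine ⟨_, _, wrap D h1 hg (e := e) (c₁ := c₁) (c₂ := c₂) (β := β) (γ := γ) (B := ε) he rfl rfl ?_ (fun x => ?_) (fun x => ?_) ?_, fun t ht => ⟨fun x => ?_, ?_⟩⟩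
  · change α * (e * γ / (e * (c₂ - c₁))) - (γ * α / (c₂ - c₁) - β) = β
    rw [mul_div_mul_left _ _ he0]; ring
  · change u₀ (e * (e * x)) = u₀ x
    rw [hee]
  · change v₀ (e * (e * x)) = v₀ x
    rw [hee]
  · intro t x ht
    exact (sup t x ht).trans (mul_le_of_le_one_right hε.le (half_le_one ht))
  · refine (sup t _ ht).trans_eq ?_
    rw [Real.sqrt_eq_rpow, Real.rpow_neg (by linarith), ← div_eq_mul_inv]
  · obtain ⟨-, i1, i2⟩ := hu δ D t ht
    obtain ⟨-, j1, j2⟩ := hv δ D t ht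
    have I := i1.abs.add j1.abs
    have I2 := (I.comp_add_right (e * c₁ * t)).comp_mul_left' he0
    refine ⟨I2, ?_⟩
    have E := Measure.integral_comp_mul_left (fun y => |D.u t (y + e * c₁ * t)| + |D.v t (y + e * c₁ * t)|) e
    rw [abs_inv, he1, inv_one, one_smul, integral_add_right_eq_self (fun y => |D.u t y| + |D.v t y|)] at E
    rw [E, integral_add i1.abs j1.abs]
    linarith
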